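/- Let K be a number field. Then the set {(a₁, a₂) ∈ (Kˣ)² : −a₁a₂ is not a square in K} is diophantine over K. -/

import Mathlib

/-- A subset `S ⊆ K^ι` is diophantine over `K` if there are `m ∈ ℕ` and a polynomial
`f` in the variables `y_i` (`i : ι`) and `x_1, …, x_m` with coefficients in `K` such that
`a ∈ S` iff `f(a, x) = 0` has a solution `x ∈ K^m`. -/
def IsDiophantine {K : Type*} [Field K] {ι : Type*} [Fintype ι] (S : Set (ι → K)) : Prop :=
  ∃ (m : ℕ) (f : MvPolynomial (ι ⊕ Fin m) K),
    ∀ a : ι → K, a ∈ S ↔ ∃ x : Fin m → K, MvPolynomial.eval (Sum.elim a x) f = 0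

section WrapPart1
/-! Part 1: weights on the mixed space -/
open NumberField NumberField.InfinitePlace NumberField.mixedEmbedding NumberField.Units
  NumberField.Units.dirichletUnitTheorem Module

namespace NSq

/-- the tent function -/
noncomputable def tent (y : ℝ) : ℝ := max 0 (1 - |y|)

lemma tent_nonneg (y : ℝ) : 0 ≤ tent y := le_max_left _ _

lemma tent_le_one (y : ℝ) : tent y ≤ 1 := by
  unfold tent; exact max_le (by norm_num) (by linarith [abs_nonneg y])

lemma tent_eq_zero {y : ℝ} (h : 1 ≤ |y|) : tent y = 0 := by
  unfold tent; exact max_eq_left (by linarith)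

lemma tent_lip (x y : ℝ) : |tent x - tent y| ≤ |x - y| := by
  unfold tent
  refine (abs_max_sub_max_le_max _ _ _ _).trans ?_
  simp only [sub_self, abs_zero]
  refine max_le (abs_nonneg _) ?_
  have : 1 - |x| - (1 - |y|) = |y| - |x| := by ring
  rw [this, abs_sub_comm x y]
  exact abs_abs_sub_abs_le _ _

/-- integer translates of the tent sum to one, over an explicit finset -/
lemma tent_sum (y : ℝ) : ∑ k ∈ ({-⌊y⌋, -⌊y⌋ - 1} : Finset ℤ), tent (y + k) = 1 := by
  rw [Finset.sum_pair (by omega)]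
  have h1 := Int.floor_le y
  have h2 := Int.lt_floor_add_one y
  push_cast
  have e1 : tent (y + -(⌊y⌋:ℝ)) = 1 - (y - ⌊y⌋) := by
    unfold tent
    rw [abs_of_nonneg (by linarith), max_eq_right (by linarith)]; ring
  have e2 : tent (y + (-(⌊y⌋:ℝ) - 1)) = (y - ⌊y⌋) := by
    unfold tent
    rw [abs_of_nonpos (by linarith), max_eq_right (by linarith)]; ring
  rw [e1, e2]; ring

lemma tent_zero_of_notMem (y : ℝ) (k : ℤ) (hk : k ∉ ({-⌊y⌋, -⌊y⌋ - 1} : Finset ℤ)) :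
    tent (y + k) = 0 := by
  apply tent_eq_zero
  have h1 := Int.floor_le y
  have h2 := Int.lt_floor_add_one y
  simp only [Finset.mem_insert, Finset.mem_singleton, not_or] at hk
  rcases lt_or_gt_of_ne hk.1 with h | h
  · have h3 : k ≤ -⌊y⌋ - 2 := by omega
    have h4 : (k:ℝ) ≤ -⌊y⌋ - 2 := by exact_mod_cast h3
    rw [abs_of_nonpos (by linarith)]; linarith
  · have h3 : -⌊y⌋ + 1 ≤ k := by omega
    have h4 : -(⌊y⌋:ℝ) + 1 ≤ k := by exact_mod_cast h3
    rw [abs_of_nonneg (by linarith)]; linarith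

lemma tent_hasSum {r : ℕ} (y : Fin r → ℝ) :
    HasSum (fun e : Fin r → ℤ => ∏ i, tent (y i + e i)) 1 := by
  classical
  have h := hasSum_sum_of_ne_finset_zero (L := SummationFilter.unconditional _) (f := fun e : Fin r → ℤ => ∏ i, tent (y i + e i))
    (s := Fintype.piFinset fun i => ({-⌊y i⌋, -⌊y i⌋ - 1} : Finset ℤ)) ?_
  · rw [← Finset.prod_univ_sum (fun i => ({-⌊y i⌋, -⌊y i⌋ - 1} : Finset ℤ))
      (fun i (k : ℤ) => tent (y i + k))] at h
    simpa only [tent_sum, Finset.prod_const_one] using h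
  · intro e he
    rw [Fintype.mem_piFinset] at he
    push Not at he
    obtain ⟨i, hi⟩ := he
    exact Finset.prod_eq_zero (Finset.mem_univ i) (tent_zero_of_notMem _ _ hi)

variable (F : Type*) [Field F] [NumberField F]

open scoped Classical in
/-- the real basis of the log space given by the fundamental units -/
noncomputable def logBasis : Basis (Fin (rank F)) ℝ (logSpace F) :=
  (basisUnitLattice F).ofZLatticeBasis ℝ (unitLattice F)

/-- coordinates of the log map -/
noncomputable def crd (x : mixedSpace F) (i : Fin (rank F)) : ℝ := (logBasis F).repr (logMap x) i

/-- the weight -/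
noncomputable def wt (x : mixedSpace F) : ℝ := ∏ i, tent (crd F x i)

variable {F}

lemma wt_nonneg (x : mixedSpace F) : 0 ≤ wt F x := Finset.prod_nonneg fun _ _ => tent_nonneg _

lemma wt_le_one (x : mixedSpace F) : wt F x ≤ 1 :=
  Finset.prod_le_one (fun _ _ => tent_nonneg _) fun _ _ => tent_le_one _

lemma crd_unit (ζ : torsion F) (e : Fin (rank F) → ℤ) (x : mixedSpace F)
    (hx : mixedEmbedding.norm x ≠ 0) (i : Fin (rank F)) :
    crd F (((ζ : (𝓞 F)ˣ) * ∏ i, (fundSystem F i) ^ (e i)) • x) i = crd F x i + e i := by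
  unfold crd
  rw [logMap_unit_smul _ hx, map_add, Finsupp.add_apply, add_comm]
  congr 1
  rw [ofMul_mul, map_add, ofMul_prod, map_sum]
  rw [(logEmbedding_eq_zero_iff (x := (ζ : (𝓞 F)ˣ))).mpr ζ.2, zero_add]
  have : ∀ j, logEmbedding F (Additive.ofMul (fundSystem F j ^ e j)) = (e j : ℝ) • logBasis F j := by
    intro j
    rw [ofMul_zpow, map_zsmul, logEmbedding_fundSystem, logBasis, Basis.ofZLatticeBasis_apply,
      Int.cast_smul_eq_zsmul]
  simp_rw [this]
  rw [Basis.repr_sum_self]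

/-- units are torsion times integer vectors -/
noncomputable def unitEquiv : (torsion F × (Fin (rank F) → ℤ)) ≃ (𝓞 F)ˣ :=
  Equiv.ofBijective (fun ζe => ζe.1 * ∏ i, (fundSystem F i) ^ (ζe.2 i))
    ⟨fun a _ h => (exist_unique_eq_mul_prod F (a.1 * ∏ i, (fundSystem F i) ^ (a.2 i))).unique rfl h,
     fun u => ⟨_, (exist_unique_eq_mul_prod F u).choose_spec.1.symm⟩⟩

lemma wt_unit_hasSum (x : mixedSpace F) (hx : mixedEmbedding.norm x ≠ 0) :
    HasSum (fun u : (𝓞 F)ˣ => wt F (u • x)) (torsionOrder F : ℝ) := by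
  rw [← (unitEquiv (F := F)).hasSum_iff]
  have h1 : ∀ ζ : torsion F, HasSum (fun e : Fin (rank F) → ℤ =>
      ((fun u : (𝓞 F)ˣ => wt F (u • x)) ∘ (unitEquiv (F := F))) (ζ, e)) 1 := by
    intro ζ
    have : (fun e : Fin (rank F) → ℤ =>
      ((fun u : (𝓞 F)ˣ => wt F (u • x)) ∘ (unitEquiv (F := F))) (ζ, e)) =
      fun e => ∏ i, tent (crd F x i + e i) := by
      ext e
      simp only [Function.comp, wt]
      refine Finset.prod_congr rfl fun i _ => ?_
      rw [← crd_unit ζ e x hx i]; rfl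
    rw [this]; exact tent_hasSum _
  have h2 : Summable ((fun u : (𝓞 F)ˣ => wt F (u • x)) ∘ (unitEquiv (F := F))) := by
    refine (summable_prod_of_nonneg (fun _ => wt_nonneg _)).mpr ?_
    exact ⟨fun ζ => (h1 ζ).summable, Summable.of_finite⟩
  have h3 := h2.hasSum.prod_fiberwise h1
  have h4 : HasSum (fun _ : torsion F => (1:ℝ)) (torsionOrder F : ℝ) := by
    have := Fintype.ofFinite (torsion F)
    simpa [torsionOrder] using hasSum_fintype (fun _ : torsion F => (1:ℝ))
  rw [← h3.unique h4]; exact h2.hasSum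

end NSq
end WrapPart1

section WrapPart2
/-! Part 2: estimates -/
open NumberField NumberField.InfinitePlace NumberField.mixedEmbedding NumberField.Units
  NumberField.Units.dirichletUnitTheorem Module

namespace NSq
section P2
open scoped Classical
set_option linter.unusedSectionVars false

lemma prod_lip {ι : Type*} (s : Finset ι) (a b : ι → ℝ) (ha : ∀ i, 0 ≤ a i) (ha' : ∀ i, a i ≤ 1)
    (hb : ∀ i, 0 ≤ b i) (hb' : ∀ i, b i ≤ 1) :
    |∏ i ∈ s, a i - ∏ i ∈ s, b i| ≤ ∑ i ∈ s, |a i - b i| := by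
  classical
  induction s using Finset.induction_on with
  | empty => simp
  | insert i s hi ih =>
    rw [Finset.prod_insert hi, Finset.prod_insert hi, Finset.sum_insert hi]
    have h1 : ∏ j ∈ s, a j ≤ 1 := Finset.prod_le_one (fun i _ => ha i) fun i _ => ha' i
    have h0 : 0 ≤ ∏ j ∈ s, a j := Finset.prod_nonneg (fun i _ => ha i)
    have e : a i * ∏ j ∈ s, a j - b i * ∏ j ∈ s, b j =
      (a i - b i) * ∏ j ∈ s, a j + b i * (∏ j ∈ s, a j - ∏ j ∈ s, b j) := by ring
    rw [e]
    refine (abs_add_le _ _).trans (add_le_add ?_ ?_)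
    · rw [abs_mul, abs_of_nonneg h0]
      exact mul_le_of_le_one_right (abs_nonneg _) h1
    · rw [abs_mul, abs_of_nonneg (hb i)]
      exact (mul_le_of_le_one_left (abs_nonneg _) (hb' i)).trans ih

variable {F : Type*} [Field F] [NumberField F]

lemma log_norm (x : mixedSpace F) (hx : mixedEmbedding.norm x ≠ 0) :
    Real.log (mixedEmbedding.norm x) = ∑ w, (mult w : ℝ) * Real.log (normAtPlace w x) := by
  rw [mixedEmbedding.norm_apply, Real.log_prod]
  · simp
  · intro w _
    exact pow_ne_zero _ (mixedEmbedding.norm_ne_zero_iff.mp hx w)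

lemma sum_mult : ∑ w : InfinitePlace F, (mult w : ℝ) = finrank ℚ F := by
  rw [← InfinitePlace.sum_mult_eq]; push_cast; rfl

lemma one_le_mult' (w : InfinitePlace F) : (1:ℝ) ≤ mult w := by
  exact_mod_cast mult_pos

lemma mult_le_two' (w : InfinitePlace F) : (mult w : ℝ) ≤ 2 := by
  rw [mult]; split_ifs <;> norm_num

variable (F) in
lemma exists_log_bound : ∃ A : ℝ, 0 ≤ A ∧ ∀ x : mixedSpace F, mixedEmbedding.norm x ≠ 0 →
    wt F x ≠ 0 → ∀ w, |Real.log (normAtPlace w x) -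
      Real.log (mixedEmbedding.norm x) * (finrank ℚ F : ℝ)⁻¹| ≤ A := by
  set A := ∑ i, ‖logBasis F i‖ with hA
  have hA0 : 0 ≤ A := Finset.sum_nonneg fun _ _ => norm_nonneg _
  have hn : (finrank ℚ F : ℝ) ≠ 0 := by
    exact_mod_cast (finrank_pos (R := ℚ) (M := F)).ne'
  refine ⟨A + Fintype.card (InfinitePlace F) * A, by positivity, fun x hx hw => ?_⟩
  have h1 : ∀ i, |crd F x i| ≤ 1 := by
    intro i
    by_contra h
    push Not at h
    exact hw (Finset.prod_eq_zero (Finset.mem_univ i) (tent_eq_zero h.le))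
  have h2 : ‖logMap x‖ ≤ A := by
    rw [← (logBasis F).sum_repr (logMap x)]
    refine norm_sum_le_of_le _ fun i _ => ?_
    rw [_root_.norm_smul]
    exact mul_le_of_le_one_left (norm_nonneg _) (h1 i)
  set t : InfinitePlace F → ℝ := fun w => Real.log (normAtPlace w x) -
      Real.log (mixedEmbedding.norm x) * (finrank ℚ F : ℝ)⁻¹ with ht
  have h3 : ∀ w, w ≠ w₀ → |mult w * t w| ≤ A := by
    intro w hw0
    have := (norm_le_pi_norm (logMap x) ⟨w, hw0⟩).trans h2
    rwa [Real.norm_eq_abs, logMap_apply] at this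
  have h4 : ∑ w, mult w * t w = 0 := by
    simp only [ht, mul_sub, Finset.sum_sub_distrib]
    rw [← log_norm x hx, ← Finset.sum_mul, sum_mult]
    field_simp; ring
  have h5 : ∀ w, |mult w * t w| ≤ A + Fintype.card (InfinitePlace F) * A := by
    intro w
    by_cases hw0 : w = w₀
    · rw [← Finset.add_sum_erase _ _ (Finset.mem_univ w)] at h4
      rw [eq_neg_of_add_eq_zero_left h4, abs_neg]
      refine (Finset.abs_sum_le_sum_abs _ _).trans ?_
      refine (Finset.sum_le_card_nsmul _ _ A fun v hv => h3 v ?_).trans ?_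
      · rw [← hw0]; exact Finset.ne_of_mem_erase hv
      · rw [nsmul_eq_mul]
        have : ((Finset.univ.erase w).card : ℝ) ≤ Fintype.card (InfinitePlace F) := by
          exact_mod_cast Finset.card_le_univ _
        nlinarith
    · refine (h3 w hw0).trans ?_
      have : 0 ≤ (Fintype.card (InfinitePlace F) : ℝ) * A := by positivity
      linarith
  intro w
  refine le_trans ?_ (h5 w)
  rw [abs_mul, abs_of_pos (a := (mult w : ℝ)) (by linarith [one_le_mult' w])]
  exact le_mul_of_one_le_left (abs_nonneg _) (one_le_mult' w)

lemma normAtPlace_le_norm (w : InfinitePlace F) (x : mixedSpace F) : normAtPlace w x ≤ ‖x‖ := by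
  rw [norm_eq_sup'_normAtPlace]
  exact Finset.le_sup' (fun w => normAtPlace w x) (Finset.mem_univ w)

lemma exists_normAtPlace_eq_norm (x : mixedSpace F) : ∃ w, normAtPlace w x = ‖x‖ := by
  rw [norm_eq_sup'_normAtPlace]
  obtain ⟨w, -, hw⟩ := Finset.exists_mem_eq_sup' Finset.univ_nonempty (fun w => normAtPlace w x)
  exact ⟨w, hw.symm⟩

variable (F) in
lemma exists_balance : ∃ C : ℝ, 1 ≤ C ∧ ∀ x : mixedSpace F, mixedEmbedding.norm x ≠ 0 →
    wt F x ≠ 0 → ∀ w, ‖x‖ ≤ C * normAtPlace w x := by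
  obtain ⟨A, hA, h⟩ := exists_log_bound F
  refine ⟨Real.exp (2 * A), Real.one_le_exp (by linarith), fun x hx hw w => ?_⟩
  obtain ⟨v, hv⟩ := exists_normAtPlace_eq_norm x
  have h1 := abs_le.mp (h x hx hw v)
  have h2 := abs_le.mp (h x hx hw w)
  have pv : 0 < normAtPlace v x :=
    lt_of_le_of_ne (normAtPlace_nonneg v x) (mixedEmbedding.norm_ne_zero_iff.mp hx v).symm
  have pw : 0 < normAtPlace w x :=
    lt_of_le_of_ne (normAtPlace_nonneg w x) (mixedEmbedding.norm_ne_zero_iff.mp hx w).symm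
  rw [← hv, ← Real.log_le_log_iff pv (by positivity), Real.log_mul (Real.exp_pos _).ne' pw.ne',
    Real.log_exp]
  linarith

variable (F) in
lemma exists_wt_lip : ∃ C : ℝ, 0 ≤ C ∧ ∀ x y : mixedSpace F, mixedEmbedding.norm x ≠ 0 →
    mixedEmbedding.norm y ≠ 0 → ∀ η : ℝ, 0 ≤ η →
    (∀ w, |Real.log (normAtPlace w x) - Real.log (normAtPlace w y)| ≤ η) →
    |wt F x - wt F y| ≤ C * η := by
  have hn : (0:ℝ) < (finrank ℚ F : ℝ) := by
    exact_mod_cast (finrank_pos (R := ℚ) (M := F))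
  let φ : Fin (rank F) → (logSpace F →L[ℝ] ℝ) := fun i =>
    LinearMap.toContinuousLinearMap ((logBasis F).coord i)
  refine ⟨∑ i, ‖φ i‖ * 4, by positivity, fun x y hx hy η hη h => ?_⟩
  have hN : |Real.log (mixedEmbedding.norm x) - Real.log (mixedEmbedding.norm y)| ≤
      finrank ℚ F * η := by
    rw [log_norm x hx, log_norm y hy, ← Finset.sum_sub_distrib, ← sum_mult, Finset.sum_mul]
    refine (Finset.abs_sum_le_sum_abs _ _).trans (Finset.sum_le_sum fun w _ => ?_)
    rw [← mul_sub, abs_mul, abs_of_pos (by linarith [one_le_mult' w])]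
    exact mul_le_mul_of_nonneg_left (h w) (by linarith [one_le_mult' w])
  have hN' : |Real.log (mixedEmbedding.norm x) * (finrank ℚ F : ℝ)⁻¹
      - Real.log (mixedEmbedding.norm y) * (finrank ℚ F : ℝ)⁻¹| ≤ η := by
    rw [← sub_mul, abs_mul, abs_of_pos (inv_pos.mpr hn), ← div_eq_mul_inv, div_le_iff₀ hn]
    linarith
  have hL : ‖logMap x - logMap y‖ ≤ 4 * η := by
    refine (pi_norm_le_iff_of_nonneg (by positivity)).mpr fun w => ?_
    rw [Pi.sub_apply, logMap_apply, logMap_apply, Real.norm_eq_abs, ← mul_sub, abs_mul,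
      abs_of_pos (by linarith [one_le_mult' w.1])]
    have h1 := h w.1
    have : |Real.log (normAtPlace w.1 x) - Real.log (mixedEmbedding.norm x) * (finrank ℚ F : ℝ)⁻¹
        - (Real.log (normAtPlace w.1 y) - Real.log (mixedEmbedding.norm y) * (finrank ℚ F : ℝ)⁻¹)|
        ≤ 2 * η := by
      rw [abs_le] at *
      constructor <;> linarith
    nlinarith [mult_le_two' w.1, one_le_mult' w.1, abs_nonneg (Real.log (normAtPlace w.1 x) -
      Real.log (mixedEmbedding.norm x) * (finrank ℚ F : ℝ)⁻¹
        - (Real.log (normAtPlace w.1 y) - Real.log (mixedEmbedding.norm y) * (finrank ℚ F : ℝ)⁻¹))]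
  unfold wt
  refine (prod_lip _ _ _ (fun _ => tent_nonneg _) (fun _ => tent_le_one _)
    (fun _ => tent_nonneg _) (fun _ => tent_le_one _)).trans ?_
  rw [Finset.sum_mul]
  refine Finset.sum_le_sum fun i _ => (tent_lip _ _).trans ?_
  have : crd F x i - crd F y i = φ i (logMap x - logMap y) := by
    simp [φ, crd]
  rw [this, ← Real.norm_eq_abs]
  refine ((φ i).le_opNorm _).trans ?_
  rw [mul_assoc]
  exact mul_le_mul_of_nonneg_left hL (norm_nonneg _)

end P2
end NSq
end WrapPart2

section WrapPart3
/-! Part 3: difference estimate for the weighted norm function -/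
open NumberField NumberField.InfinitePlace NumberField.mixedEmbedding NumberField.Units
  NumberField.Units.dirichletUnitTheorem Module

namespace NSq
section P3
open scoped Classical
set_option linter.unusedSectionVars false

variable {F : Type*} [Field F] [NumberField F]

lemma exp_diff_le (a b : ℝ) : |Real.exp a - Real.exp b| ≤ |a - b| * max (Real.exp a) (Real.exp b) := by
  wlog h : b ≤ a generalizing a b
  · rw [abs_sub_comm, abs_sub_comm a b, max_comm]; exact this b a (le_of_not_ge h)
  rw [abs_of_nonneg (sub_nonneg.mpr (Real.exp_le_exp.mpr h)), abs_of_nonneg (sub_nonneg.mpr h),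
    max_eq_left (Real.exp_le_exp.mpr h)]
  have h1 := Real.add_one_le_exp (b - a)
  have h2 : Real.exp b = Real.exp a * Real.exp (b - a) := by rw [← Real.exp_add]; congr 1; ring
  rw [h2]
  nlinarith [Real.exp_pos a]

lemma log_diff_le {a b m : ℝ} (hm : 0 < m) (ha : m ≤ a) (hb : m ≤ b) :
    |Real.log a - Real.log b| ≤ |a - b| / m := by
  wlog h : b ≤ a generalizing a b
  · rw [abs_sub_comm, abs_sub_comm a b]; exact this hb ha (le_of_not_ge h)
  have hb0 : 0 < b := by linarith
  rw [abs_of_nonneg (sub_nonneg.mpr (Real.log_le_log hb0 h)), abs_of_nonneg (sub_nonneg.mpr h),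
    ← Real.log_div (by linarith) hb0.ne']
  refine (Real.log_le_sub_one_of_pos (div_pos (by linarith) hb0)).trans ?_
  have : a / b - 1 = (a - b) / b := by field_simp
  rw [this]
  exact div_le_div_of_nonneg_left (by linarith) hm hb

/-- the weighted function -/
noncomputable def fs (s : ℝ) (x : mixedSpace F) : ℝ := wt F x * (mixedEmbedding.norm x) ^ (-s)

lemma fs_nonneg (s : ℝ) (x : mixedSpace F) : 0 ≤ fs s x :=
  mul_nonneg (wt_nonneg x) (Real.rpow_nonneg (mixedEmbedding.norm_nonneg x) _)

lemma norm_lower (x : mixedSpace F) {m : ℝ} (hm : 0 ≤ m) (h : ∀ w, m ≤ normAtPlace w x) :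
    m ^ (finrank ℚ F) ≤ mixedEmbedding.norm x := by
  rw [mixedEmbedding.norm_apply, ← InfinitePlace.sum_mult_eq, ← Finset.prod_pow_eq_pow_sum]
  exact Finset.prod_le_prod (fun w _ => pow_nonneg hm _) fun w _ => pow_le_pow_left₀ hm (h w) _

lemma normAtPlace_diff (w : InfinitePlace F) (x y : mixedSpace F) :
    |normAtPlace w x - normAtPlace w y| ≤ ‖x - y‖ := by
  rw [abs_le]
  have h1 := normAtPlace_add_le w (x - y) y
  have h2 := normAtPlace_add_le w (-(x - y)) x
  rw [sub_add_cancel] at h1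
  rw [normAtPlace_neg, neg_sub, sub_add_cancel] at h2
  have := normAtPlace_le_norm w (x - y)
  constructor <;> linarith

variable (F) in
lemma exists_sym_bound (D : ℝ) (hD : 0 ≤ D) : ∃ R C : ℝ, 0 < R ∧ 0 ≤ C ∧ ∀ x y : mixedSpace F,
    ‖x - y‖ ≤ D → R ≤ ‖y‖ → ∀ s : ℝ, 1 < s → s ≤ 2 → fs s y ≠ 0 →
    |fs s x - fs s y| ≤ C * (‖y‖ ^ (finrank ℚ F + 1))⁻¹ := by
  obtain ⟨C1, hC1, hbal⟩ := exists_balance F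
  obtain ⟨C2, hC2, hlip⟩ := exists_wt_lip F
  set n := finrank ℚ F with hn
  refine ⟨2 * C1 * (D + 1), (C2 + 2 * n) * (D * (2 * C1)) * (2 * C1) ^ n, by positivity,
    by positivity, fun x y hxy hy s hs hs' hf => ?_⟩
  have hNy : mixedEmbedding.norm y ≠ 0 := by
    intro h
    apply hf
    rw [fs, h, Real.zero_rpow (by linarith), mul_zero]
  have hwy : wt F y ≠ 0 := fun h => hf (by rw [fs, h, zero_mul])
  have hC1' : 0 < 2 * C1 := by linarith
  set m := ‖y‖ / (2 * C1) with hm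
  have hy0 : 0 < ‖y‖ := lt_of_lt_of_le (by positivity) hy
  have hmD : D + 1 ≤ m := by
    rw [hm, le_div_iff₀ hC1']; linarith
  have hm0 : 0 < m := by linarith
  have hyw : ∀ w, 2 * m ≤ normAtPlace w y := by
    intro w
    have := hbal y hNy hwy w
    rw [hm, show 2 * (‖y‖ / (2 * C1)) = ‖y‖ / C1 by field_simp, div_le_iff₀ (by linarith)]
    linarith
  have hd := fun w => (normAtPlace_diff w x y).trans hxy
  have hxw : ∀ w, m ≤ normAtPlace w x := by
    intro w
    have := (abs_le.mp (hd w)).1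
    linarith [hyw w]
  have hyw' : ∀ w, m ≤ normAtPlace w y := fun w => by linarith [hyw w]
  have hNx : mixedEmbedding.norm x ≠ 0 :=
    mixedEmbedding.norm_ne_zero_iff.mpr fun w => by linarith [hxw w]
  set η := D / m with hη
  have hη0 : 0 ≤ η := by positivity
  have hlog : ∀ w, |Real.log (normAtPlace w x) - Real.log (normAtPlace w y)| ≤ η := fun w =>
    (log_diff_le hm0 (hxw w) (hyw' w)).trans (div_le_div_of_nonneg_right (hd w) hm0.le)
  have hw := hlip x y hNx hNy η hη0 hlog
  have hN : |Real.log (mixedEmbedding.norm x) - Real.log (mixedEmbedding.norm y)| ≤ n * η := by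
    rw [log_norm x hNx, log_norm y hNy, ← Finset.sum_sub_distrib, ← sum_mult, Finset.sum_mul]
    refine (Finset.abs_sum_le_sum_abs _ _).trans (Finset.sum_le_sum fun w _ => ?_)
    rw [← mul_sub, abs_mul, abs_of_pos (by linarith [one_le_mult' w])]
    exact mul_le_mul_of_nonneg_left (hlog w) (by linarith [one_le_mult' w])
  have hM : ∀ z : mixedSpace F, (∀ w, m ≤ normAtPlace w z) →
      mixedEmbedding.norm z ^ (-s) ≤ (m ^ n)⁻¹ := by
    intro z hz
    have h1 := norm_lower z hm0.le hz
    have h2 : 1 ≤ m ^ n := one_le_pow₀ (by linarith)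
    calc mixedEmbedding.norm z ^ (-s) ≤ mixedEmbedding.norm z ^ (-1 : ℝ) :=
          Real.rpow_le_rpow_of_exponent_le (h2.trans h1) (by linarith)
      _ = (mixedEmbedding.norm z)⁻¹ := Real.rpow_neg_one _
      _ ≤ _ := inv_anti₀ (by linarith) h1
  have px : 0 < mixedEmbedding.norm x := lt_of_le_of_ne (mixedEmbedding.norm_nonneg x) hNx.symm
  have py : 0 < mixedEmbedding.norm y := lt_of_le_of_ne (mixedEmbedding.norm_nonneg y) hNy.symm
  have hpow : |mixedEmbedding.norm x ^ (-s) - mixedEmbedding.norm y ^ (-s)| ≤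
      2 * (n * η) * (m ^ n)⁻¹ := by
    have hx' := hM x hxw
    have hy' := hM y hyw'
    rw [Real.rpow_def_of_pos px, Real.rpow_def_of_pos py] at *
    refine (exp_diff_le _ _).trans ?_
    refine mul_le_mul ?_ (max_le hx' hy') (le_max_of_le_left (Real.exp_pos _).le) (by positivity)
    rw [← sub_mul, abs_mul, abs_neg, abs_of_pos (by linarith : 0 < s), mul_comm]
    exact mul_le_mul hs' hN (abs_nonneg _) (by norm_num)
  have e : fs s x - fs s y = (wt F x - wt F y) * mixedEmbedding.norm x ^ (-s) +
      wt F y * (mixedEmbedding.norm x ^ (-s) - mixedEmbedding.norm y ^ (-s)) := by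
    unfold fs; ring
  have hx' := hM x hxw
  have hx0 : 0 ≤ mixedEmbedding.norm x ^ (-s) := Real.rpow_nonneg px.le _
  calc |fs s x - fs s y| ≤ C2 * η * (m ^ n)⁻¹ + 2 * (n * η) * (m ^ n)⁻¹ := by
        rw [e]
        refine (abs_add_le _ _).trans (add_le_add ?_ ?_)
        · rw [abs_mul, abs_of_nonneg hx0]
          exact mul_le_mul hw hx' hx0 (by positivity)
        · rw [abs_mul, abs_of_nonneg (wt_nonneg y)]
          exact (mul_le_of_le_one_left (abs_nonneg _) (wt_le_one y)).trans hpow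
    _ = (C2 + 2 * n) * (D * (2 * C1)) * (2 * C1) ^ n * (‖y‖ ^ (n + 1))⁻¹ := by
        rw [hη, hm, div_pow, pow_succ]
        field_simp

variable (F) in
lemma exists_shift_bound (δ : mixedSpace F) : ∃ R C : ℝ, 0 < R ∧ 0 ≤ C ∧ ∀ x : mixedSpace F,
    R ≤ ‖x‖ → ∀ s : ℝ, 1 < s → s ≤ 2 →
    |fs s (x + δ) - fs s x| ≤ C * (‖x‖ ^ (finrank ℚ F + 1))⁻¹ := by
  obtain ⟨R, C, hR, hC, h⟩ := exists_sym_bound F ‖δ‖ (norm_nonneg _)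
  refine ⟨2 * R + 2 * ‖δ‖, C * 2 ^ (finrank ℚ F + 1), by positivity, by positivity,
    fun x hx s hs hs' => ?_⟩
  have hx0 : 0 < ‖x‖ := by linarith [norm_nonneg δ]
  by_cases h1 : fs s x = 0
  · by_cases h2 : fs s (x + δ) = 0
    · rw [h1, h2, sub_zero, abs_zero]; positivity
    · have hn : ‖x‖ / 2 ≤ ‖x + δ‖ := by
        have := norm_sub_le (x + δ) δ
        rw [add_sub_cancel_right] at this
        linarith
      have := h x (x + δ) (by rw [sub_add_cancel_left, norm_neg]) (by linarith [norm_nonneg δ]) s hs hs' h2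
      rw [abs_sub_comm]
      refine this.trans ?_
      rw [mul_assoc]
      refine mul_le_mul_of_nonneg_left ?_ hC
      calc (‖x + δ‖ ^ (finrank ℚ F + 1))⁻¹ ≤ ((‖x‖ / 2) ^ (finrank ℚ F + 1))⁻¹ :=
            inv_anti₀ (by positivity) (pow_le_pow_left₀ (by positivity) hn _)
        _ = _ := by rw [div_pow]; field_simp
  · refine (h (x + δ) x (by rw [add_sub_cancel_left]) (by linarith [norm_nonneg δ]) s hs hs' h1).trans ?_
    refine mul_le_mul_of_nonneg_right ?_ (by positivity)
    exact le_mul_of_one_le_right hC (one_le_pow₀ (by norm_num))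

lemma summable_lat {E T : Type*} [NormedAddCommGroup E] [NormedSpace ℝ E] [FiniteDimensional ℝ E]
    (L : Submodule ℤ E) [DiscreteTopology L] (j : T → E) (hj : Function.Injective j)
    (hm : ∀ t, j t ∈ L) (r : ℝ) (hr : r < -(finrank ℤ L : ℝ)) :
    Summable fun t => ‖j t‖ ^ r := by
  have h1 := ZLattice.summable_norm_rpow L r hr
  have h2 := h1.comp_injective (i := fun t => (⟨j t, hm t⟩ : L))
    (fun a b hab => hj (congrArg Subtype.val hab))
  exact h2

lemma summable_int : Summable fun γ : 𝓞 F => ‖mixedEmbedding F γ‖ ^ (-((finrank ℚ F : ℝ) + 1)) := by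
  apply summable_lat (mixedEmbedding.integerLattice F) (fun γ : 𝓞 F => mixedEmbedding F γ)
  · intro a b hab
    exact RingOfIntegers.ext (mixedEmbedding_injective F hab)
  · intro γ
    exact ⟨γ, by simp⟩
  · have hrk : finrank ℤ (mixedEmbedding.integerLattice F) = finrank ℚ F := by
      rw [ZLattice.rank ℝ (mixedEmbedding.integerLattice F), mixedEmbedding.finrank]
    rw [hrk]; linarith

/-- summable majorant over the ring of integers -/
lemma exists_majorant (δ : 𝓞 F) : ∃ h : 𝓞 F → ℝ, Summable h ∧ ∀ γ : 𝓞 F, ∀ s : ℝ, 1 < s → s ≤ 2 →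
    |fs s (mixedEmbedding F (γ + δ : 𝓞 F)) - fs s (mixedEmbedding F γ)| ≤ h γ := by
  obtain ⟨R, C, hR, hC, hb⟩ := exists_shift_bound F (mixedEmbedding F δ)
  have hinteg : ∀ (γ : 𝓞 F) (s : ℝ), 1 < s → fs s (mixedEmbedding F γ) ≤ 1 := by
    intro γ s hs
    unfold fs
    refine mul_le_one₀ (wt_le_one _) (Real.rpow_nonneg (mixedEmbedding.norm_nonneg _) _) ?_
    by_cases hγ : γ = 0
    · subst hγ
      simp only [map_zero]
      rw [Real.zero_rpow (by linarith)]; norm_num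
    · apply Real.rpow_le_one_of_one_le_of_nonpos _ (by linarith)
      rw [norm_eq_norm]
      have h0 : Algebra.norm ℤ γ ≠ 0 := Algebra.norm_ne_zero_iff.mpr hγ
      rw [← Algebra.coe_norm_int]
      exact_mod_cast Int.one_le_abs h0
  have hs1 := summable_int (F := F)
  have hfin : {γ : 𝓞 F | ‖mixedEmbedding F γ‖ < R}.Finite := by
    have h1 := hs1.tendsto_cofinite_zero
    have h2 : ∀ᶠ γ : 𝓞 F in Filter.cofinite,
        ‖mixedEmbedding F γ‖ ^ (-((finrank ℚ F : ℝ) + 1)) < R ^ (-((finrank ℚ F : ℝ) + 1)) :=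
      h1.eventually_lt_const (Real.rpow_pos_of_pos hR _)
    refine (Set.Finite.union (Filter.eventually_cofinite.mp h2) (Set.finite_singleton 0)).subset ?_
    intro γ hγ
    by_cases h0 : γ = 0
    · right; exact h0
    · left
      have : 0 < ‖mixedEmbedding F γ‖ := by
        rw [norm_pos_iff]
        intro h
        rw [map_eq_zero] at h
        exact h0 (RingOfIntegers.ext h)
      simp only [Set.mem_setOf_eq, not_lt]
      exact Real.rpow_le_rpow_of_nonpos this (le_of_lt hγ) (by linarith [(finrank ℚ F).cast_nonneg (α := ℝ)])
  refine ⟨fun γ => C * ‖mixedEmbedding F γ‖ ^ (-((finrank ℚ F : ℝ) + 1)) +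
    (if ‖mixedEmbedding F γ‖ < R then 1 else 0), ?_, fun γ s hs hs' => ?_⟩
  · refine (hs1.mul_left C).add ?_
    refine summable_of_finite_support (hfin.subset ?_)
    intro γ hγ
    by_contra h
    simp only [Set.mem_setOf_eq] at h
    simp [h] at hγ
  · have hp : 0 ≤ C * ‖mixedEmbedding F γ‖ ^ (-((finrank ℚ F : ℝ) + 1)) := by positivity
    by_cases hγ : ‖mixedEmbedding F γ‖ < R
    · simp only [if_pos hγ]
      have := abs_sub_le_of_nonneg_of_le (fs_nonneg s (mixedEmbedding F (γ + δ : 𝓞 F))) (hinteg _ s hs)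
        (fs_nonneg s (mixedEmbedding F γ)) (hinteg _ s hs)
      linarith
    · simp only [if_neg hγ, add_zero]
      have := hb (mixedEmbedding F γ) (not_lt.mp hγ) s hs hs'
      rw [← map_add] at this
      rw [show ((γ + δ : 𝓞 F) : F) = (γ : F) + (δ : F) by rfl]
      refine this.trans (le_of_eq ?_)
      congr 1
      rw [Real.rpow_neg (norm_nonneg _)]
      congr 1
      exact_mod_cast (Real.rpow_natCast _ (finrank ℚ F + 1)).symm

end P3
end NSq
end WrapPart3

section WrapPart4
/-! Part 4: zeta sums over ideals -/
open NumberField NumberField.InfinitePlace NumberField.Units Module nonZeroDivisors Ideal Filter Topology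

namespace NSq
section P4
open scoped Classical
set_option linter.unusedSectionVars false

variable (F : Type*) [Field F] [NumberField F]

/-- norm of a nonzero ideal -/
noncomputable def nm {F : Type*} [Field F] [NumberField F] (I : (Ideal (𝓞 F))⁰) : ℝ := (absNorm (I : Ideal (𝓞 F)) : ℝ)

lemma nm_nat {F : Type*} [Field F] [NumberField F] (I : (Ideal (𝓞 F))⁰) :
    absNorm (I : Ideal (𝓞 F)) ≠ 0 := by
  rw [Ne, absNorm_eq_zero_iff]
  exact nonZeroDivisors.ne_zero I.2

lemma one_le_nm {F : Type*} [Field F] [NumberField F] (I : (Ideal (𝓞 F))⁰) : 1 ≤ nm I := by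
  unfold nm
  exact_mod_cast Nat.one_le_iff_ne_zero.mpr (nm_nat I)

lemma nm_mul {F : Type*} [Field F] [NumberField F] (I J : (Ideal (𝓞 F))⁰) : nm (I * J) = nm I * nm J := by
  unfold nm; simp

/-- real Dedekind zeta as sum over ideals -/
noncomputable def Z (s : ℝ) : ℝ := ∑' I : (Ideal (𝓞 F))⁰, nm I ^ (-s)

lemma lser_summable {s : ℝ} (hs : 1 < s) :
    LSeriesSummable (fun n ↦ ((Nat.card {I : Ideal (𝓞 F) // absNorm I = n} : ℝ) : ℂ)) s := by
  refine LSeriesSummable_of_sum_norm_bigO_and_nonneg (r := 1)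
    (f := fun n => (Nat.card {I : Ideal (𝓞 F) // absNorm I = n} : ℝ)) ?_ (fun _ => Nat.cast_nonneg _)
    zero_le_one (by simpa using hs)
  have h : Tendsto (fun n : ℕ => (∑ k ∈ Finset.Icc 1 n, (Nat.card {I : Ideal (𝓞 F) // absNorm I = k} : ℝ)) / n)
      atTop (𝓝 (dedekindZeta_residue F)) := by
    refine ((Ideal.tendsto_norm_le_div_atTop₀ F).comp tendsto_natCast_atTop_atTop).congr fun n ↦ ?_
    simp only [Function.comp_apply, Nat.cast_le, ← Nat.cast_sum]
    congr
    rw [← add_left_inj 1, ← card_norm_le_eq_card_norm_le_add_one,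
      show Finset.Icc 1 n = Finset.Ioc 0 n from Finset.Icc_succ_left_eq_Ioc _ _,
      show 1 = Nat.card {I : Ideal (𝓞 F) // absNorm I = 0} by simp [Ideal.absNorm_eq_zero_iff],
      Finset.sum_Ioc_add_eq_sum_Icc (n.zero_le),
      ← Finset.card_preimage_eq_sum_card_image_eq (fun k _ ↦ finite_setOfPred_absNorm_eq k)]
    simp [Set.coe_eq_subtype]
  have h2 := h.isBigO_one ℝ
  have h3 := h2.mul (Asymptotics.isBigO_refl (fun n : ℕ => ((n : ℝ))) atTop)
  refine (h3.congr' ?_ ?_)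
  · filter_upwards [eventually_ge_atTop 1] with n hn
    have : (n : ℝ) ≠ 0 := by positivity
    field_simp
  · filter_upwards with n
    simp

lemma fiber_hasSum {s : ℝ} (hs : 1 < s) (n : ℕ) :
    HasSum (fun I : {I : (Ideal (𝓞 F))⁰ // absNorm (I : Ideal (𝓞 F)) = n} => nm I.1 ^ (-s))
      (if n = 0 then 0 else (Nat.card {I : Ideal (𝓞 F) // absNorm I = n} : ℝ) * (n : ℝ) ^ (-s)) := by
  split_ifs with h
  · subst h
    have : IsEmpty {I : (Ideal (𝓞 F))⁰ // absNorm (I : Ideal (𝓞 F)) = 0} :=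
      ⟨fun I => nm_nat I.1 I.2⟩
    exact hasSum_empty
  · let e : {I : (Ideal (𝓞 F))⁰ // absNorm (I : Ideal (𝓞 F)) = n} ≃ {I : Ideal (𝓞 F) // absNorm I = n} :=
      { toFun := fun I => ⟨I.1, I.2⟩
        invFun := fun I => ⟨⟨I.1, mem_nonZeroDivisors_of_ne_zero (fun h0 => h (by rw [← I.2, h0]; simp))⟩, I.2⟩
        left_inv := fun _ => rfl
        right_inv := fun _ => rfl }
    have : Finite {I : Ideal (𝓞 F) // absNorm I = n} := finite_setOfPred_absNorm_eq n
    have := Fintype.ofFinite {I : Ideal (𝓞 F) // absNorm I = n}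
    rw [← e.symm.hasSum_iff]
    have : ((fun I : {I : (Ideal (𝓞 F))⁰ // absNorm (I : Ideal (𝓞 F)) = n} => nm I.1 ^ (-s)) ∘ e.symm)
        = fun _ => (n : ℝ) ^ (-s) := by
      funext I
      simp only [Function.comp_apply]
      congr 1
      unfold nm
      rw [(e.symm I).2]
    rw [this, Nat.card_eq_fintype_card, ← nsmul_eq_mul]
    convert hasSum_fintype (fun _ : {I : Ideal (𝓞 F) // absNorm I = n} => (n : ℝ) ^ (-s)) using 1
    simp


lemma term_eq (s : ℝ) (n : ℕ) :
    LSeries.term (fun n ↦ ((Nat.card {I : Ideal (𝓞 F) // absNorm I = n} : ℝ) : ℂ)) s n =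
    ((if n = 0 then 0 else (Nat.card {I : Ideal (𝓞 F) // absNorm I = n} : ℝ) * (n : ℝ) ^ (-s) : ℝ) : ℂ) := by
  rw [LSeries.term_def]
  split_ifs with h
  · simp
  · rw [Real.rpow_neg (Nat.cast_nonneg n), div_eq_mul_inv]
    push_cast
    rw [Complex.ofReal_cpow (Nat.cast_nonneg n)]
    simp

lemma Z_summable {s : ℝ} (hs : 1 < s) : Summable (fun I : (Ideal (𝓞 F))⁰ => nm I ^ (-s)) := by
  have h1 := lser_summable F hs
  unfold LSeriesSummable at h1
  rw [funext (term_eq F s), Complex.summable_ofReal] at h1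
  rw [← (Equiv.sigmaFiberEquiv (fun I : (Ideal (𝓞 F))⁰ => absNorm (I : Ideal (𝓞 F)))).summable_iff]
  rw [summable_sigma_of_nonneg]
  · refine ⟨fun n => (fiber_hasSum F hs n).summable, ?_⟩
    refine h1.congr fun n => ?_
    exact (fiber_hasSum F hs n).tsum_eq.symm
  · intro x
    exact Real.rpow_nonneg (zero_le_one.trans (one_le_nm _)) _

lemma Z_eq {s : ℝ} (hs : 1 < s) : (Z F s : ℂ) = dedekindZeta F s := by
  unfold dedekindZeta LSeries Z
  have h0 := (Z_summable F hs)
  rw [← (Equiv.sigmaFiberEquiv (fun I : (Ideal (𝓞 F))⁰ => absNorm (I : Ideal (𝓞 F)))).tsum_eq]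
  rw [← (Equiv.sigmaFiberEquiv (fun I : (Ideal (𝓞 F))⁰ => absNorm (I : Ideal (𝓞 F)))).summable_iff] at h0
  have h1 := h0.tsum_sigma' (fun n => (fiber_hasSum F hs n).summable)
  simp only [Function.comp_def] at h1
  rw [h1, Complex.ofReal_tsum]
  refine tsum_congr fun n => ?_
  have h2 := term_eq F s n
  simp only [Complex.ofReal_natCast] at h2
  rw [h2]
  congr 1
  exact (fiber_hasSum F hs n).tsum_eq

lemma Z_tendsto : Tendsto (fun s : ℝ => (s - 1) * Z F s) (𝓝[>] 1) (𝓝 (dedekindZeta_residue F)) := by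
  have h := tendsto_sub_one_mul_dedekindZeta_nhdsGT F
  have h' := (Complex.continuous_re.tendsto _).comp h
  rw [Complex.ofReal_re] at h'
  refine h'.congr' ?_
  filter_upwards [self_mem_nhdsWithin] with s hs
  simp only [Function.comp_apply]
  rw [← Z_eq F hs, ← Complex.ofReal_one, ← Complex.ofReal_sub, ← Complex.ofReal_mul, Complex.ofReal_re]

/-- bounded near 1 from the right -/
def Bdd (f : ℝ → ℝ) : Prop := ∃ C : ℝ, ∀ᶠ s in 𝓝[>] (1 : ℝ), |f s| ≤ C

lemma Bdd.add {f g : ℝ → ℝ} (hf : Bdd f) (hg : Bdd g) : Bdd (fun s => f s + g s) := by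
  obtain ⟨C, hC⟩ := hf
  obtain ⟨D, hD⟩ := hg
  refine ⟨C + D, ?_⟩
  filter_upwards [hC, hD] with s h1 h2
  exact (abs_add_le _ _).trans (add_le_add h1 h2)

lemma Bdd.neg {f : ℝ → ℝ} (hf : Bdd f) : Bdd (fun s => - f s) := by
  obtain ⟨C, hC⟩ := hf
  exact ⟨C, by simpa only [abs_neg] using hC⟩

lemma Bdd.sub {f g : ℝ → ℝ} (hf : Bdd f) (hg : Bdd g) : Bdd (fun s => f s - g s) := by
  simpa only [sub_eq_add_neg] using hf.add hg.neg

lemma Bdd.const_mul {f : ℝ → ℝ} (c : ℝ) (hf : Bdd f) : Bdd (fun s => c * f s) := by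
  obtain ⟨C, hC⟩ := hf
  refine ⟨|c| * C, ?_⟩
  filter_upwards [hC] with s h
  rw [abs_mul]
  exact mul_le_mul_of_nonneg_left h (abs_nonneg _)

lemma Bdd.sum {ι : Type*} (t : Finset ι) {f : ι → ℝ → ℝ} (hf : ∀ i ∈ t, Bdd (f i)) :
    Bdd (fun s => ∑ i ∈ t, f i s) := by
  induction t using Finset.induction_on with
  | empty => exact ⟨0, by simp⟩
  | insert a t ha ih =>
    simp only [Finset.sum_insert ha]
    exact (hf a (by simp)).add (ih fun i hi => hf i (by simp [hi]))

lemma Bdd.congr {f g : ℝ → ℝ} (hf : Bdd f) (h : ∀ᶠ s in 𝓝[>] (1 : ℝ), f s = g s) : Bdd g := by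
  obtain ⟨C, hC⟩ := hf
  refine ⟨C, ?_⟩
  filter_upwards [hC, h] with s h1 h2
  rwa [← h2]

lemma Bdd.mono {f g : ℝ → ℝ} (hf : Bdd f) (h : ∀ᶠ s in 𝓝[>] (1 : ℝ), |g s| ≤ |f s|) : Bdd g := by
  obtain ⟨C, hC⟩ := hf
  refine ⟨C, ?_⟩
  filter_upwards [hC, h] with s h1 h2
  exact h2.trans h1

lemma gt_one_ev : ∀ᶠ s in 𝓝[>] (1 : ℝ), 1 < s := self_mem_nhdsWithin

lemma le_two_ev : ∀ᶠ s in 𝓝[>] (1 : ℝ), s ≤ 2 :=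
  nhdsWithin_le_nhds (Iic_mem_nhds (by norm_num))

lemma one_le_Z {s : ℝ} (hs : 1 < s) : 1 ≤ Z F s := by
  have := (Z_summable F hs).le_tsum (1 : (Ideal (𝓞 F))⁰)
    (fun j _ => Real.rpow_nonneg (zero_le_one.trans (one_le_nm _)) _)
  have h1 : nm (1 : (Ideal (𝓞 F))⁰) = 1 := by unfold nm; simp
  unfold Z
  simpa [h1] using this

lemma log_Z_bdd : Bdd (fun s => Real.log (Z F s) + Real.log (s - 1)) := by
  have h := ((Z_tendsto F).log (dedekindZeta_residue_ne_zero F)).isBigO_one ℝ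
  obtain ⟨C, hC⟩ := h.bound
  refine ⟨C, ?_⟩
  filter_upwards [hC, gt_one_ev] with s h1 h2
  rw [Real.log_mul (by linarith) (by linarith [one_le_Z F h2])] at h1
  simpa [add_comm] using h1

lemma not_bdd_log : ¬ Bdd (fun s => Real.log (s - 1)) := by
  rintro ⟨C, hC⟩
  have h1 : Tendsto (fun s : ℝ => s - 1) (𝓝[>] 1) (𝓝[>] 0) := by
    refine tendsto_nhdsWithin_iff.mpr ⟨?_, ?_⟩
    · have : Tendsto (fun s : ℝ => s - 1) (𝓝 1) (𝓝 (1 - 1)) := (continuous_id.sub continuous_const).tendsto 1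
      rw [sub_self] at this
      exact this.mono_left nhdsWithin_le_nhds
    · filter_upwards [gt_one_ev] with s hs
      simpa using hs
  have h2 := (Real.tendsto_log_nhdsGT_zero.comp h1).eventually_lt_atBot (-C)
  obtain ⟨s, h3, h4⟩ := (hC.and h2).exists
  simp only [Function.comp_apply] at h4
  have := (abs_le.mp h3).1
  linarith

end P4
end NSq
end WrapPart4

section WrapPart5
/-! Part 5: boundedness of twisted sums -/
open NumberField NumberField.InfinitePlace NumberField.Units Module nonZeroDivisors Ideal Filter Topology

namespace NSq
section P5
open scoped Classical
set_option linter.unusedSectionVars false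

lemma coset_sum {A : Type*} [AddCommGroup A] (B : AddSubgroup A) [Fintype (A ⧸ B)] (c f : A → ℝ)
    (hc : ∀ a, |c a| ≤ 1) (hf : Summable fun a => c a * f a) (τ : A ⧸ B → A)
    (hτ : ∀ x, (QuotientAddGroup.mk (τ x) : A ⧸ B) = x) (hper : ∀ x a, c (a + τ x) = c a)
    (h : A ⧸ B → A → ℝ) (hh : ∀ x, Summable (h x))
    (hle : ∀ x a, |f (a + τ x) - f a| ≤ h x a) :
    |∑' a, c a * f a - (B.index : ℝ) * ∑' b : B, c b * f b| ≤ ∑ x, ∑' a, h x a := by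
  let e : (A ⧸ B) × B ≃ A := Equiv.ofBijective (fun p => (p.2 : A) + τ p.1) (by
    constructor
    · rintro ⟨x, b⟩ ⟨y, b'⟩ hxy
      simp only at hxy
      have h1 := congrArg (QuotientAddGroup.mk : A → A ⧸ B) hxy
      rw [QuotientAddGroup.mk_add, QuotientAddGroup.mk_add, hτ, hτ,
        (QuotientAddGroup.eq_zero_iff _).mpr b.2, (QuotientAddGroup.eq_zero_iff _).mpr b'.2,
        zero_add, zero_add] at h1
      subst h1
      simpa using hxy
    · intro a
      refine ⟨⟨a, ⟨a - τ a, ?_⟩⟩, by simp⟩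
      rw [← QuotientAddGroup.eq_zero_iff, QuotientAddGroup.mk_sub, hτ, sub_self])
  have he : ∀ x (b : B), e (x, b) = b + τ x := fun x b => rfl
  have hs := e.summable_iff.mpr hf
  have hB : Summable fun b : B => c b * f b := hf.comp_injective Subtype.val_injective
  have h1 : ∑' a, c a * f a = ∑ x, ∑' b : B, c b * f (b + τ x) := by
    rw [← e.tsum_eq]
    refine hs.tsum_prod.trans ?_
    rw [tsum_fintype]
    refine Finset.sum_congr rfl fun x _ => tsum_congr fun b => ?_
    simp only [Function.comp_apply]
    rw [he, hper]
  have h2 : (B.index : ℝ) * ∑' b : B, c b * f b = ∑ x : A ⧸ B, ∑' b : B, c b * f b := by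
    rw [Finset.sum_const, nsmul_eq_mul, AddSubgroup.index, Finset.card_univ, Nat.card_eq_fintype_card]
  rw [h1, h2, ← Finset.sum_sub_distrib]
  refine (Finset.abs_sum_le_sum_abs _ _).trans (Finset.sum_le_sum fun x _ => ?_)
  have hsx : Summable fun b : B => c b * f (b + τ x) := by
    have := hs.prod_factor x
    refine this.congr fun b => ?_
    simp only [Function.comp_apply]
    rw [he, hper]
  rw [← hsx.tsum_sub hB]
  have hbx : Summable fun b : B => h x b := (hh x).comp_injective Subtype.val_injective
  have hterm : ∀ b : B, ‖c b * f (b + τ x) - c b * f b‖ ≤ h x b := by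
    intro b
    rw [← mul_sub, Real.norm_eq_abs, abs_mul]
    exact (mul_le_of_le_one_left (abs_nonneg _) (hc _)).trans (hle x b)
  calc |∑' b : B, (c b * f (b + τ x) - c b * f b)| ≤ ∑' b : B, h x b := by
        rw [← Real.norm_eq_abs]
        exact tsum_of_norm_bounded hbx.hasSum hterm
    _ ≤ ∑' a, h x a :=
        hbx.tsum_le_tsum_of_inj (fun b : B => (b : A)) Subtype.val_injective
          (fun a _ => (abs_nonneg _).trans (hle x a)) (fun _ => le_rfl) (hh x)

lemma double_sum {P U : Type*} (a A : P → ℝ) (w : P → U → ℝ) (hw : ∀ p u, 0 ≤ w p u)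
    (hA : Summable A) (haA : ∀ p, |a p| ≤ A p) (t : ℝ) (hu : ∀ p, HasSum (w p) t) :
    HasSum (fun p : P × U => a p.1 * w p.1 p.2) ((∑' p, a p) * t) := by
  have hpos : Summable fun p : P × U => A p.1 * w p.1 p.2 := by
    have hn : (0 : P × U → ℝ) ≤ fun p : P × U => A p.1 * w p.1 p.2 := fun p =>
      mul_nonneg ((abs_nonneg _).trans (haA _)) (hw _ _)
    have h1 : ∀ J, HasSum (fun u => A J * w J u) (A J * t) := fun J => HasSum.mul_left (A J) (hu J)
    refine (summable_prod_of_nonneg hn).mpr ⟨fun J => (h1 J).summable, ?_⟩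
    refine (hA.mul_right t).congr fun J => ?_
    exact (h1 J).tsum_eq.symm
  have hsummable : Summable fun p : P × U => a p.1 * w p.1 p.2 := by
    refine Summable.of_norm_bounded hpos ?_
    rintro ⟨J, u⟩
    rw [Real.norm_eq_abs, abs_mul, abs_of_nonneg (hw _ _)]
    exact mul_le_mul_of_nonneg_right (haA _) (hw _ _)
  have hfin := hsummable.hasSum
  have h5 := (hfin.prod_fiberwise (g := fun p => a p * t) (fun J => HasSum.mul_left (a J) (hu J))).tsum_eq
  rw [← h5, tsum_mul_right] at hfin
  exact hfin

variable {F : Type*} [Field F] [NumberField F]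

/-- natural absolute norm of an element -/
noncomputable def aN (γ : 𝓞 F) : ℕ := absNorm (span {γ})

lemma norm_mixed (γ : 𝓞 F) : mixedEmbedding.norm (mixedEmbedding F γ) = (aN γ : ℝ) := by
  rw [mixedEmbedding.norm_eq_norm, aN, absNorm_span_singleton, ← Algebra.coe_norm_int,
    Nat.cast_natAbs]
  push_cast; rfl

lemma aN_unit_mul (u : (𝓞 F)ˣ) (γ : 𝓞 F) : aN ((u : 𝓞 F) * γ) = aN γ := by
  unfold aN
  rw [span_singleton_mul_left_unit u.isUnit]

/-- partial sums by class -/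
noncomputable def V (χ : ℕ →*₀ ℝ) (C : ClassGroup (𝓞 F)) (s : ℝ) : ℝ :=
  ∑' J : {J : (Ideal (𝓞 F))⁰ // ClassGroup.mk0 J = C}, χ (absNorm (J.1 : Ideal (𝓞 F))) * nm J.1 ^ (-s)

set_option maxHeartbeats 1000000 in
lemma U_hasSum (χ : ℕ →*₀ ℝ) (hχ : ∀ n, |χ n| ≤ 1) (b : (Ideal (𝓞 F))⁰) {s : ℝ} (hs : 1 < s) :
    HasSum (fun γ : (b : Ideal (𝓞 F)) => χ (aN (γ : 𝓞 F)) * fs s (mixedEmbedding F (γ : 𝓞 F)))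
      ((torsionOrder F : ℝ) * χ (absNorm (b : Ideal (𝓞 F))) * nm b ^ (-s) * V χ (ClassGroup.mk0 b)⁻¹ s) := by
  have hg : ∀ J : {J : (Ideal (𝓞 F))⁰ // ClassGroup.mk0 J = (ClassGroup.mk0 b)⁻¹},
      ∃ x : 𝓞 F, x ≠ 0 ∧ (J.1 : Ideal (𝓞 F)) * b = span {x} := fun J =>
    ClassGroup.mk0_eq_mk0_inv_iff.mp J.2
  choose g hg0 hg using hg
  have hmem : ∀ J (u : (𝓞 F)ˣ), (u : 𝓞 F) * g J ∈ (b : Ideal (𝓞 F)) := by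
    intro J u
    apply Ideal.mul_mem_left
    have : g J ∈ (J.1 : Ideal (𝓞 F)) * b := by rw [hg]; exact mem_span_singleton_self _
    exact Ideal.mul_le_right this
  let j : {J : (Ideal (𝓞 F))⁰ // ClassGroup.mk0 J = (ClassGroup.mk0 b)⁻¹} × (𝓞 F)ˣ → (b : Ideal (𝓞 F)) :=
    fun p => ⟨(p.2 : 𝓞 F) * g p.1, hmem p.1 p.2⟩
  have hspan : ∀ J (u : (𝓞 F)ˣ), span {(u : 𝓞 F) * g J} = (J.1 : Ideal (𝓞 F)) * b := by
    intro J u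
    rw [span_singleton_mul_left_unit u.isUnit, hg]
  have hb0 : (b : Ideal (𝓞 F)) ≠ 0 := nonZeroDivisors.ne_zero b.2
  have hj : Function.Injective j := by
    rintro ⟨J, u⟩ ⟨J', u'⟩ h
    have h1 : (u : 𝓞 F) * g J = u' * g J' := congrArg Subtype.val h
    have h2 : (J.1 : Ideal (𝓞 F)) * b = (J'.1 : Ideal (𝓞 F)) * b := by
      rw [← hspan J u, ← hspan J' u', h1]
    have h3 : J = J' := Subtype.ext (Subtype.ext (mul_right_cancel₀ hb0 h2))
    subst h3
    have h4 := mul_right_cancel₀ (hg0 J) h1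
    rw [Units.ext h4]
  have hrange : ∀ γ : (b : Ideal (𝓞 F)), γ ∉ Set.range j →
      χ (aN (γ : 𝓞 F)) * fs s (mixedEmbedding F (γ : 𝓞 F)) = 0 := by
    intro γ hγ
    by_cases h0 : (γ : 𝓞 F) = 0
    · rw [h0]
      unfold aN
      simp
    · exfalso
      apply hγ
      have hd : (b : Ideal (𝓞 F)) ∣ span {(γ : 𝓞 F)} := by
        rw [dvd_span_singleton]; exact γ.2
      obtain ⟨J, hJ⟩ := hd
      have hJ0 : J ≠ 0 := by
        rintro rfl
        rw [mul_zero] at hJ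
        exact h0 (span_singleton_eq_bot.mp hJ)
      let J' : (Ideal (𝓞 F))⁰ := ⟨J, mem_nonZeroDivisors_of_ne_zero hJ0⟩
      have hJ' : ClassGroup.mk0 J' = (ClassGroup.mk0 b)⁻¹ :=
        ClassGroup.mk0_eq_mk0_inv_iff.mpr ⟨γ, h0, by rw [hJ, mul_comm]⟩
      have h1 := hg ⟨J', hJ'⟩
      have h2 : span {g ⟨J', hJ'⟩} = span {(γ : 𝓞 F)} := by rw [← h1, hJ, mul_comm]
      obtain ⟨u, hu⟩ := span_singleton_eq_span_singleton.mp h2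
      exact ⟨(⟨J', hJ'⟩, u), Subtype.ext (by simp only [j]; rw [← hu, mul_comm])⟩
  rw [← hj.hasSum_iff hrange]
  -- termwise formula
  have haN : ∀ J (u : (𝓞 F)ˣ), aN ((u : 𝓞 F) * g J) =
      absNorm (b : Ideal (𝓞 F)) * absNorm (J.1 : Ideal (𝓞 F)) := by
    intro J u
    rw [aN, hspan, map_mul, mul_comm]
  have hfs : ∀ J (u : (𝓞 F)ˣ), fs s (mixedEmbedding F ((u : 𝓞 F) * g J : 𝓞 F)) =
      (nm b ^ (-s) * nm J.1 ^ (-s)) * wt F (u • mixedEmbedding F (g J)) := by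
    intro J u
    rw [fs, norm_mixed, haN, mul_comm (wt F _)]
    congr 1
    · push_cast
      exact Real.mul_rpow (zero_le_one.trans (one_le_nm _)) (zero_le_one.trans (one_le_nm _))
    · rw [mixedEmbedding.unitSMul_smul, ← map_mul, ← map_mul]
  have hgn : ∀ J, mixedEmbedding.norm (mixedEmbedding F (g J)) ≠ 0 := by
    intro J
    rw [norm_mixed]
    unfold aN
    rw [← hg, Nat.cast_ne_zero, map_mul]
    exact mul_ne_zero (nm_nat _) (nm_nat _)
  have hu : ∀ J, HasSum (fun u : (𝓞 F)ˣ => wt F (u • mixedEmbedding F (g J))) (torsionOrder F : ℝ) :=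
    fun J => wt_unit_hasSum _ (hgn J)
  have hnn : ∀ J : (Ideal (𝓞 F))⁰, 0 ≤ nm J ^ (-s) := fun J =>
    Real.rpow_nonneg (zero_le_one.trans (one_le_nm _)) _
  have hZ : Summable fun J : {J : (Ideal (𝓞 F))⁰ // ClassGroup.mk0 J = (ClassGroup.mk0 b)⁻¹} =>
      nm J.1 ^ (-s) := (Z_summable F hs).comp_injective Subtype.val_injective
  have key := double_sum (fun J : {J : (Ideal (𝓞 F))⁰ // ClassGroup.mk0 J = (ClassGroup.mk0 b)⁻¹} =>
      χ (absNorm (b : Ideal (𝓞 F))) * nm b ^ (-s) * (χ (absNorm (J.1 : Ideal (𝓞 F))) * nm J.1 ^ (-s)))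
      (fun J => nm b ^ (-s) * nm J.1 ^ (-s)) (fun J (u : (𝓞 F)ˣ) => wt F (u • mixedEmbedding F (g J)))
      (fun _ _ => wt_nonneg _) (hZ.mul_left _) ?_ (torsionOrder F : ℝ) hu
  · have hv : (torsionOrder F : ℝ) * χ (absNorm (b : Ideal (𝓞 F))) * nm b ^ (-s) *
        V χ (ClassGroup.mk0 b)⁻¹ s =
        (∑' J : {J : (Ideal (𝓞 F))⁰ // ClassGroup.mk0 J = (ClassGroup.mk0 b)⁻¹},
          χ (absNorm (b : Ideal (𝓞 F))) * nm b ^ (-s) * (χ (absNorm (J.1 : Ideal (𝓞 F))) * nm J.1 ^ (-s)))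
        * torsionOrder F := by
      unfold V
      rw [tsum_mul_left]; ring
    rw [hv]
    have hfun : (fun γ : (b : Ideal (𝓞 F)) =>
        χ (aN (γ : 𝓞 F)) * fs s (mixedEmbedding F (γ : 𝓞 F))) ∘ j = fun p =>
        (χ (absNorm (b : Ideal (𝓞 F))) * nm b ^ (-s) *
          (χ (absNorm (p.1.1 : Ideal (𝓞 F))) * nm p.1.1 ^ (-s))) *
        wt F (p.2 • mixedEmbedding F (g p.1)) := by
      funext p
      simp only [Function.comp_apply, j]
      rw [haN, hfs, map_mul]; ring
    rw [hfun]
    exact key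
  · intro J
    rw [abs_mul, abs_mul, abs_mul, abs_of_nonneg (hnn _), abs_of_nonneg (hnn _)]
    refine mul_le_mul ?_ ?_ (mul_nonneg (abs_nonneg _) (hnn _)) (hnn _)
    · exact mul_le_of_le_one_left (hnn _) (hχ _)
    · exact mul_le_of_le_one_left (hnn _) (hχ _)

end P5
end NSq
end WrapPart5

section WrapPart6
/-! Part 6: boundedness of twisted sums, main -/
open NumberField NumberField.InfinitePlace NumberField.Units Module nonZeroDivisors Ideal Filter Topology

namespace NSq
section P6
open scoped Classical
set_option linter.unusedSectionVars false

variable {F : Type*} [Field F] [NumberField F]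

/-- sum over the lattice -/
noncomputable def U (χ : ℕ →*₀ ℝ) (b : (Ideal (𝓞 F))⁰) (s : ℝ) : ℝ :=
  ∑' γ : (b : Ideal (𝓞 F)), χ (aN (γ : 𝓞 F)) * fs s (mixedEmbedding F (γ : 𝓞 F))

lemma U_step (χ : ℕ →*₀ ℝ) (hχ : ∀ n, |χ n| ≤ 1) (q : 𝓞 F)
    (hper : ∀ γ δ : 𝓞 F, χ (aN (γ + q * δ)) = χ (aN γ)) (b I0 : (Ideal (𝓞 F))⁰)
    (hI0 : ∃ i ∈ (I0 : Ideal (𝓞 F)), ∃ y, i + q * y = 1) :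
    Bdd (fun s => U χ b s - nm I0 * U χ (b * I0) s) := by
  obtain ⟨i, hi, y, hiy⟩ := hI0
  set A : AddSubgroup (𝓞 F) := (b : Ideal (𝓞 F)).toAddSubgroup with hA
  set B' : AddSubgroup (𝓞 F) := ((b * I0 : (Ideal (𝓞 F))⁰) : Ideal (𝓞 F)).toAddSubgroup with hB'
  have hle : B' ≤ A := by
    intro x hx
    exact Ideal.mul_le_right (I := (I0 : Ideal (𝓞 F))) (by rw [mul_comm]; exact hx)
  let B : AddSubgroup A := B'.addSubgroupOf A
  have hidx : ∀ I : (Ideal (𝓞 F))⁰, (I : Ideal (𝓞 F)).toAddSubgroup.index = absNorm (I : Ideal (𝓞 F)) := by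
    intro I
    rw [absNorm_apply, Submodule.cardQuot_apply]; rfl
  have hBidx : B.index = absNorm (I0 : Ideal (𝓞 F)) := by
    have h1 := AddSubgroup.relIndex_mul_index hle
    rw [hidx, hidx, Submonoid.coe_mul, map_mul, mul_comm] at h1
    exact mul_left_cancel₀ (nm_nat b) h1
  have hfi : Finite (A ⧸ B) := by
    have : B.index ≠ 0 := by rw [hBidx]; exact nm_nat I0
    exact Nat.finite_of_card_ne_zero this
  have := Fintype.ofFinite (A ⧸ B)
  -- representatives
  have hrep : ∀ x : A ⧸ B, ∃ t : A, (QuotientAddGroup.mk t : A ⧸ B) = x ∧ ∃ δ : 𝓞 F, (t : 𝓞 F) = q * δ := by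
    intro x
    obtain ⟨a, rfl⟩ := QuotientAddGroup.mk_surjective x
    have hm : q * ((a : 𝓞 F) * y) ∈ A := by
      exact Ideal.mul_mem_left (b : Ideal (𝓞 F)) q (Ideal.mul_mem_right y (b : Ideal (𝓞 F)) a.2)
    refine ⟨⟨_, hm⟩, ?_, _, rfl⟩
    rw [QuotientAddGroup.eq]
    change -(q * ((a : 𝓞 F) * y)) + (a : 𝓞 F) ∈ ((b * I0 : (Ideal (𝓞 F))⁰) : Ideal (𝓞 F))
    have : -(q * ((a : 𝓞 F) * y)) + (a : 𝓞 F) = a * i := by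
      rw [show i = 1 - q * y by rw [← hiy]; ring]; ring
    rw [this]
    exact Ideal.mul_mem_mul a.2 hi
  choose τ hτ δ hδ using hrep
  have hmaj : ∀ x : A ⧸ B, ∃ h : 𝓞 F → ℝ, Summable h ∧ ∀ γ : 𝓞 F, ∀ s : ℝ, 1 < s → s ≤ 2 →
    |fs s (mixedEmbedding F (γ + (τ x : 𝓞 F) : 𝓞 F)) - fs s (mixedEmbedding F γ)| ≤ h γ := fun x =>
    exists_majorant (τ x : 𝓞 F)
  choose h hh hb using hmaj
  refine ⟨∑ x, ∑' a : A, h x (a : 𝓞 F), ?_⟩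
  filter_upwards [gt_one_ev, le_two_ev] with s hs hs2
  have key := coset_sum B (fun a : A => χ (aN (a : 𝓞 F))) (fun a : A => fs s (mixedEmbedding F (a : 𝓞 F)))
    (fun a => hχ _) (U_hasSum χ hχ b hs).summable τ hτ
    (fun x a => by
      have := hper a (δ x)
      rw [← hδ] at this
      exact this) (fun x a => h x a)
    (fun x => (hh x).comp_injective Subtype.val_injective) (fun x a => hb x a s hs hs2)
  rw [hBidx] at key
  have hU2 : U χ (b * I0) s = ∑' c : B, χ (aN ((c : A) : 𝓞 F)) * fs s (mixedEmbedding F ((c : A) : 𝓞 F)) := by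
    let e : B ≃ ((b * I0 : (Ideal (𝓞 F))⁰) : Ideal (𝓞 F)) :=
      { toFun := fun c => ⟨((c : A) : 𝓞 F), c.2⟩
        invFun := fun c => ⟨⟨c.1, hle c.2⟩, c.2⟩
        left_inv := fun _ => rfl
        right_inv := fun _ => rfl }
    unfold U
    rw [← e.tsum_eq]
    rfl
  rw [hU2]
  exact key

/-- the twisted character on ideals -/
noncomputable def lam (χ : ℕ →*₀ ℝ) (ψ : ClassGroup (𝓞 F) →* ℤˣ) (J : (Ideal (𝓞 F))⁰) : ℝ :=
  ((ψ (ClassGroup.mk0 J) : ℤ) : ℝ) * χ (absNorm (J : Ideal (𝓞 F)))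

lemma V_step (χ : ℕ →*₀ ℝ) (hχ : ∀ n, |χ n| ≤ 1) (q : 𝓞 F) (hq : q ≠ 0)
    (hper : ∀ γ δ : 𝓞 F, χ (aN (γ + q * δ)) = χ (aN γ)) (I0 : (Ideal (𝓞 F))⁰)
    (hI0 : ∃ i ∈ (I0 : Ideal (𝓞 F)), ∃ y, i + q * y = 1) (C : ClassGroup (𝓞 F)) :
    Bdd (fun s => V χ C s - χ (absNorm (I0 : Ideal (𝓞 F))) * nm I0 ^ (1 - s) *
      V χ (C * (ClassGroup.mk0 I0)⁻¹) s) := by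
  obtain ⟨c, hc⟩ := ClassGroup.mk0_surjective C
  have hc0 : (c : Ideal (𝓞 F)) ≠ 0 := nonZeroDivisors.ne_zero c.2
  have hq' : span {q} ≠ 0 := by rwa [Ne, zero_eq_bot, span_singleton_eq_bot]
  obtain ⟨a, ha⟩ := IsDedekindDomain.exists_sup_span_eq (I := span {q} * (c : Ideal (𝓞 F))) (J := (c : Ideal (𝓞 F)))
    Ideal.mul_le_right (mul_ne_zero hq' hc0)
  have hac : (c : Ideal (𝓞 F)) ∣ span {a} := by
    rw [dvd_iff_le]; conv_rhs => rw [← ha]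
    exact le_sup_right
  obtain ⟨b, hb⟩ := hac
  have hcop : span {q} ⊔ b = ⊤ := by
    have h1 : (c : Ideal (𝓞 F)) * (span {q} ⊔ b) = c * ⊤ := by
      rw [Ideal.mul_sup, ← hb, mul_comm, ha, mul_top]
    exact mul_left_cancel₀ hc0 h1
  obtain ⟨x, hx, β, hβ, hxβ⟩ := Submodule.mem_sup.mp ((Ideal.eq_top_iff_one _).mp hcop)
  obtain ⟨z, rfl⟩ := mem_span_singleton'.mp hx
  -- a nonzero
  have hβN : χ (aN β) = 1 := by
    have h1 := hper β z
    rw [show β + q * z = 1 by rw [← hxβ]; ring] at h1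
    rw [← h1, aN]
    simp
  have hb0 : b ≠ 0 := by
    rintro rfl
    have : β = 0 := by simpa using hβ
    rw [this, aN] at hβN
    simp at hβN
  have hbχ : χ (absNorm b) ≠ 0 := by
    have hd : b ∣ span {β} := by rw [dvd_span_singleton]; exact hβ
    obtain ⟨k, hk⟩ := hd
    intro h0
    rw [aN, hk, map_mul, map_mul, h0, zero_mul] at hβN
    exact zero_ne_one hβN
  let b' : (Ideal (𝓞 F))⁰ := ⟨b, mem_nonZeroDivisors_of_ne_zero hb0⟩
  have ha0 : a ≠ 0 := by
    rintro rfl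
    rw [span_singleton_eq_bot.mpr rfl] at hb
    exact mul_ne_zero hc0 hb0 hb.symm
  have hCb : C = (ClassGroup.mk0 b')⁻¹ := by
    rw [← hc]
    exact ClassGroup.mk0_eq_mk0_inv_iff.mpr ⟨a, ha0, hb.symm⟩
  have h1 := (U_step χ hχ q hper b' I0 hI0).const_mul
    ((torsionOrder F : ℝ) * χ (absNorm b))⁻¹
  have h2 : Bdd (fun s => nm b' ^ s * (((torsionOrder F : ℝ) * χ (absNorm b))⁻¹ *
      (U χ b' s - nm I0 * U χ (b' * I0) s))) := by
    obtain ⟨M, hM⟩ := h1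
    refine ⟨nm b' ^ (2 : ℝ) * M, ?_⟩
    filter_upwards [hM, le_two_ev] with s h3 h4
    have hb1 := one_le_nm b'
    rw [abs_mul, abs_of_nonneg (Real.rpow_nonneg (by linarith) _)]
    exact mul_le_mul (Real.rpow_le_rpow_of_exponent_le hb1 h4) h3 (abs_nonneg _)
      (Real.rpow_nonneg (by linarith) _)
  refine h2.congr ?_
  filter_upwards [gt_one_ev] with s hs
  have e1 : U χ b' s = (torsionOrder F : ℝ) * χ (absNorm b) * nm b' ^ (-s) * V χ C s := by
    rw [hCb]
    exact (U_hasSum χ hχ b' hs).tsum_eq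
  have e2 : U χ (b' * I0) s = (torsionOrder F : ℝ) * (χ (absNorm b) * χ (absNorm (I0 : Ideal (𝓞 F)))) *
      (nm b' ^ (-s) * nm I0 ^ (-s)) * V χ (C * (ClassGroup.mk0 I0)⁻¹) s := by
    have := (U_hasSum χ hχ (b' * I0) hs).tsum_eq
    rw [map_mul, mul_inv, ← hCb, Submonoid.coe_mul, map_mul, map_mul, nm_mul, Real.mul_rpow
      (zero_le_one.trans (one_le_nm _)) (zero_le_one.trans (one_le_nm _))] at this
    exact this
  have ht : (torsionOrder F : ℝ) ≠ 0 := by exact_mod_cast (torsionOrder_pos F).ne'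
  have hI1 := one_le_nm I0
  have hb1 := one_le_nm b'
  have hbp : 0 < nm b' ^ s := Real.rpow_pos_of_pos (by linarith) _
  rw [e1, e2, show (1 - s) = 1 + -s by ring, Real.rpow_add (by linarith : 0 < nm I0), Real.rpow_one,
    Real.rpow_neg (by linarith : 0 ≤ nm b')]
  field_simp

/-- the twisted sum -/
noncomputable def T (χ : ℕ →*₀ ℝ) (ψ : ClassGroup (𝓞 F) →* ℤˣ) (s : ℝ) : ℝ :=
  ∑' J : (Ideal (𝓞 F))⁰, lam χ ψ J * nm J ^ (-s)

lemma abs_lam (χ : ℕ →*₀ ℝ) (hχ : ∀ n, |χ n| ≤ 1) (ψ : ClassGroup (𝓞 F) →* ℤˣ)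
    (J : (Ideal (𝓞 F))⁰) : |lam χ ψ J| ≤ 1 := by
  unfold lam
  rw [abs_mul]
  rcases Int.units_eq_one_or (ψ (ClassGroup.mk0 J)) with h | h <;> rw [h] <;> simp [hχ]

lemma T_summable (χ : ℕ →*₀ ℝ) (hχ : ∀ n, |χ n| ≤ 1) (ψ : ClassGroup (𝓞 F) →* ℤˣ) {s : ℝ} (hs : 1 < s) :
    Summable fun J : (Ideal (𝓞 F))⁰ => lam χ ψ J * nm J ^ (-s) := by
  refine Summable.of_norm_bounded (Z_summable F hs) fun J => ?_
  have : 0 ≤ nm J ^ (-s) := Real.rpow_nonneg (zero_le_one.trans (one_le_nm _)) _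
  rw [Real.norm_eq_abs, abs_mul, abs_of_nonneg this]
  exact mul_le_of_le_one_left this (abs_lam χ hχ ψ J)

lemma T_eq (χ : ℕ →*₀ ℝ) (hχ : ∀ n, |χ n| ≤ 1) (ψ : ClassGroup (𝓞 F) →* ℤˣ) {s : ℝ} (hs : 1 < s) :
    T χ ψ s = ∑ C, ((ψ C : ℤ) : ℝ) * V χ C s := by
  have h0 := T_summable χ hχ ψ hs
  let e := Equiv.sigmaFiberEquiv (fun I : (Ideal (𝓞 F))⁰ => ClassGroup.mk0 I)
  have h1 := e.summable_iff.mpr h0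
  unfold T
  rw [← e.tsum_eq]
  refine h1.tsum_sigma.trans ?_
  rw [tsum_fintype]
  refine Finset.sum_congr rfl fun C _ => ?_
  unfold V
  rw [← tsum_mul_left]
  refine tsum_congr fun J => ?_
  change lam χ ψ J.1 * _ = _
  unfold lam
  rw [J.2]
  rw [mul_assoc]; rfl

theorem T_bdd (χ : ℕ →*₀ ℝ) (hχ : ∀ n, |χ n| ≤ 1) (q : 𝓞 F) (hq : q ≠ 0)
    (hper : ∀ γ δ : 𝓞 F, χ (aN (γ + q * δ)) = χ (aN γ)) (I0 : (Ideal (𝓞 F))⁰)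
    (hI0 : ∃ i ∈ (I0 : Ideal (𝓞 F)), ∃ y, i + q * y = 1) (ψ : ClassGroup (𝓞 F) →* ℤˣ)
    (hlam : lam χ ψ I0 = -1) : Bdd (T χ ψ) := by
  have h1 : Bdd (fun s => ∑ C, ((ψ C : ℤ) : ℝ) * (V χ C s - χ (absNorm (I0 : Ideal (𝓞 F))) * nm I0 ^ (1 - s) *
      V χ (C * (ClassGroup.mk0 I0)⁻¹) s)) :=
    Bdd.sum _ fun C _ => (V_step χ hχ q hq hper I0 hI0 C).const_mul _
  refine h1.mono ?_
  filter_upwards [gt_one_ev] with s hs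
  have h2 : ∑ C, ((ψ C : ℤ) : ℝ) * (V χ C s - χ (absNorm (I0 : Ideal (𝓞 F))) * nm I0 ^ (1 - s) *
      V χ (C * (ClassGroup.mk0 I0)⁻¹) s) = T χ ψ s * (1 + nm I0 ^ (1 - s)) := by
    have h3 : ∑ C, ((ψ C : ℤ) : ℝ) * V χ (C * (ClassGroup.mk0 I0)⁻¹) s =
        ((ψ (ClassGroup.mk0 I0) : ℤ) : ℝ) * T χ ψ s := by
      rw [T_eq χ hχ ψ hs, Finset.mul_sum]
      refine (Equiv.sum_comp (Equiv.mulRight (ClassGroup.mk0 I0)) _).symm.trans ?_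
      refine Finset.sum_congr rfl fun C _ => ?_
      simp only [Equiv.coe_mulRight, mul_inv_cancel_right, map_mul, Units.val_mul, Int.cast_mul]
      ring
    have h4 : ∑ C, ((ψ C : ℤ) : ℝ) * (V χ C s - χ (absNorm (I0 : Ideal (𝓞 F))) * nm I0 ^ (1 - s) *
      V χ (C * (ClassGroup.mk0 I0)⁻¹) s) = T χ ψ s - χ (absNorm (I0 : Ideal (𝓞 F))) * nm I0 ^ (1 - s) *
        ∑ C, ((ψ C : ℤ) : ℝ) * V χ (C * (ClassGroup.mk0 I0)⁻¹) s := by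
      rw [T_eq χ hχ ψ hs, Finset.mul_sum, ← Finset.sum_sub_distrib]
      refine Finset.sum_congr rfl fun C _ => ?_
      ring
    rw [h4, h3]
    have h5 : ((ψ (ClassGroup.mk0 I0) : ℤ) : ℝ) * χ (absNorm (I0 : Ideal (𝓞 F))) = -1 := hlam
    linear_combination (- nm I0 ^ (1 - s) * T χ ψ s) * h5
  rw [h2, abs_mul]
  have h6 : 0 ≤ nm I0 ^ (1 - s) := Real.rpow_nonneg (zero_le_one.trans (one_le_nm _)) _
  rw [abs_of_nonneg (by linarith : 0 ≤ 1 + nm I0 ^ (1 - s))]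
  exact le_mul_of_one_le_right (abs_nonneg _) (by linarith)

end P6
end NSq
end WrapPart6

section WrapPart7
/-! Part 7: Euler products -/
open NumberField NumberField.InfinitePlace NumberField.Units Module nonZeroDivisors Ideal Filter Topology
open IsDedekindDomain UniqueFactorizationMonoid

namespace NSq
section P7
open scoped Classical
set_option linter.unusedSectionVars false

variable {F : Type*} [Field F] [NumberField F]

lemma countable_ideal : Countable (Ideal (𝓞 F)) := by
  let e := Equiv.sigmaFiberEquiv (fun I : Ideal (𝓞 F) => absNorm I)
  have : ∀ n, Countable {I : Ideal (𝓞 F) // absNorm I = n} := by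
    intro n
    by_cases h : n = 0
    · subst h
      have : Subsingleton {I : Ideal (𝓞 F) // absNorm I = 0} :=
        ⟨fun a b => Subtype.ext ((absNorm_eq_zero_iff.mp a.2).trans (absNorm_eq_zero_iff.mp b.2).symm)⟩
      infer_instance
    · have : Finite {I : Ideal (𝓞 F) // absNorm I = n} := finite_setOfPred_absNorm_eq n
      infer_instance
  exact e.symm.injective.countable

variable (F) in
lemma exists_idx : ∃ idx : Ideal (𝓞 F) → ℕ, Function.Injective idx ∧ ∀ I, (idx I).Prime := by
  have := countable_ideal (F := F)
  obtain ⟨c, hc⟩ := exists_injective_nat (Ideal (𝓞 F))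
  exact ⟨fun I => Nat.nth Nat.Prime (c I), fun a b h => hc (Nat.nth_injective Nat.infinite_setOfPred_prime h),
    fun I => Nat.prime_nth_prime _⟩

/-- height one primes as nonzero ideals -/
def hp (P : HeightOneSpectrum (𝓞 F)) : (Ideal (𝓞 F))⁰ :=
  ⟨P.asIdeal, mem_nonZeroDivisors_of_ne_zero P.ne_bot⟩

lemma hp_inj : Function.Injective (hp (F := F)) := fun _ _ h =>
  HeightOneSpectrum.ext (congrArg Subtype.val h)

/-- completely multiplicative function on ℕ from values at primes -/
noncomputable def cmul (g : ℕ → ℂ) : ℕ →*₀ ℂ where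
  toFun n := if n = 0 then 0 else (n.primeFactorsList.map g).prod
  map_zero' := by simp
  map_one' := by simp
  map_mul' a b := by
    by_cases ha : a = 0
    · simp [ha]
    by_cases hb : b = 0
    · simp [hb]
    rw [if_neg ha, if_neg hb, if_neg (mul_ne_zero ha hb),
      ((Nat.perm_primeFactorsList_mul ha hb).map g).prod_eq, List.map_append, List.prod_append]

lemma cmul_prime (g : ℕ → ℂ) {p : ℕ} (hp : p.Prime) : cmul g p = g p := by
  change (if p = 0 then 0 else (p.primeFactorsList.map g).prod) = _
  rw [if_neg hp.ne_zero, Nat.primeFactorsList_prime hp]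
  simp

lemma ideal_induction {C : (Ideal (𝓞 F))⁰ → Prop} (h1 : C 1)
    (hm : ∀ (P : HeightOneSpectrum (𝓞 F)) (J : (Ideal (𝓞 F))⁰), C J → C (hp P * J)) (J : (Ideal (𝓞 F))⁰) : C J := by
  suffices h : ∀ J : Ideal (𝓞 F), ∀ hJ : J ≠ 0, C ⟨J, mem_nonZeroDivisors_of_ne_zero hJ⟩ from
    h J (nonZeroDivisors.ne_zero J.2)
  intro J
  induction J using UniqueFactorizationMonoid.induction_on_prime with
  | h₁ => intro h; exact absurd rfl h
  | h₂ x hx =>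
    intro _
    have : x = 1 := isUnit_iff_eq_one.mp hx
    subst this
    exact h1
  | h₃ a p ha hp' ih =>
    intro h0
    have := hm ⟨p, isPrime_of_prime hp', hp'.ne_zero⟩ _ (ih ha)
    exact this

/-- code of ideals by naturals -/
noncomputable def nu (idx : Ideal (𝓞 F) → ℕ) (J : (Ideal (𝓞 F))⁰) : ℕ :=
  ((normalizedFactors (J : Ideal (𝓞 F))).map idx).prod

lemma nu_one (idx : Ideal (𝓞 F) → ℕ) : nu idx 1 = 1 := by
  unfold nu
  rw [Submonoid.coe_one, normalizedFactors_one]; simp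

lemma nu_mul (idx : Ideal (𝓞 F) → ℕ) (I J : (Ideal (𝓞 F))⁰) : nu idx (I * J) = nu idx I * nu idx J := by
  unfold nu
  rw [Submonoid.coe_mul, normalizedFactors_mul (nonZeroDivisors.ne_zero I.2) (nonZeroDivisors.ne_zero J.2),
    Multiset.map_add, Multiset.prod_add]

lemma nu_hp (idx : Ideal (𝓞 F) → ℕ) (P : HeightOneSpectrum (𝓞 F)) : nu idx (hp P) = idx P.asIdeal := by
  unfold nu
  have : normalizedFactors (hp P : Ideal (𝓞 F)) = {P.asIdeal} := by
    have h := normalizedFactors_irreducible (P.irreducible)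
    rw [normalize_eq] at h
    exact h
  rw [this]; simp

lemma nu_inj (idx : Ideal (𝓞 F) → ℕ) (hi : Function.Injective idx) (hpr : ∀ I, (idx I).Prime) :
    Function.Injective (nu idx) := by
  intro I J h
  have key : ∀ K : (Ideal (𝓞 F))⁰, (nu idx K).primeFactorsList = ((normalizedFactors (K : Ideal (𝓞 F))).map idx : Multiset ℕ) := by
    intro K
    have h2 := Nat.factors_multiset_prod_of_irreducible (s := (normalizedFactors (K : Ideal (𝓞 F))).map idx) (by
      intro x hx
      obtain ⟨P, _, rfl⟩ := Multiset.mem_map.mp hx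
      exact hpr P)
    rw [Nat.factors_eq] at h2
    exact h2
  have h3 : (normalizedFactors (I : Ideal (𝓞 F))).map idx = (normalizedFactors (J : Ideal (𝓞 F))).map idx := by
    rw [← key, ← key, h]
  have h4 := Multiset.map_injective hi h3
  apply Subtype.ext
  have h5 := prod_normalizedFactors_eq (nonZeroDivisors.ne_zero I.2)
  rw [h4, prod_normalizedFactors_eq (nonZeroDivisors.ne_zero J.2), normalize_eq, normalize_eq] at h5
  exact h5.symm

theorem euler (h : (Ideal (𝓞 F))⁰ →* ℝ) (hs : Summable fun J => |h J|) :
    Complex.exp (∑' P : HeightOneSpectrum (𝓞 F), -Complex.log (1 - (h (hp P) : ℂ))) =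
      ((∑' J, h J : ℝ) : ℂ) := by
  obtain ⟨idx, hi, hpr⟩ := exists_idx F
  let g : ℕ → ℂ := fun p => if H : ∃ P : HeightOneSpectrum (𝓞 F), idx P.asIdeal = p then
    (h (hp H.choose) : ℂ) else 0
  have hg : ∀ P : HeightOneSpectrum (𝓞 F), g (idx P.asIdeal) = h (hp P) := by
    intro P
    have H : ∃ P' : HeightOneSpectrum (𝓞 F), idx P'.asIdeal = idx P.asIdeal := ⟨P, rfl⟩
    simp only [g, dif_pos H]
    have : H.choose = P := HeightOneSpectrum.ext (hi H.choose_spec)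
    rw [this]
  have hgn : ∀ p, (¬ ∃ P : HeightOneSpectrum (𝓞 F), idx P.asIdeal = p) → g p = 0 := by
    intro p H
    simp only [g, dif_neg H]
  have hf : ∀ J, cmul g (nu idx J) = h J := by
    intro J
    induction J using ideal_induction with
    | h1 => rw [nu_one]; simp
    | hm P J ih => rw [nu_mul, map_mul, nu_hp, cmul_prime g (hpr _), hg, ih, map_mul]; push_cast; rfl
  have hni := nu_inj idx hi hpr
  have hoff : ∀ n ∉ Set.range (nu idx), cmul g n = 0 := by
    intro n
    induction n using Nat.recOnMul with
    | zero => intro _; simp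
    | one => intro hn; exact absurd ⟨1, nu_one idx⟩ hn
    | prime p hp' =>
      intro hn
      rw [cmul_prime g hp']
      apply hgn
      rintro ⟨P, rfl⟩
      exact hn ⟨hp P, nu_hp idx P⟩
    | mul a b iha ihb =>
      intro hn
      rw [map_mul]
      by_cases ha : a ∈ Set.range (nu idx)
      · by_cases hb : b ∈ Set.range (nu idx)
        · obtain ⟨I, rfl⟩ := ha
          obtain ⟨J, rfl⟩ := hb
          exact absurd ⟨I * J, nu_mul idx I J⟩ hn
        · rw [ihb hb, mul_zero]
      · rw [iha ha, zero_mul]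
  have hsum : Summable (fun n => ‖cmul g n‖) := by
    rw [← hni.summable_iff (fun n hn => by rw [hoff n hn, norm_zero])]
    refine hs.congr fun J => ?_
    simp only [Function.comp_apply, hf, Complex.norm_real, Real.norm_eq_abs]
  have key := EulerProduct.exp_tsum_primes_log_eq_tsum hsum
  have e1 : ∑' n, cmul g n = ((∑' J, h J : ℝ) : ℂ) := by
    rw [Complex.ofReal_tsum, ← hni.tsum_eq (f := fun n => cmul g n)]
    · exact tsum_congr fun J => hf J
    · intro n hn
      by_contra hr
      exact hn (hoff n hr)
  have e2 : ∑' p : Nat.Primes, -Complex.log (1 - cmul g p) =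
      ∑' P : HeightOneSpectrum (𝓞 F), -Complex.log (1 - (h (hp P) : ℂ)) := by
    have hinj : Function.Injective (fun P : HeightOneSpectrum (𝓞 F) => (⟨idx P.asIdeal, hpr _⟩ : Nat.Primes)) := by
      intro P Q hPQ
      exact HeightOneSpectrum.ext (hi (congrArg Subtype.val hPQ))
    refine (hinj.tsum_eq (f := fun p : Nat.Primes => -Complex.log (1 - cmul g p.1)) ?_).symm.trans ?_
    rotate_left
    · refine tsum_congr fun P => ?_
      simp only
      rw [cmul_prime g (hpr _), hg]
    · intro p hn
      by_contra hr
      apply hn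
      simp only
      rw [cmul_prime g p.2, hgn, sub_zero, Complex.log_one, neg_zero]
      rintro ⟨P, hP⟩
      exact hr ⟨P, Subtype.ext hP⟩
  rw [← e1, ← key, e2]

lemma log_est {x : ℝ} (hx : |x| ≤ 1 / 2) : |(-Real.log (1 - x)) - x| ≤ 2 * x ^ 2 := by
  have h1 := abs_le.mp hx
  have h2 : 0 < 1 - x := by linarith
  have h3 := Real.log_le_sub_one_of_pos h2
  have h4 := Real.log_le_sub_one_of_pos (inv_pos.mpr h2)
  rw [Real.log_inv] at h4
  have h5 : (1 - x)⁻¹ - 1 = x + x ^ 2 * (1 - x)⁻¹ := by field_simp; ring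
  have h6 : (1 - x)⁻¹ ≤ 2 := by
    rw [inv_le_comm₀ h2 (by norm_num)]; linarith
  rw [abs_le]
  constructor
  · nlinarith [sq_nonneg x]
  · nlinarith [sq_nonneg x]

lemma two_le_nm (P : HeightOneSpectrum (𝓞 F)) : 2 ≤ nm (hp P) := by
  unfold nm
  have h1 := nm_nat (hp P)
  have h2 : absNorm (hp P : Ideal (𝓞 F)) ≠ 1 := by
    rw [Ne, absNorm_eq_one_iff]
    exact P.isPrime.ne_top
  exact_mod_cast (by omega : 2 ≤ absNorm (hp P : Ideal (𝓞 F)))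

lemma P_summable {s : ℝ} (hs : 1 < s) : Summable fun P : HeightOneSpectrum (𝓞 F) => nm (hp P) ^ (-s) :=
  (Z_summable F hs).comp_injective hp_inj

lemma PL_summable (l : HeightOneSpectrum (𝓞 F) → ℝ) (hl : ∀ J, |l J| ≤ 1) {s : ℝ} (hs : 1 < s) :
    Summable fun P : HeightOneSpectrum (𝓞 F) => l P * nm (hp P) ^ (-s) := by
  refine Summable.of_norm_bounded (P_summable hs) fun J => ?_
  have : 0 ≤ nm (hp J) ^ (-s) := Real.rpow_nonneg (zero_le_one.trans (one_le_nm _)) _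
  rw [Real.norm_eq_abs, abs_mul, abs_of_nonneg this]
  exact mul_le_of_le_one_left this (hl _)

/-- prime sum -/
noncomputable def SP (l : HeightOneSpectrum (𝓞 F) → ℝ) (s : ℝ) : ℝ := ∑' P : HeightOneSpectrum (𝓞 F), l P * nm (hp P) ^ (-s)

theorem log_euler (l : (Ideal (𝓞 F))⁰ →* ℝ) (hl : ∀ J, |l J| ≤ 1) :
    Bdd (fun s => Real.log (∑' J, l J * nm J ^ (-s)) - SP (fun P => l (hp P)) s) := by
  refine ⟨∑' P : HeightOneSpectrum (𝓞 F), 2 * nm (hp P) ^ (-(2 : ℝ)), ?_⟩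
  filter_upwards [gt_one_ev] with s hs
  let h : (Ideal (𝓞 F))⁰ →* ℝ :=
    { toFun := fun J => l J * nm J ^ (-s)
      map_one' := by simp [nm]
      map_mul' := fun I J => by
        rw [map_mul, nm_mul, Real.mul_rpow (zero_le_one.trans (one_le_nm _)) (zero_le_one.trans (one_le_nm _))]
        ring }
  have hh : ∀ J, h J = l J * nm J ^ (-s) := fun J => rfl
  have habs : ∀ J, |h J| ≤ nm J ^ (-s) := by
    intro J
    have : 0 ≤ nm J ^ (-s) := Real.rpow_nonneg (zero_le_one.trans (one_le_nm _)) _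
    rw [hh, abs_mul, abs_of_nonneg this]
    exact mul_le_of_le_one_left this (hl _)
  have hsm : Summable fun J => |h J| :=
    Summable.of_nonneg_of_le (fun _ => abs_nonneg _) habs (Z_summable F hs)
  have hle : ∀ P : HeightOneSpectrum (𝓞 F), nm (hp P) ^ (-s) ≤ nm (hp P) ^ (-1 : ℝ) := fun P =>
    Real.rpow_le_rpow_of_exponent_le (one_le_nm _) (by linarith)
  have hhalf : ∀ P : HeightOneSpectrum (𝓞 F), |h (hp P)| ≤ 1 / 2 := by
    intro P
    refine (habs _).trans ((hle P).trans ?_)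
    rw [Real.rpow_neg_one, one_div]
    exact inv_anti₀ (by norm_num) (two_le_nm P)
  have hsq : ∀ P : HeightOneSpectrum (𝓞 F), 2 * (h (hp P)) ^ 2 ≤ 2 * nm (hp P) ^ (-(2 : ℝ)) := by
    intro P
    have h1 : |h (hp P)| ≤ nm (hp P) ^ (-1 : ℝ) := (habs _).trans (hle P)
    have h2 : nm (hp P) ^ (-(2 : ℝ)) = (nm (hp P) ^ (-1 : ℝ)) ^ 2 := by
      rw [← Real.rpow_natCast, ← Real.rpow_mul (zero_le_one.trans (one_le_nm _))]; norm_num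
    rw [h2, ← sq_abs (h (hp P))]
    have := pow_le_pow_left₀ (abs_nonneg _) h1 2
    linarith
  have hbig : Summable fun P : HeightOneSpectrum (𝓞 F) => 2 * nm (hp P) ^ (-(2 : ℝ)) :=
    (P_summable (by norm_num : (1 : ℝ) < 2)).mul_left 2
  have hterm : ∀ P : HeightOneSpectrum (𝓞 F), ‖(-Real.log (1 - h (hp P))) - h (hp P)‖ ≤ 2 * nm (hp P) ^ (-(2 : ℝ)) :=
    fun P => (log_est (hhalf P)).trans (hsq P)
  have hS : Summable fun P : HeightOneSpectrum (𝓞 F) => h (hp P) := PL_summable _ (fun P => hl (hp P)) hs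
  have hD := Summable.of_norm_bounded hbig hterm
  have hL : Summable fun P : HeightOneSpectrum (𝓞 F) => -Real.log (1 - h (hp P)) := by
    refine (hD.add hS).congr fun P => ?_
    ring
  have key := euler h hsm
  have e1 : ∑' P : HeightOneSpectrum (𝓞 F), -Complex.log (1 - (h (hp P) : ℂ)) =
      ((∑' P : HeightOneSpectrum (𝓞 F), -Real.log (1 - h (hp P)) : ℝ) : ℂ) := by
    rw [Complex.ofReal_tsum]
    refine tsum_congr fun P => ?_
    have := (abs_le.mp (hhalf P)).2
    rw [Complex.ofReal_neg, Complex.ofReal_log (by linarith)]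
    push_cast; rfl
  rw [e1, ← Complex.ofReal_exp] at key
  have key' := Complex.ofReal_injective key
  change |Real.log (∑' J, h J) - ∑' P : HeightOneSpectrum (𝓞 F), h (hp P)| ≤ _
  rw [← key', Real.log_exp, ← hL.tsum_sub hS]
  exact tsum_of_norm_bounded hbig.hasSum hterm

end P7
end NSq
end WrapPart7

section WrapPart8
/-! Part 8: quadratic extensions -/
open NumberField NumberField.InfinitePlace NumberField.Units Module nonZeroDivisors Ideal Filter Topology
open IsDedekindDomain UniqueFactorizationMonoid

universe u
namespace NSq
section P8
open scoped Classical Pointwise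
set_option linter.unusedSectionVars false
variable {F E : Type*} [Field F] [NumberField F] [Field E] [NumberField E] [Algebra F E]

noncomputable abbrev und (P : HeightOneSpectrum (𝓞 E)) : HeightOneSpectrum (𝓞 F) := P.under (𝓞 F)

instance und_liesOver (P : HeightOneSpectrum (𝓞 E)) : P.asIdeal.LiesOver (und (F := F) P).asIdeal := ⟨rfl⟩

lemma mem_und (P : HeightOneSpectrum (𝓞 E)) (x : 𝓞 F) :
    x ∈ (und (F := F) P).asIdeal ↔ algebraMap (𝓞 F) (𝓞 E) x ∈ P.asIdeal := Iff.rfl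

lemma relNorm_hp (P : HeightOneSpectrum (𝓞 E)) :
    relNorm (𝓞 F) P.asIdeal = (und (F := F) P).asIdeal ^ (P.asIdeal.inertiaDeg (𝓞 F)) := by
  have := (P.under (𝓞 F)).isMaximal
  have := P.isMaximal
  exact relNorm_eq_pow_of_isMaximal _ _

lemma absNorm_hp (P : HeightOneSpectrum (𝓞 E)) :
    absNorm P.asIdeal = absNorm (und (F := F) P).asIdeal ^ (P.asIdeal.inertiaDeg (𝓞 F)) := by
  rw [← map_pow, ← relNorm_hp, absNorm_relNorm]

lemma deg_one_rep (P : HeightOneSpectrum (𝓞 E)) (h : P.asIdeal.inertiaDeg (𝓞 F) = 1) (x : 𝓞 E) :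
    ∃ t : 𝓞 F, x - algebraMap (𝓞 F) (𝓞 E) t ∈ P.asIdeal := by
  have h1 := absNorm_hp (F := F) P
  rw [h, pow_one] at h1
  let φ : (𝓞 F ⧸ (und (F := F) P).asIdeal) →+* (𝓞 E ⧸ P.asIdeal) :=
    Ideal.quotientMap _ (algebraMap (𝓞 F) (𝓞 E)) le_rfl
  have hφ : Function.Injective φ := Ideal.quotientMap_injective
  have f1 : Finite (𝓞 E ⧸ P.asIdeal) := Ideal.finiteQuotientOfFreeOfNeBot _ P.ne_bot
  have hb : Function.Bijective φ := hφ.bijective_of_nat_card_le (by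
    rw [absNorm_apply, absNorm_apply, Submodule.cardQuot_apply, Submodule.cardQuot_apply] at h1
    exact h1.le)
  obtain ⟨t, ht⟩ := hb.2 (Ideal.Quotient.mk _ x)
  obtain ⟨t, rfl⟩ := Ideal.Quotient.mk_surjective t
  refine ⟨t, ?_⟩
  rw [← Ideal.Quotient.eq, ← ht]
  rfl

variable [Algebra.IsQuadraticExtension F E]

variable (E) in
lemma gef (P : HeightOneSpectrum (𝓞 F)) :
    (primesOver P.asIdeal (𝓞 E)).ncard * (ramificationIdxIn P.asIdeal (𝓞 E) * inertiaDegIn P.asIdeal (𝓞 E)) = 2 := by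
  rw [ncard_primesOver_mul_ramificationIdxIn_mul_inertiaDegIn P.asIdeal (𝓞 E) Gal(E/F),
   IsGaloisGroup.card_eq_finrank Gal(E/F) F E, Algebra.IsQuadraticExtension.finrank_eq_two]

lemma inert_eq (P : HeightOneSpectrum (𝓞 E)) :
    P.asIdeal.inertiaDeg (𝓞 F) = inertiaDegIn (und (F := F) P).asIdeal (𝓞 E) := by
  rw [inertiaDegIn_eq_inertiaDeg _ P.asIdeal Gal(E/F)]

lemma exists_conj (a : F) (ha : ¬ ∃ s : F, a = s ^ 2) (δ : E) (hδ : δ ^ 2 = algebraMap F E a) :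
    ∃ σ : Gal(E/F), σ δ = - δ := by
  by_contra! hcon
  have h1 : ∀ σ : Gal(E/F), σ δ = δ := by
    intro σ
    have h2 : (σ δ) ^ 2 = δ ^ 2 := by rw [← map_pow, hδ, AlgEquiv.commutes]
    rcases sq_eq_sq_iff_eq_or_eq_neg.mp h2 with h | h
    · exact h
    · exact absurd h (hcon σ)
  obtain ⟨s, hs⟩ := (IsGalois.mem_range_algebraMap_iff_fixed δ).mpr h1
  refine ha ⟨s, ?_⟩
  apply (algebraMap F E).injective
  rw [← hδ, map_pow, hs]

lemma split_case (a : 𝓞 F) (ha : ¬ ∃ s : F, (a : F) = s ^ 2) (δ : 𝓞 E) (hδ : δ ^ 2 = algebraMap (𝓞 F) (𝓞 E) a)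
    (P : HeightOneSpectrum (𝓞 F)) (h2 : (2 : 𝓞 F) ∉ P.asIdeal) (t : 𝓞 F) (ht : t ∉ P.asIdeal)
    (hat : a - t ^ 2 ∈ P.asIdeal) :
    (primesOver P.asIdeal (𝓞 E)).ncard = 2 ∧ inertiaDegIn P.asIdeal (𝓞 E) = 1 := by
  have hg := gef E P
  have hne : (primesOver P.asIdeal (𝓞 E)).ncard ≠ 1 := by
    intro h1
    obtain ⟨Q, hQ⟩ := Set.ncard_eq_one.mp h1
    have hQm : Q ∈ primesOver P.asIdeal (𝓞 E) := by rw [hQ]; rfl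
    obtain ⟨σ, hσ⟩ := exists_conj (a : F) ha (δ : E) (by
      have := congrArg (algebraMap (𝓞 E) E) hδ
      rw [map_pow, ← IsScalarTower.algebraMap_apply] at this
      rw [this]
      exact (IsScalarTower.algebraMap_apply (𝓞 F) F E a))
    have hQp := hQm.1
    have hQo := hQm.2
    have hsQ : σ • Q = Q := by
      have : σ • Q ∈ primesOver P.asIdeal (𝓞 E) := ⟨inferInstance, inferInstance⟩
      rw [hQ] at this
      exact this
    have hsd : σ • δ = - δ := by
      apply RingOfIntegers.ext
      exact hσ
    have hst : ∀ u : 𝓞 F, σ • (algebraMap (𝓞 F) (𝓞 E) u) = algebraMap (𝓞 F) (𝓞 E) u := by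
      intro u
      exact smul_algebraMap σ u
    have key : ∀ u : 𝓞 F, δ - algebraMap (𝓞 F) (𝓞 E) u ∈ Q → 2 * u ∈ P.asIdeal := by
      intro u hu
      have h3 : σ • (δ - algebraMap (𝓞 F) (𝓞 E) u) ∈ σ • Q := smul_mem_pointwise_smul σ _ _ hu
      rw [hsQ, smul_sub, hsd, hst] at h3
      have h4 := Q.neg_mem (Q.add_mem hu h3)
      rw [hQo.over]
      change algebraMap (𝓞 F) (𝓞 E) (2 * u) ∈ Q
      convert h4 using 1
      rw [map_mul, map_ofNat]
      ring
    have h5 : (δ - algebraMap (𝓞 F) (𝓞 E) t) * (δ - algebraMap (𝓞 F) (𝓞 E) (-t)) ∈ Q := by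
      have : algebraMap (𝓞 F) (𝓞 E) (a - t ^ 2) ∈ Q := by
        rw [hQo.over] at hat; exact hat
      convert this using 1
      rw [map_neg, map_sub, map_pow, ← hδ]; ring
    have hP := P.isPrime
    rcases hQp.mem_or_mem h5 with h | h
    · rcases hP.mem_or_mem (key _ h) with h | h
      · exact h2 h
      · exact ht h
    · rcases hP.mem_or_mem (key _ h) with h | h
      · exact h2 h
      · exact ht ((neg_mem_iff).mp h)
  have hd : (primesOver P.asIdeal (𝓞 E)).ncard ∣ 2 := Dvd.intro _ hg
  have hg2 := ((Nat.dvd_prime Nat.prime_two).mp hd).resolve_left hne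
  refine ⟨hg2, ?_⟩
  rw [hg2] at hg
  have : ramificationIdxIn P.asIdeal (𝓞 E) * inertiaDegIn P.asIdeal (𝓞 E) = 1 := by omega
  exact Nat.dvd_one.mp (Dvd.intro_left _ this)

variable (E) in
lemma exists_over (P : HeightOneSpectrum (𝓞 F)) : ∃ Q : HeightOneSpectrum (𝓞 E), und Q = P := by
  have := P.isMaximal
  obtain ⟨Q, hQ1, hQ2⟩ := exists_maximal_ideal_liesOver_of_isIntegral (S := 𝓞 E) P.asIdeal
  refine ⟨⟨Q, hQ1.isPrime, ?_⟩, ?_⟩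
  · exact ne_bot_of_mem_primesOver P.ne_bot ⟨hQ1.isPrime, hQ2⟩
  · apply HeightOneSpectrum.ext
    exact hQ2.over.symm

lemma inert_case (a : 𝓞 F) (δ : 𝓞 E) (hδ : δ ^ 2 = algebraMap (𝓞 F) (𝓞 E) a)
    (P : HeightOneSpectrum (𝓞 F)) (hat : ∀ t : 𝓞 F, a - t ^ 2 ∉ P.asIdeal) :
    (primesOver P.asIdeal (𝓞 E)).ncard = 1 ∧ inertiaDegIn P.asIdeal (𝓞 E) = 2 := by
  have hg := gef E P
  have hne : inertiaDegIn P.asIdeal (𝓞 E) ≠ 1 := by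
    intro h1
    obtain ⟨Q, hQ⟩ := exists_over E P
    rw [← hQ, ← inert_eq] at h1
    obtain ⟨t, ht⟩ := deg_one_rep Q h1 δ
    apply hat t
    rw [← hQ, mem_und]
    have := Q.asIdeal.mul_mem_left (δ + algebraMap (𝓞 F) (𝓞 E) t) ht
    convert this using 1
    rw [map_sub, map_pow, ← hδ]; ring
  rw [← mul_assoc] at hg
  have hd : inertiaDegIn P.asIdeal (𝓞 E) ∣ 2 := Dvd.intro_left _ hg
  have hg2 := ((Nat.dvd_prime Nat.prime_two).mp hd).resolve_left hne
  refine ⟨?_, hg2⟩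
  rw [hg2] at hg
  have : (primesOver P.asIdeal (𝓞 E)).ncard * ramificationIdxIn P.asIdeal (𝓞 E) = 1 := by omega
  exact Nat.dvd_one.mp (Dvd.intro _ this)

variable (E) in
noncomputable def gP (P : HeightOneSpectrum (𝓞 F)) : ℕ := (primesOver P.asIdeal (𝓞 E)).ncard
variable (E) in
noncomputable def fP (P : HeightOneSpectrum (𝓞 F)) : ℕ := inertiaDegIn P.asIdeal (𝓞 E)

variable (E) in
lemma gf_cases (P : HeightOneSpectrum (𝓞 F)) : gP E P ≤ 2 ∧ 1 ≤ fP E P := by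
  have h := gef E P
  constructor
  · exact Nat.le_of_dvd (by norm_num) (Dvd.intro _ h)
  · rw [← mul_assoc] at h
    exact Nat.pos_of_dvd_of_pos (Dvd.intro_left _ h) (by norm_num)

variable (E) in
lemma card_fiber (P : HeightOneSpectrum (𝓞 F)) :
    Nat.card {Q : HeightOneSpectrum (𝓞 E) // und Q = P} = gP E P := by
  rw [gP, ← Nat.card_coe_set_eq]
  refine Nat.card_congr
    { toFun := fun Q => ⟨Q.1.asIdeal, Q.1.isPrime, ⟨(congrArg HeightOneSpectrum.asIdeal Q.2).symm⟩⟩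
      invFun := fun Q => ⟨⟨Q.1, Q.2.1, ne_bot_of_mem_primesOver P.ne_bot Q.2⟩,
        HeightOneSpectrum.ext Q.2.2.over.symm⟩
      left_inv := fun Q => rfl
      right_inv := fun Q => rfl }

variable (F) in
lemma nm_fiber (Q : HeightOneSpectrum (𝓞 E)) :
    nm (hp Q) = nm (hp (und (F := F) Q)) ^ fP E (und (F := F) Q) := by
  unfold nm hp fP
  rw [← inert_eq]
  exact_mod_cast absNorm_hp Q

variable (F E) in
lemma SP_fiber {s : ℝ} (hs : 1 < s) :
    Summable (fun P : HeightOneSpectrum (𝓞 F) => (gP E P : ℝ) * (nm (hp P) ^ fP E P) ^ (-s)) ∧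
    SP (fun _ : HeightOneSpectrum (𝓞 E) => 1) s =
      ∑' P : HeightOneSpectrum (𝓞 F), (gP E P : ℝ) * (nm (hp P) ^ fP E P) ^ (-s) := by
  have h0 : Summable fun Q : HeightOneSpectrum (𝓞 E) => nm (hp Q) ^ (-s) := P_summable hs
  have e := Equiv.sigmaFiberEquiv (fun Q : HeightOneSpectrum (𝓞 E) => und (F := F) Q)
  have h1 : Summable fun x : (Σ P : HeightOneSpectrum (𝓞 F), {Q : HeightOneSpectrum (𝓞 E) // und Q = P}) =>
      nm (hp x.2.1) ^ (-s) :=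
    ((Equiv.sigmaFiberEquiv (fun Q : HeightOneSpectrum (𝓞 E) => und (F := F) Q)).summable_iff).mpr h0
  have h2 : ∀ P : HeightOneSpectrum (𝓞 F),
      ∑' Q : {Q : HeightOneSpectrum (𝓞 E) // und Q = P}, nm (hp Q.1) ^ (-s)
        = (gP E P : ℝ) * (nm (hp P) ^ fP E P) ^ (-s) := by
    intro P
    have : ∀ Q : {Q : HeightOneSpectrum (𝓞 E) // und Q = P}, nm (hp Q.1) ^ (-s) =
        (nm (hp P) ^ fP E P) ^ (-s) := by
      rintro ⟨Q, rfl⟩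
      rw [nm_fiber F Q]
    rw [tsum_congr this, tsum_const, card_fiber, nsmul_eq_mul]
  constructor
  · have := h1.sigma
    simpa only [h2] using this
  · unfold SP
    simp only [one_mul]
    rw [← (Equiv.sigmaFiberEquiv (fun Q : HeightOneSpectrum (𝓞 E) => und (F := F) Q)).tsum_eq]
    have := h1.tsum_sigma
    simp only [h2] at this
    exact this

variable (F) in
lemma SP_one : Bdd (fun s => SP (fun _ : HeightOneSpectrum (𝓞 F) => 1) s + Real.log (s - 1)) := by
  have h1 := log_euler (F := F) 1 (by simp)
  have h2 := (log_Z_bdd F).sub h1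
  refine h2.congr (Eventually.of_forall fun s => ?_)
  simp only [MonoidHom.one_apply, one_mul, Z]
  ring

/-- sums of characters of quadratic extensions over primes are bounded -/
theorem SP_char (a : 𝓞 F) (ha : ¬ ∃ s : F, (a : F) = s ^ 2) (δ : 𝓞 E)
    (hδ : δ ^ 2 = algebraMap (𝓞 F) (𝓞 E) a) (χ : HeightOneSpectrum (𝓞 F) → ℝ)
    (hχ : ∀ P, |χ P| ≤ 1) (S : Set (HeightOneSpectrum (𝓞 F))) (hS : S.Finite)
    (h2 : ∀ P ∉ S, (2 : 𝓞 F) ∉ P.asIdeal)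
    (hc : ∀ P ∉ S, (χ P = 1 ∧ ∃ t ∉ P.asIdeal, a - t ^ 2 ∈ P.asIdeal) ∨
      (χ P = -1 ∧ ∀ t : 𝓞 F, a - t ^ 2 ∉ P.asIdeal)) : Bdd (SP χ) := by
  have hE := SP_one E
  have hF := SP_one F
  have hd := hE.sub hF
  have key : Bdd (fun s => SP (fun _ : HeightOneSpectrum (𝓞 E) => 1) s -
      SP (fun _ : HeightOneSpectrum (𝓞 F) => 1) s - SP χ s) := by
    have hsum2 : Summable fun P : HeightOneSpectrum (𝓞 F) => nm (hp P) ^ (-2 : ℝ) := P_summable (by norm_num)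
    have hind : Summable fun P : HeightOneSpectrum (𝓞 F) => if P ∈ S then (4 : ℝ) else 0 := by
      refine summable_of_hasFiniteSupport (hS.subset fun P hP => ?_)
      by_contra h
      exact hP (if_neg h)
    refine ⟨∑' P : HeightOneSpectrum (𝓞 F), (nm (hp P) ^ (-2 : ℝ) + if P ∈ S then (4 : ℝ) else 0), ?_⟩
    filter_upwards [gt_one_ev] with s hs
    obtain ⟨hs1, hs2⟩ := SP_fiber F E hs
    have hs3 := PL_summable (F := F) (fun _ => 1) (by simp) hs
    have hs4 := PL_summable χ hχ hs
    rw [hs2]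
    unfold SP
    rw [← hs1.tsum_sub hs3, ← (hs1.sub hs3).tsum_sub hs4]
    rw [← Real.norm_eq_abs]
    refine tsum_of_norm_bounded (hsum2.add hind).hasSum fun P => ?_
    rw [Real.norm_eq_abs]
    have n1 := one_le_nm (hp P)
    have n0 : 0 ≤ nm (hp P) := zero_le_one.trans n1
    have hns : nm (hp P) ^ (-s) ≤ 1 := Real.rpow_le_one_of_one_le_of_nonpos n1 (by linarith)
    have hns0 : 0 ≤ nm (hp P) ^ (-s) := Real.rpow_nonneg n0 _
    have hn2 : 0 ≤ nm (hp P) ^ (-2 : ℝ) := Real.rpow_nonneg n0 _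
    by_cases hP : P ∈ S
    · rw [if_pos hP]
      have ⟨g2, f1⟩ := gf_cases E P
      have g2' : (gP E P : ℝ) ≤ 2 := by exact_mod_cast g2
      have hnf : (nm (hp P) ^ fP E P) ^ (-s) ≤ 1 :=
        Real.rpow_le_one_of_one_le_of_nonpos (one_le_pow₀ n1) (by linarith)
      have hnf0 : 0 ≤ (nm (hp P) ^ fP E P) ^ (-s) := Real.rpow_nonneg (pow_nonneg n0 _) _
      have hc1 := abs_le.mp (hχ P)
      have gg : (0 : ℝ) ≤ gP E P := Nat.cast_nonneg _
      rw [abs_le]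
      constructor <;> nlinarith
    · rw [if_neg hP, add_zero]
      rcases hc P hP with ⟨h3, t, ht, hat⟩ | ⟨h3, h4⟩
      · obtain ⟨hg, hf⟩ := split_case a ha δ hδ P (h2 P hP) t ht hat
        have hg' : gP E P = 2 := hg
        have hf' : fP E P = 1 := hf
        rw [hg', hf', h3, pow_one]
        push_cast
        rw [show (2 : ℝ) * nm (hp P) ^ (-s) - 1 * nm (hp P) ^ (-s) - 1 * nm (hp P) ^ (-s) = 0 by ring, abs_zero]
        exact hn2
      · obtain ⟨hg, hf⟩ := inert_case a δ hδ P h4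
        have hg' : gP E P = 1 := hg
        have hf' : fP E P = 2 := hf
        rw [hg', hf', h3, ← Real.rpow_natCast, ← Real.rpow_mul n0]
        rw [show ((1 : ℕ) : ℝ) * nm (hp P) ^ (((2 : ℕ) : ℝ) * -s) - 1 * nm (hp P) ^ (-s) - -1 * nm (hp P) ^ (-s)
          = nm (hp P) ^ (((2 : ℕ) : ℝ) * -s) by push_cast; ring, abs_of_nonneg (Real.rpow_nonneg n0 _)]
        exact Real.rpow_le_rpow_of_exponent_le n1 (by push_cast; linarith)
  have := hd.sub key
  refine this.congr (Eventually.of_forall fun s => ?_)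
  ring

/-- existence of the quadratic extension -/
theorem exists_quad {F : Type u} [Field F] [NumberField F] (a : F) (ha : ¬ ∃ s : F, a = s ^ 2) :
    ∃ (E : Type u) (_ : Field E) (_ : NumberField E) (_ : Algebra F E) (_ : Algebra.IsQuadraticExtension F E)
      (δ : E), δ ^ 2 = algebraMap F E a := by
  have hirr : Irreducible (Polynomial.X ^ 2 - Polynomial.C a) := by
    refine X_pow_sub_C_irreducible_of_prime Nat.prime_two fun b hb => ha ⟨b, hb.symm⟩
  have : Fact (Irreducible (Polynomial.X ^ 2 - Polynomial.C a)) := ⟨hirr⟩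
  have hm : (Polynomial.X ^ 2 - Polynomial.C a).Monic := Polynomial.monic_X_pow_sub_C a two_ne_zero
  have hfr : finrank F (AdjoinRoot (Polynomial.X ^ 2 - Polynomial.C a)) = 2 := by
    rw [(AdjoinRoot.powerBasis hirr.ne_zero).finrank, AdjoinRoot.powerBasis_dim,
      Polynomial.natDegree_X_pow_sub_C]
  have hq : Algebra.IsQuadraticExtension F (AdjoinRoot (Polynomial.X ^ 2 - Polynomial.C a)) := ⟨hfr⟩
  have hfin : Module.Finite F (AdjoinRoot (Polynomial.X ^ 2 - Polynomial.C a)) := inferInstance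
  have hch : CharZero (AdjoinRoot (Polynomial.X ^ 2 - Polynomial.C a)) :=
    charZero_of_injective_algebraMap (algebraMap F _).injective
  have hnf : NumberField (AdjoinRoot (Polynomial.X ^ 2 - Polynomial.C a)) :=
    { to_charZero := hch, to_finiteDimensional := Module.Finite.trans F _ }
  refine ⟨AdjoinRoot (Polynomial.X ^ 2 - Polynomial.C a), inferInstance, hnf, inferInstance, hq,
    AdjoinRoot.root _, ?_⟩
  have := AdjoinRoot.eval₂_root (Polynomial.X ^ 2 - Polynomial.C a)
  rw [Polynomial.eval₂_sub, Polynomial.eval₂_pow, Polynomial.eval₂_X, Polynomial.eval₂_C, sub_eq_zero] at this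
  exact this

end P8
end NSq
end WrapPart8

section WrapPart9
/-! Part 9: quadratic reciprocity characters -/
open NumberField NumberField.InfinitePlace NumberField.Units Module nonZeroDivisors Ideal Filter Topology
open IsDedekindDomain UniqueFactorizationMonoid

universe u
namespace NSq
section P9
open scoped Classical Pointwise
set_option linter.unusedSectionVars false
variable {F : Type u} [Field F] [NumberField F]

/-- quadratic character mod q as a real multiplicative function on ℕ -/
noncomputable def chq (q : ℕ) [Fact q.Prime] : ℕ →*₀ ℝ where
  toFun n := ((quadraticChar (ZMod q) (n : ZMod q) : ℤ) : ℝ)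
  map_zero' := by simp
  map_one' := by simp
  map_mul' a b := by push_cast; rw [map_mul]; push_cast; rfl

lemma chq_def (q : ℕ) [Fact q.Prime] (n : ℕ) : chq q n = ((quadraticChar (ZMod q) (n : ZMod q) : ℤ) : ℝ) := rfl

lemma chq_cases (q : ℕ) [Fact q.Prime] (n : ℕ) : chq q n = 0 ∨ chq q n = 1 ∨ chq q n = -1 := by
  rw [chq_def]
  by_cases h : (n : ZMod q) = 0
  · left; rw [h]; simp
  · right
    rcases quadraticChar_dichotomy h with h | h <;> rw [h] <;> simp

lemma chq_abs (q : ℕ) [Fact q.Prime] (n : ℕ) : |chq q n| ≤ 1 := by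
  rcases chq_cases q n with h | h | h <;> rw [h] <;> norm_num

lemma chq_zero_iff (q : ℕ) [Fact q.Prime] (n : ℕ) : chq q n = 0 ↔ q ∣ n := by
  rw [chq_def, Int.cast_eq_zero, quadraticChar_eq_zero_iff, ZMod.natCast_eq_zero_iff]

lemma chq_pm (q : ℕ) [Fact q.Prime] (n : ℕ) (h : ¬ q ∣ n) : chq q n = 1 ∨ chq q n = -1 :=
  (chq_cases q n).resolve_left (fun h0 => h ((chq_zero_iff q n).mp h0))

lemma chq_sq (q : ℕ) [Fact q.Prime] (n : ℕ) (h : ¬ q ∣ n) : chq q n * chq q n = 1 := by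
  rcases chq_pm q n h with h | h <;> rw [h] <;> norm_num

section
variable (q : ℕ) [Fact q.Prime] (hq8 : q % 8 = 1)
include hq8
lemma q_ne_two : q ≠ 2 := by rintro rfl; norm_num at hq8

lemma rc_ne : ringChar (ZMod q) ≠ 2 := by
  rw [ZMod.ringChar_zmod_n]; exact q_ne_two q hq8

lemma qc_neg_one : quadraticChar (ZMod q) (-1) = 1 := by
  rw [quadraticChar_one_iff_isSquare (neg_ne_zero.mpr one_ne_zero), FiniteField.isSquare_neg_one_iff, ZMod.card]
  omega

lemma chq_two : chq q 2 = 1 := by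
  rw [chq_def]
  have : quadraticChar (ZMod q) ((2 : ℕ) : ZMod q) = 1 := by
    rw [quadraticChar_one_iff_isSquare, Nat.cast_ofNat, FiniteField.isSquare_two_iff, ZMod.card]
    · omega
    · rw [Ne, ZMod.natCast_eq_zero_iff]
      intro h
      have := (Nat.prime_dvd_prime_iff_eq (Fact.out : q.Prime) Nat.prime_two).mp h
      exact q_ne_two q hq8 this
  rw [this]; simp

lemma chq_natAbs (n : ℤ) : chq q n.natAbs = ((quadraticChar (ZMod q) (n : ZMod q) : ℤ) : ℝ) := by
  rw [chq_def]
  rcases Int.natAbs_eq n with h | h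
  · have h1 : (n : ZMod q) = (n.natAbs : ZMod q) := by
      conv_lhs => rw [h]
      rw [Int.cast_natCast]
    rw [h1]
  · have h1 : (n : ZMod q) = -(n.natAbs : ZMod q) := by
      conv_lhs => rw [h]
      rw [Int.cast_neg, Int.cast_natCast]
    rw [h1, show -(n.natAbs : ZMod q) = (-1) * (n.natAbs : ZMod q) by ring, map_mul, qc_neg_one q hq8, one_mul]

omit hq8 in
lemma norm_congr (m : ℕ) (γ δ : 𝓞 F) : ((Algebra.norm ℤ (γ + m * δ) : ℤ) : ZMod m) = ((Algebra.norm ℤ γ : ℤ) : ZMod m) := by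
  have b := RingOfIntegers.basis F
  rw [Algebra.norm_eq_matrix_det b, Algebra.norm_eq_matrix_det b]
  have h : ∀ M : Matrix (Free.ChooseBasisIndex ℤ (𝓞 F)) (Free.ChooseBasisIndex ℤ (𝓞 F)) ℤ, ((M.det : ℤ) : ZMod m) = ((Int.castRingHom (ZMod m)).mapMatrix M).det := by
    intro M
    rw [← RingHom.map_det]; rfl
  rw [h, h, map_add, map_mul, map_add, map_mul]
  congr 1
  have h3 : (Int.castRingHom (ZMod m)).mapMatrix (Algebra.leftMulMatrix b (m : 𝓞 F)) = 0 := by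
    rw [map_natCast, map_natCast]
    ext i j
    rw [← Matrix.diagonal_natCast]
    by_cases hij : i = j <;> simp [Matrix.diagonal, hij]
  rw [h3, zero_mul, add_zero]

lemma chq_per (γ δ : 𝓞 F) : chq q (aN (γ + (q : 𝓞 F) * δ)) = chq q (aN γ) := by
  unfold aN
  rw [absNorm_span_singleton, absNorm_span_singleton, chq_natAbs q hq8, chq_natAbs q hq8, norm_congr]

end

/-- quadratic residue character mod P -/
noncomputable def rch (P : HeightOneSpectrum (𝓞 F)) (a : 𝓞 F) : ℤ :=
  let _ : Field (𝓞 F ⧸ P.asIdeal) := @Ideal.Quotient.field _ _ P.asIdeal P.isMaximal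
  let _ : Fintype (𝓞 F ⧸ P.asIdeal) := @Fintype.ofFinite _ (Ideal.finiteQuotientOfFreeOfNeBot _ P.ne_bot)
  quadraticChar (𝓞 F ⧸ P.asIdeal) (Ideal.Quotient.mk P.asIdeal a)

lemma rch_mul (P : HeightOneSpectrum (𝓞 F)) (a b : 𝓞 F) : rch P (a * b) = rch P a * rch P b := by
  unfold rch
  rw [map_mul, map_mul]

lemma rch_spec (P : HeightOneSpectrum (𝓞 F)) (a : 𝓞 F) (ha : a ∉ P.asIdeal) :
    (rch P a = 1 ∧ ∃ t ∉ P.asIdeal, a - t ^ 2 ∈ P.asIdeal) ∨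
      (rch P a = -1 ∧ ∀ t : 𝓞 F, a - t ^ 2 ∉ P.asIdeal) := by
  let _ : Field (𝓞 F ⧸ P.asIdeal) := @Ideal.Quotient.field _ _ P.asIdeal P.isMaximal
  let _ : Fintype (𝓞 F ⧸ P.asIdeal) := @Fintype.ofFinite _ (Ideal.finiteQuotientOfFreeOfNeBot _ P.ne_bot)
  have ha' : Ideal.Quotient.mk P.asIdeal a ≠ 0 := by rwa [Ne, Ideal.Quotient.eq_zero_iff_mem]
  have hd : rch P a = quadraticChar (𝓞 F ⧸ P.asIdeal) (Ideal.Quotient.mk P.asIdeal a) := rfl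
  rw [hd]
  rcases quadraticChar_dichotomy ha' with h | h
  · left
    refine ⟨h, ?_⟩
    obtain ⟨t, ht⟩ := (quadraticChar_one_iff_isSquare ha').mp h
    obtain ⟨t, rfl⟩ := Ideal.Quotient.mk_surjective t
    have h1 : a - t ^ 2 ∈ P.asIdeal := by
      rw [← Ideal.Quotient.eq, ht, map_pow, sq]
    refine ⟨t, fun hh => ha ?_, h1⟩
    have := P.asIdeal.add_mem h1 (P.asIdeal.mul_mem_left t hh)
    convert this using 1; ring
  · right
    refine ⟨h, fun t ht => quadraticChar_neg_one_iff_not_isSquare.mp h ⟨Ideal.Quotient.mk _ t, ?_⟩⟩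
    rw [← map_mul, Ideal.Quotient.eq, ← sq]; exact ht

lemma rch_prime (q : ℕ) [Fact q.Prime] (hq8 : q % 8 = 1) (P : HeightOneSpectrum (𝓞 F))
    (h2 : (2 : 𝓞 F) ∉ P.asIdeal) (hqP : (q : 𝓞 F) ∉ P.asIdeal) :
    ((rch P q : ℤ) : ℝ) = chq q (absNorm P.asIdeal) := by
  let _ : Field (𝓞 F ⧸ P.asIdeal) := @Ideal.Quotient.field _ _ P.asIdeal P.isMaximal
  let _ : Fintype (𝓞 F ⧸ P.asIdeal) := @Fintype.ofFinite _ (Ideal.finiteQuotientOfFreeOfNeBot _ P.ne_bot)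
  have hd : rch P q = quadraticChar (𝓞 F ⧸ P.asIdeal) (Ideal.Quotient.mk P.asIdeal (q : 𝓞 F)) := rfl
  have hrc : ∀ p : ℕ, (p : 𝓞 F) ∉ P.asIdeal → ringChar (𝓞 F ⧸ P.asIdeal) ≠ p := by
    intro p hp h
    have := (ringChar.spec (𝓞 F ⧸ P.asIdeal) p).mpr (by rw [h])
    apply hp
    rw [← Ideal.Quotient.eq_zero_iff_mem, map_natCast]; exact this
  have h2' : ringChar (𝓞 F ⧸ P.asIdeal) ≠ 2 := hrc 2 (by exact_mod_cast h2)
  have hcard : absNorm P.asIdeal = Fintype.card (𝓞 F ⧸ P.asIdeal) := by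
    rw [absNorm_apply, Submodule.cardQuot_apply, Nat.card_eq_fintype_card]
  rw [hd, map_natCast, quadraticChar_odd_prime h2' (q_ne_two q hq8) (hrc q hqP), chq_def, hcard, map_mul]
  have h4 : quadraticChar (ZMod q) ((ZMod.χ₄ (Fintype.card (𝓞 F ⧸ P.asIdeal)) : ℤ) : ZMod q) = 1 := by
    have hodd := FiniteField.odd_card_of_char_ne_two h2'
    rcases Nat.odd_mod_four_iff.mp hodd with h | h
    · rw [ZMod.χ₄_nat_one_mod_four h]; simp
    · rw [ZMod.χ₄_nat_three_mod_four h]; push_cast; exact qc_neg_one q hq8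
  rw [h4, one_mul]

lemma chq_over_two (q : ℕ) [Fact q.Prime] (hq8 : q % 8 = 1) (P : HeightOneSpectrum (𝓞 F))
    (h2 : (2 : 𝓞 F) ∈ P.asIdeal) : chq q (absNorm P.asIdeal) = 1 := by
  have : absNorm P.asIdeal ∣ absNorm (span {(2 : 𝓞 F)}) := by
    apply map_dvd
    rw [dvd_span_singleton]; exact h2
  rw [absNorm_span_singleton, show (2 : 𝓞 F) = algebraMap ℤ (𝓞 F) 2 by simp, Algebra.norm_algebraMap,
    Int.natAbs_pow] at this
  obtain ⟨k, -, hk⟩ := (Nat.dvd_prime_pow Nat.prime_two).mp this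
  rw [hk, map_pow, chq_two q hq8, one_pow]

lemma finite_mem (a : 𝓞 F) (ha : a ≠ 0) : {P : HeightOneSpectrum (𝓞 F) | a ∈ P.asIdeal}.Finite := by
  have := Ideal.finite_factors (R := 𝓞 F) (I := span {a}) (by rwa [Ne, zero_eq_bot, span_singleton_eq_bot])
  refine this.subset fun P hP => ?_
  exact dvd_span_singleton.mpr hP

lemma SP_rch (a : 𝓞 F) (ha : ¬ ∃ s : F, (a : F) = s ^ 2) (χ : HeightOneSpectrum (𝓞 F) → ℝ) (hχ : ∀ P, |χ P| ≤ 1)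
    (h : ∀ P : HeightOneSpectrum (𝓞 F), 2 * a ∉ P.asIdeal → χ P = rch P a) : Bdd (SP χ) := by
  obtain ⟨E, _, _, _, _, δ, hδ⟩ := exists_quad (a : F) ha
  have hinteg : IsIntegral ℤ δ := by
    refine IsIntegral.of_pow two_pos ?_
    rw [hδ]
    exact (RingOfIntegers.isIntegral_coe a).algebraMap
  obtain ⟨δ', hδ'⟩ : ∃ δ' : 𝓞 E, (δ' : E) = δ := ⟨⟨δ, hinteg⟩, rfl⟩
  have ha0 : a ≠ 0 := fun h0 => ha ⟨0, by rw [h0]; simp⟩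
  refine SP_char (E := E) a ha δ' ?_ χ hχ {P | 2 * a ∈ P.asIdeal}
    (finite_mem _ (mul_ne_zero two_ne_zero ha0)) ?_ ?_
  · apply RingOfIntegers.coe_injective
    rw [map_pow]
    exact (congrArg (· ^ 2) hδ').trans hδ
  · intro P hP h2
    exact hP (P.asIdeal.mul_mem_right _ h2)
  · intro P hP
    have := rch_spec P a (fun h2 => hP (P.asIdeal.mul_mem_left _ h2))
    rw [h P hP]
    exact_mod_cast this

section
variable (q d : ℕ) [Fact q.Prime] [Fact d.Prime] (hq8 : q % 8 = 1) (hd8 : d % 8 = 1)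
include hq8 hd8

omit hd8 in
lemma SP_q (h : ¬ ∃ s : F, (q : F) = s ^ 2) :
    Bdd (SP (fun P : HeightOneSpectrum (𝓞 F) => chq q (absNorm P.asIdeal))) := by
  refine SP_rch (q : 𝓞 F) (by simpa using h) _ (fun _ => chq_abs _ _) fun P hP => (rch_prime q hq8 P ?_ ?_).symm
  · exact fun h => hP (P.asIdeal.mul_mem_right _ h)
  · exact fun h => hP (P.asIdeal.mul_mem_left _ h)

lemma SP_qd (h : ¬ ∃ s : F, ((q * d : ℕ) : F) = s ^ 2) :
    Bdd (SP (fun P : HeightOneSpectrum (𝓞 F) => chq q (absNorm P.asIdeal) * chq d (absNorm P.asIdeal))) := by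
  refine SP_rch ((q * d : ℕ) : 𝓞 F) (by simpa using h) _ (fun P => ?_) fun P hP => ?_
  · rw [abs_mul]; exact mul_le_one₀ (chq_abs _ _) (abs_nonneg _) (chq_abs _ _)
  · push_cast at hP ⊢
    rw [rch_mul, Int.cast_mul, rch_prime q hq8 P, rch_prime d hd8 P]
    · exact fun h => hP (P.asIdeal.mul_mem_right _ h)
    · exact fun h => hP (P.asIdeal.mul_mem_left _ (P.asIdeal.mul_mem_left _ h))
    · exact fun h => hP (P.asIdeal.mul_mem_right _ h)
    · exact fun h => hP (P.asIdeal.mul_mem_left _ (P.asIdeal.mul_mem_right _ h))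
end

end P9
end NSq
end WrapPart9

section WrapPart10
/-! Part 10: nonvanishing theorem -/
open NumberField NumberField.InfinitePlace NumberField.Units Module nonZeroDivisors Ideal Filter Topology
open IsDedekindDomain UniqueFactorizationMonoid

universe u
namespace NSq
section P10
open scoped Classical Pointwise
set_option linter.unusedSectionVars false
variable {F : Type u} [Field F] [NumberField F]

lemma absNorm_dvd_pow (p : ℕ) (P : HeightOneSpectrum (𝓞 F)) (h : (p : 𝓞 F) ∈ P.asIdeal) :
    ∃ n, absNorm P.asIdeal ∣ p ^ n := by
  have : absNorm P.asIdeal ∣ absNorm (span {(p : 𝓞 F)}) := by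
    apply map_dvd
    rw [dvd_span_singleton]; exact h
  rw [absNorm_span_singleton, show (p : 𝓞 F) = algebraMap ℤ (𝓞 F) p by simp, Algebra.norm_algebraMap,
    Int.natAbs_pow, Int.natAbs_natCast] at this
  exact ⟨_, this⟩

lemma absNorm_ne_one (P : HeightOneSpectrum (𝓞 F)) : absNorm P.asIdeal ≠ 1 := by
  rw [Ne, absNorm_eq_one_iff]; exact P.isPrime.ne_top

lemma prime_dvd_norm (p : ℕ) (hpp : p.Prime) (P : HeightOneSpectrum (𝓞 F)) :
    p ∣ absNorm P.asIdeal ↔ (p : 𝓞 F) ∈ P.asIdeal := by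
  have hpr : P.asIdeal.IsPrime := P.isPrime
  have hnz : NeZero P.asIdeal := ⟨P.ne_bot⟩
  constructor
  · intro hdv
    have hrp : (absNorm (under ℤ P.asIdeal)).Prime := Nat.absNorm_under_prime P.asIdeal
    have hmem : ((absNorm (under ℤ P.asIdeal) : ℕ) : 𝓞 F) ∈ P.asIdeal := by
      exact_mod_cast Int.absNorm_under_mem P.asIdeal
    obtain ⟨n, hn⟩ := absNorm_dvd_pow _ P hmem
    rw [(Nat.prime_dvd_prime_iff_eq hpp hrp).mp (hpp.dvd_of_dvd_pow (hdv.trans hn))]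
    exact hmem
  · intro hm
    obtain ⟨n, hn⟩ := absNorm_dvd_pow p P hm
    obtain ⟨k, -, hk⟩ := (Nat.dvd_prime_pow hpp).mp hn
    rw [hk]
    refine dvd_pow_self p ?_
    rintro rfl
    exact absNorm_ne_one P (by simpa using hk)

/-- lam as a monoid homomorphism -/
noncomputable def lamHom (χ : ℕ →*₀ ℝ) (ψ : ClassGroup (𝓞 F) →* ℤˣ) : (Ideal (𝓞 F))⁰ →* ℝ where
  toFun := lam χ ψ
  map_one' := by simp [lam]
  map_mul' I J := by
    unfold lam
    simp only [map_mul, Submonoid.coe_mul, Units.val_mul, Int.cast_mul]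
    ring

theorem thmN (q d : ℕ) [Fact q.Prime] [Fact d.Prime] (hq8 : q % 8 = 1) (hd8 : d % 8 = 1)
    (hqF : ¬ ∃ s : F, (q : F) = s ^ 2) (hdF : ¬ ∃ s : F, (d : F) = s ^ 2)
    (hqdF : ¬ ∃ s : F, ((q * d : ℕ) : F) = s ^ 2)
    (χ : ℕ →*₀ ℝ) (hχ : ∀ n, |χ n| ≤ 1) (hper : ∀ γ δ : 𝓞 F, χ (aN (γ + (q : 𝓞 F) * δ)) = χ (aN γ))
    (hχq : ∀ n, χ n ≠ 0 → ¬ q ∣ n)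
    (ψ : ClassGroup (𝓞 F) →* ℤˣ) (S : Set (HeightOneSpectrum (𝓞 F))) (hS : S.Finite)
    (hnb : ∀ P ∉ S, ¬ (chq q (absNorm P.asIdeal) = -1 ∧ chq d (absNorm P.asIdeal) = 1) → lam χ ψ (hp P) = 1)
    (I0 : (Ideal (𝓞 F))⁰) (hI0 : lam χ ψ I0 = -1) : False := by
  have hq0 : (q : 𝓞 F) ≠ 0 := by exact_mod_cast (Fact.out : q.Prime).ne_zero
  have hd0 : (d : 𝓞 F) ≠ 0 := by exact_mod_cast (Fact.out : d.Prime).ne_zero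
  have hcop : ∃ i ∈ (I0 : Ideal (𝓞 F)), ∃ y, i + (q : 𝓞 F) * y = 1 := by
    have h1 : χ (absNorm (I0 : Ideal (𝓞 F))) ≠ 0 := by
      intro h; rw [lam, h, mul_zero] at hI0; norm_num at hI0
    have h2 := ((Fact.out : q.Prime).coprime_iff_not_dvd).mpr (hχq _ h1)
    have h3 : IsCoprime (absNorm (I0 : Ideal (𝓞 F)) : ℤ) (q : ℤ) := (Nat.isCoprime_iff_coprime.mpr h2).symm
    obtain ⟨u, v, huv⟩ := h3
    refine ⟨(u : 𝓞 F) * (absNorm (I0 : Ideal (𝓞 F)) : 𝓞 F), Ideal.mul_mem_left _ _ (absNorm_mem _), (v : 𝓞 F), ?_⟩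
    have := congrArg (Int.cast : ℤ → 𝓞 F) huv
    push_cast at this
    rw [← this]; ring
  have hT := T_bdd χ hχ (q : 𝓞 F) hq0 hper I0 hcop ψ hI0
  have hl : ∀ J, |lamHom χ ψ J| ≤ 1 := by
    intro J
    change |((ψ (ClassGroup.mk0 J) : ℤ) : ℝ) * χ (absNorm (J : Ideal (𝓞 F)))| ≤ 1
    rw [abs_mul]
    have : |((ψ (ClassGroup.mk0 J) : ℤ) : ℝ)| = 1 := by
      rcases Int.units_eq_one_or (ψ (ClassGroup.mk0 J)) with h | h <;> rw [h] <;> simp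
    rw [this, one_mul]; exact hχ _
  have hle := log_euler (lamHom χ ψ) hl
  obtain ⟨C1, hC1⟩ := hT
  obtain ⟨C2, hC2⟩ := hle
  set cq : HeightOneSpectrum (𝓞 F) → ℝ := fun P => chq q (absNorm P.asIdeal) with hcq
  set cd : HeightOneSpectrum (𝓞 F) → ℝ := fun P => chq d (absNorm P.asIdeal) with hcd
  have acq : ∀ P, |cq P| ≤ 1 := fun P => chq_abs _ _
  have acd : ∀ P, |cd P| ≤ 1 := fun P => chq_abs _ _
  have acqd : ∀ P, |cq P * cd P| ≤ 1 := fun P => by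
    rw [abs_mul]; exact mul_le_one₀ (acq P) (abs_nonneg _) (acd P)
  have hB : Bdd (fun s => -Real.log (s - 1) + SP cq s - SP cd s + SP (fun P => cq P * cd P) s
      - SP (fun _ : HeightOneSpectrum (𝓞 F) => 1) s - Real.log (s - 1) * 0 + Real.log (s - 1) * 0
      + 2 * (SP (fun _ : HeightOneSpectrum (𝓞 F) => 1) s + Real.log (s - 1))) :=
    by
    have := (((SP_q q hq8 hqF).sub (SP_q d hd8 hdF)).add (SP_qd q d hq8 hd8 hqdF)).add (SP_one F)
    refine this.congr (Eventually.of_forall fun s => ?_)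
    ring
  obtain ⟨C3, hC3⟩ := hB
  set S' : Set (HeightOneSpectrum (𝓞 F)) := S ∪ {P | (q * d : 𝓞 F) ∈ P.asIdeal} with hS'
  have hS'f : S'.Finite := hS.union (finite_mem _ (mul_ne_zero hq0 hd0))
  have hind : Summable fun P : HeightOneSpectrum (𝓞 F) => if P ∈ S' then (6 : ℝ) else 0 := by
    refine summable_of_hasFiniteSupport (hS'f.subset fun P hP => ?_)
    by_contra h
    exact hP (if_neg h)
  refine not_bdd_log ⟨C3 + 2 * (C1 + C2) + ∑' P : HeightOneSpectrum (𝓞 F), (if P ∈ S' then (6 : ℝ) else 0), ?_⟩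
  filter_upwards [gt_one_ev, le_two_ev, hC1, hC2, hC3] with s hs hs2 h1 h2 h3
  have hlog : Real.log (s - 1) ≤ 0 := Real.log_nonpos (by linarith) (by linarith)
  rw [abs_of_nonpos hlog]
  have hSP : SP (fun P => lamHom χ ψ (hp P)) s ≤ C1 + C2 := by
    have hTs : ∑' J, lamHom χ ψ J * nm J ^ (-s) = T χ ψ s := rfl
    rw [hTs] at h2
    have := (abs_le.mp h2).1
    have h5 : Real.log (T χ ψ s) ≤ C1 := by
      rw [← Real.log_abs]
      exact (Real.log_le_self (abs_nonneg _)).trans h1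
    linarith
  have s1 := PL_summable (F := F) (fun _ => 1) (by simp) hs
  have sq := PL_summable cq acq hs
  have sd := PL_summable cd acd hs
  have sqd := PL_summable (fun P => cq P * cd P) acqd hs
  have sl := PL_summable (fun P => lamHom χ ψ (hp P)) (fun P => hl _) hs
  have hmain : SP (fun _ : HeightOneSpectrum (𝓞 F) => 1) s + SP cq s - SP cd s + SP (fun P => cq P * cd P) s ≤
      2 * SP (fun P => lamHom χ ψ (hp P)) s + ∑' P : HeightOneSpectrum (𝓞 F), (if P ∈ S' then (6 : ℝ) else 0) := by
    unfold SP
    rw [← s1.tsum_add sq, ← (s1.add sq).tsum_sub sd, ← ((s1.add sq).sub sd).tsum_add sqd, ← tsum_mul_left,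
      ← (sl.mul_left 2).tsum_add hind]
    refine (((s1.add sq).sub sd).add sqd).tsum_le_tsum (fun P => ?_) ((sl.mul_left 2).add hind)
    have n1 := one_le_nm (hp P)
    have n0 : 0 ≤ nm (hp P) := zero_le_one.trans n1
    have hns : nm (hp P) ^ (-s) ≤ 1 := Real.rpow_le_one_of_one_le_of_nonpos n1 (by linarith)
    have hns0 : 0 ≤ nm (hp P) ^ (-s) := Real.rpow_nonneg n0 _
    have b1 := abs_le.mp (acq P)
    have b2 := abs_le.mp (acd P)
    have b3 := abs_le.mp (acqd P)
    have b4 := abs_le.mp (hl (hp P))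
    by_cases hP : P ∈ S'
    · rw [if_pos hP]
      nlinarith
    · rw [if_neg hP, add_zero]
      have hP1 : P ∉ S := fun h => hP (Or.inl h)
      have hP2 : (q * d : 𝓞 F) ∉ P.asIdeal := fun h => hP (Or.inr h)
      have hPq : ∀ p : ℕ, p.Prime → (p : 𝓞 F) ∉ P.asIdeal → ¬ p ∣ absNorm P.asIdeal := by
        intro p hpp hpm hdv
        exact hpm ((prime_dvd_norm p hpp P).mp hdv)
      have e1 := chq_pm q _ (hPq q Fact.out fun h => hP2 (P.asIdeal.mul_mem_right _ h))
      have e2 := chq_pm d _ (hPq d Fact.out fun h => hP2 (P.asIdeal.mul_mem_left _ h))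
      have key : 1 + cq P - cd P + cq P * cd P ≤ 2 * lamHom χ ψ (hp P) := by
        by_cases hb : chq q (absNorm P.asIdeal) = -1 ∧ chq d (absNorm P.asIdeal) = 1
        · rw [hcq, hcd]; dsimp only; rw [hb.1, hb.2]; linarith
        · have : lamHom χ ψ (hp P) = 1 := hnb P hP1 hb
          rw [this, hcq, hcd]; dsimp only
          rcases e1 with e1 | e1 <;> rcases e2 with e2 | e2 <;> rw [e1, e2] <;> norm_num
      nlinarith
  have := (abs_le.mp h3).1
  linarith

end P10
end NSq
end WrapPart10

section WrapPart11
/-! Part 11: signs of ideals and parity lemmas -/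
open NumberField NumberField.InfinitePlace NumberField.Units Module nonZeroDivisors Ideal Filter Topology
open IsDedekindDomain UniqueFactorizationMonoid

universe u
namespace NSq
section P11
open scoped Classical Pointwise
set_option linter.unusedSectionVars false
variable {F : Type u} [Field F] [NumberField F]

/-- parity character attached to a set of primes -/
noncomputable def sg (B : Set (HeightOneSpectrum (𝓞 F))) (I : Ideal (𝓞 F)) : ℤˣ :=
  ((normalizedFactors I).map (fun P => if ∃ p ∈ B, p.asIdeal = P then (-1 : ℤˣ) else 1)).prod

lemma sg_mul (B : Set (HeightOneSpectrum (𝓞 F))) {I J : Ideal (𝓞 F)} (hI : I ≠ 0) (hJ : J ≠ 0) :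
    sg B (I * J) = sg B I * sg B J := by
  unfold sg; rw [normalizedFactors_mul hI hJ, Multiset.map_add, Multiset.prod_add]

lemma sg_one (B : Set (HeightOneSpectrum (𝓞 F))) : sg B 1 = 1 := by
  unfold sg; rw [normalizedFactors_one]; simp

lemma sg_hp (B : Set (HeightOneSpectrum (𝓞 F))) (P : HeightOneSpectrum (𝓞 F)) :
    sg B P.asIdeal = if P ∈ B then -1 else 1 := by
  unfold sg
  rw [normalizedFactors_irreducible P.irreducible]
  simp only [normalize_eq, Multiset.map_singleton, Multiset.prod_singleton]
  congr 1
  apply propext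
  constructor
  · rintro ⟨p, hp, h⟩
    have : p = P := HeightOneSpectrum.ext h
    exact this ▸ hp
  · intro h; exact ⟨P, h, rfl⟩

lemma sgs_mul (B : Set (HeightOneSpectrum (𝓞 F))) {x y : 𝓞 F} (hx : x ≠ 0) (hy : y ≠ 0) :
    sg B (span {x * y}) = sg B (span {x}) * sg B (span {y}) := by
  rw [← Ideal.span_singleton_mul_span_singleton, sg_mul] <;> simpa using ‹_›

lemma sgs_sq (B : Set (HeightOneSpectrum (𝓞 F))) {x : 𝓞 F} (hx : x ≠ 0) :
    sg B (span {x ^ 2}) = 1 := by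
  rw [sq, sgs_mul _ hx hx, ← sq, Int.units_sq]

lemma sg_single (P : HeightOneSpectrum (𝓞 F)) (I : Ideal (𝓞 F)) :
    sg {P} I = (-1) ^ ((normalizedFactors I).count P.asIdeal) := by
  unfold sg
  simp only [Set.mem_singleton_iff, exists_eq_left]
  induction (normalizedFactors I) using Multiset.induction_on with
  | empty => simp
  | cons a s ih =>
    rw [Multiset.map_cons, Multiset.prod_cons, ih, Multiset.count_cons]
    split_ifs <;> simp [pow_succ]

lemma sg_of_single (B : Set (HeightOneSpectrum (𝓞 F))) (I : Ideal (𝓞 F)) (h : ∀ p ∈ B, sg {p} I = 1) :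
    sg B I = 1 := by
  unfold sg
  rw [Finset.prod_multiset_map_count]
  apply Finset.prod_eq_one
  intro P hP
  split_ifs with h1
  · obtain ⟨p, hp, rfl⟩ := h1
    rw [← sg_single]; exact h p hp
  · simp

lemma sg_notdvd (P : HeightOneSpectrum (𝓞 F)) (I : Ideal (𝓞 F)) (h : ¬ P.asIdeal ∣ I) :
    sg {P} I = 1 := by
  rw [sg_single, Multiset.count_eq_zero_of_notMem, pow_zero]
  intro hm; exact h (dvd_of_mem_normalizedFactors hm)

lemma sgs_notmem (P : HeightOneSpectrum (𝓞 F)) (x : 𝓞 F) (h : x ∉ P.asIdeal) :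
    sg {P} (span {x}) = 1 := by
  apply sg_notdvd; rwa [Ideal.dvd_span_singleton]

lemma sg_sq_dvd (P : HeightOneSpectrum (𝓞 F)) (I : Ideal (𝓞 F)) (hI : I ≠ 0) (h : sg {P} I = 1)
    (hd : P.asIdeal ∣ I) : ∃ J, I = P.asIdeal * P.asIdeal * J := by
  obtain ⟨J, rfl⟩ := hd
  have hJ : J ≠ 0 := right_ne_zero_of_mul hI
  rw [sg_mul _ P.ne_bot hJ, sg_hp] at h
  have : P.asIdeal ∣ J := by
    by_contra hn
    rw [sg_notdvd _ _ hn] at h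
    simp at h
  obtain ⟨L, rfl⟩ := this
  exact ⟨L, by ring⟩

lemma sg_split (B : Set (HeightOneSpectrum (𝓞 F))) (P : HeightOneSpectrum (𝓞 F)) (hP : P ∈ B) (I : Ideal (𝓞 F)) :
    sg B I = sg (B \ {P}) I * sg {P} I := by
  unfold sg
  rw [← Multiset.prod_map_mul]
  congr 1
  apply Multiset.map_congr rfl
  intro Q hQ
  by_cases h : Q = P.asIdeal
  · subst h
    have h1 : ∃ p ∈ B, p.asIdeal = P.asIdeal := ⟨P, hP, rfl⟩
    have h2 : ¬ ∃ p ∈ B \ {P}, p.asIdeal = P.asIdeal := by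
      rintro ⟨p, hp, h⟩
      exact hp.2 (HeightOneSpectrum.ext h)
    have h3 : ∃ p ∈ ({P} : Set (HeightOneSpectrum (𝓞 F))), p.asIdeal = P.asIdeal := ⟨P, rfl, rfl⟩
    rw [if_pos h1, if_neg h2, if_pos h3, one_mul]
  · have h3 : ¬ ∃ p ∈ ({P} : Set (HeightOneSpectrum (𝓞 F))), p.asIdeal = Q := by
      rintro ⟨p, rfl, hh⟩; exact h hh.symm
    have h4 : (∃ p ∈ B, p.asIdeal = Q) ↔ ∃ p ∈ B \ {P}, p.asIdeal = Q := by
      constructor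
      · rintro ⟨p, hp, rfl⟩
        exact ⟨p, ⟨hp, fun hh => h (by rw [hh])⟩, rfl⟩
      · rintro ⟨p, hp, rfl⟩; exact ⟨p, hp.1, rfl⟩
    rw [if_neg h3, mul_one]
    simp only [h4]

lemma absNorm_dvd_of_dvd {I J : Ideal (𝓞 F)} (h : I ∣ J) : absNorm I ∣ absNorm J := map_dvd _ h

lemma sg_chq (q : ℕ) [Fact q.Prime] (J : (Ideal (𝓞 F))⁰) :
    ¬ q ∣ absNorm (J : Ideal (𝓞 F)) →
    ((sg {p : HeightOneSpectrum (𝓞 F) | chq q (absNorm p.asIdeal) = -1} (J : Ideal (𝓞 F)) : ℤ) : ℝ)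
      = chq q (absNorm (J : Ideal (𝓞 F))) := by
  induction J using ideal_induction with
  | h1 => intro _; rw [show (((1 : (Ideal (𝓞 F))⁰)) : Ideal (𝓞 F)) = 1 from rfl, sg_one]; simp
  | hm P J ih =>
    intro h
    have e : ((hp P * J : (Ideal (𝓞 F))⁰) : Ideal (𝓞 F)) = P.asIdeal * J := rfl
    rw [e] at h ⊢
    rw [map_mul] at h
    have h1 : ¬ q ∣ absNorm P.asIdeal := fun hh => h (hh.mul_right _)
    have h2 : ¬ q ∣ absNorm (J : Ideal (𝓞 F)) := fun hh => h (hh.mul_left _)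
    rw [sg_mul _ P.ne_bot (nonZeroDivisors.ne_zero J.2), map_mul, map_mul, sg_hp, ← ih h2]
    rcases chq_pm q _ h1 with h3 | h3
    · have : ¬ (chq q (absNorm P.asIdeal) = -1) := by rw [h3]; norm_num
      simp [h3]; norm_num
    · simp [h3]

/-- dichotomy at a prime -/
lemma dich (p : HeightOneSpectrum (𝓞 F)) (A B : 𝓞 F) :
    ∃ c ∉ p.asIdeal, (A ∣ c * B ∨ B ∣ c * A) := by
  have hpr : p.asIdeal.IsPrime := p.isPrime
  have hdv : IsDiscreteValuationRing (Localization.AtPrime p.asIdeal) :=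
    IsLocalization.AtPrime.isDiscreteValuationRing_of_dedekind_domain _ p.ne_bot _
  have key : ∀ A B : 𝓞 F, algebraMap (𝓞 F) (Localization.AtPrime p.asIdeal) A ∣ algebraMap _ _ B →
      ∃ c ∉ p.asIdeal, A ∣ c * B := by
    rintro A B ⟨z, hz⟩
    obtain ⟨⟨r, s⟩, hrs⟩ := IsLocalization.surj p.asIdeal.primeCompl z
    refine ⟨s, s.2, r, ?_⟩
    have hinj : Function.Injective (algebraMap (𝓞 F) (Localization.AtPrime p.asIdeal)) :=
      IsLocalization.injective _ p.asIdeal.primeCompl_le_nonZeroDivisors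
    apply hinj
    simp only [map_mul] 
    simp only at hrs
    rw [hz, ← hrs]; ring
  rcases ValuationRing.dvd_total (algebraMap (𝓞 F) (Localization.AtPrime p.asIdeal) A) (algebraMap _ _ B) with h | h
  · obtain ⟨c, hc, h⟩ := key A B h; exact ⟨c, hc, Or.inl h⟩
  · obtain ⟨c, hc, h⟩ := key B A h; exact ⟨c, hc, Or.inr h⟩

/-- parity of a norm form at an inert prime -/
lemma parity (p : HeightOneSpectrum (𝓞 F)) (a : 𝓞 F) (ha : ∀ t, a - t ^ 2 ∉ p.asIdeal) (A B : 𝓞 F)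
    (hm : A ^ 2 - a * B ^ 2 ≠ 0) : sg {p} (span {A ^ 2 - a * B ^ 2}) = 1 := by
  have hpr : p.asIdeal.IsPrime := p.isPrime
  have hap : a ∉ p.asIdeal := by simpa using ha 0
  -- unit part
  have hu : ∀ c e : 𝓞 F, c ∉ p.asIdeal → e ^ 2 - a * c ^ 2 ∉ p.asIdeal := by
    intro c e hc hh
    have hmax : p.asIdeal.IsMaximal := p.isMaximal
    obtain ⟨c', i, hi, hci⟩ := (Ideal.IsMaximal.exists_inv hmax hc)
    apply ha (c' * e)
    have hi2 : c' * c - 1 ∈ p.asIdeal := by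
      rw [show c' * c - 1 = - i by rw [← hci]; ring]; exact neg_mem hi
    have : a - (c' * e) ^ 2 = -(c' ^ 2 * (e ^ 2 - a * c ^ 2)) - (c' * c - 1) * ((c' * c + 1) * a) := by ring
    rw [this]
    exact sub_mem (neg_mem (Ideal.mul_mem_left _ _ hh)) (Ideal.mul_mem_right _ _ hi2)
  have hne : ∀ x : 𝓞 F, x ∉ p.asIdeal → x ≠ 0 := by rintro x hx rfl; exact hx (zero_mem _)
  have fin : ∀ c m n U : 𝓞 F, c ∉ p.asIdeal → m ≠ 0 → U ∉ p.asIdeal → c ^ 2 * m = n ^ 2 * U → sg {p} (span {m}) = 1 := by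
    intro c m n U hc hm0 hU h
    have hc0 := hne c hc
    have hn0 : n ≠ 0 := by
      rintro rfl
      have : c ^ 2 * m ≠ 0 := mul_ne_zero (pow_ne_zero _ hc0) hm0
      apply this; rw [h]; ring
    have := congrArg (fun z => sg {p} (span {z})) h
    rw [sgs_mul _ (pow_ne_zero _ hc0) hm0, sgs_mul _ (pow_ne_zero _ hn0) (hne U hU), sgs_sq _ hc0, sgs_sq _ hn0,
      sgs_notmem p U hU] at this
    simpa using this
  obtain ⟨c, hc, ⟨e, h⟩ | ⟨e, h⟩⟩ := dich p A B
  · -- c B = A e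
    apply fin c _ A (c ^ 2 - a * e ^ 2) hc hm
    · by_cases hep : e ∈ p.asIdeal
      · intro hh
        apply hc
        apply hpr.mem_of_pow_mem 2
        have : c ^ 2 = (c ^ 2 - a * e ^ 2) + (a * e) * e := by ring
        rw [this]; exact add_mem hh (Ideal.mul_mem_left _ _ hep)
      · exact hu e c hep
    · linear_combination (-a) * (c * B + A * e) * h
  · apply fin c _ B (e ^ 2 - a * c ^ 2) hc hm (hu c e hc)
    linear_combination (c * A + B * e) * h


lemma inert_of_chq (q : ℕ) [Fact q.Prime] (hq8 : q % 8 = 1) (P : HeightOneSpectrum (𝓞 F))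
    (h : chq q (absNorm P.asIdeal) = -1) : ∀ t, (q : 𝓞 F) - t ^ 2 ∉ P.asIdeal := by
  have hqP : (q : 𝓞 F) ∉ P.asIdeal := by
    intro hh
    rw [← prime_dvd_norm q Fact.out, ← chq_zero_iff, h] at hh
    norm_num at hh
  have h2 : (2 : 𝓞 F) ∉ P.asIdeal := by
    intro hh
    have := chq_over_two q hq8 P hh
    rw [h] at this; norm_num at this
  have h3 := rch_prime q hq8 P h2 hqP
  rcases rch_spec P (q : 𝓞 F) hqP with ⟨h4, _⟩ | ⟨_, h5⟩
  · rw [h4, h] at h3; norm_num at h3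
  · exact h5

lemma split_of_chq (q : ℕ) [Fact q.Prime] (hq8 : q % 8 = 1) (P : HeightOneSpectrum (𝓞 F))
    (h2 : (2 : 𝓞 F) ∉ P.asIdeal) 
    (h : chq q (absNorm P.asIdeal) = 1) : ∃ t ∉ P.asIdeal, (q : 𝓞 F) - t ^ 2 ∈ P.asIdeal := by
  have hqP : (q : 𝓞 F) ∉ P.asIdeal := by
    intro hh
    rw [← prime_dvd_norm q Fact.out, ← chq_zero_iff, h] at hh
    norm_num at hh
  have h3 := rch_prime q hq8 P h2 hqP
  rcases rch_spec P (q : 𝓞 F) hqP with ⟨_, h5⟩ | ⟨h4, _⟩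
  · exact h5
  · rw [h4, h] at h3; norm_num at h3

lemma unram_div (P : HeightOneSpectrum (𝓞 F)) (a e : 𝓞 F) (ha2 : a ∉ P.asIdeal * P.asIdeal)
    (he : e ∈ P.asIdeal) : ∃ g ∉ P.asIdeal, a ∣ g * e := by
  obtain ⟨c, hc, h | ⟨e2, h⟩⟩ := dich P a e
  · exact ⟨c, hc, h⟩
  · refine ⟨e2, ?_, c, by linear_combination (-1) * h⟩
    intro he2
    apply ha2
    obtain ⟨c', i, hi, hci⟩ := Ideal.IsMaximal.exists_inv P.isMaximal hc
    have haP : a ∈ P.asIdeal := by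
      have : a = c' * (c * a) + i * a := by linear_combination (-a) * hci
      rw [this, h]
      exact add_mem (Ideal.mul_mem_left _ _ (Ideal.mul_mem_right _ _ he)) (Ideal.mul_mem_right _ _ hi)
    have : a = c' * (c * a) + i * a := by linear_combination (-a) * hci
    rw [this, h]
    exact add_mem (Ideal.mul_mem_left _ _ (Ideal.mul_mem_mul he he2)) (Ideal.mul_mem_mul hi haP)

lemma local_div (P : HeightOneSpectrum (𝓞 F)) (a r t : 𝓞 F) (ha : a ∈ P.asIdeal) (ha2 : a ∉ P.asIdeal * P.asIdeal) :
    ∃ B ∉ P.asIdeal, r ^ 2 - a * t ^ 2 ∣ B * (a * t ^ 2) := by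
  have hpr : P.asIdeal.IsPrime := P.isPrime
  have aux : ∀ x y : 𝓞 F, x ∉ P.asIdeal → x ^ 2 - a * y ∉ P.asIdeal := by
    intro x y hx hh
    apply hx
    apply hpr.mem_of_pow_mem 2
    rw [show x ^ 2 = (x ^ 2 - a * y) + a * y by ring]
    exact add_mem hh (Ideal.mul_mem_right _ _ ha)
  obtain ⟨c, hc, ⟨e, h⟩ | ⟨e, h⟩⟩ := dich P r t
  · refine ⟨(c ^ 2 - a * e ^ 2) * c ^ 2, ?_, c ^ 2 * a * e ^ 2, ?_⟩
    · intro hh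
      rcases hpr.mem_or_mem hh with h1 | h1
      · exact aux c _ hc h1
      · exact hc (hpr.mem_of_pow_mem _ h1)
    · linear_combination (c ^ 2 * a * (c * t + r * e)) * h
  · by_cases he : e ∈ P.asIdeal
    · obtain ⟨g, hg, e1, hge⟩ := unram_div P a e ha2 he
      refine ⟨(c * g) ^ 2 - a * e1 ^ 2, aux _ _ (fun hh => (hpr.mem_or_mem hh).elim hc hg), - (g * c) ^ 2, ?_⟩
      linear_combination g ^ 2 * (c * r + t * e) * h + t ^ 2 * (g * e + a * e1) * hge
    · refine ⟨e ^ 2 - a * c ^ 2, aux _ _ he, c ^ 2 * a, ?_⟩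
      linear_combination (-a) * (c * r + t * e) * h

lemma sgX_one_of_congr (q : ℕ) [Fact q.Prime] (hq8 : q % 8 = 1) (y : 𝓞 F) :
    (1 + (q : 𝓞 F) * y) ≠ 0 ∧
    sg {p : HeightOneSpectrum (𝓞 F) | chq q (absNorm p.asIdeal) = -1} (span {1 + (q : 𝓞 F) * y}) = 1 := by
  have h := chq_per q hq8 (1 : 𝓞 F) y
  have h1 : chq q (aN (1 : 𝓞 F)) = 1 := by simp [aN]
  rw [h1] at h
  have h0 : (1 + (q : 𝓞 F) * y) ≠ 0 := by
    intro h0; rw [h0] at h; simp [aN] at h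
  refine ⟨h0, ?_⟩
  have hs : span {1 + (q : 𝓞 F) * y} ∈ (Ideal (𝓞 F))⁰ := mem_nonZeroDivisors_of_ne_zero (by simpa using h0)
  have := sg_chq q ⟨_, hs⟩ (by
    rw [← chq_zero_iff]; change chq q (aN _) ≠ 0; rw [h]; norm_num)
  change _ = chq q (aN _) at this
  rw [h] at this
  have h5 : ((sg {p : HeightOneSpectrum (𝓞 F) | chq q (absNorm p.asIdeal) = -1} (span {1 + (q : 𝓞 F) * y}) : ℤˣ) : ℤ) = 1 := by
    apply Int.cast_injective (α := ℝ)
    rw [Int.cast_one]; exact this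
  exact Units.ext h5

lemma sgX_nm (q : ℕ) [Fact q.Prime] (hq8 : q % 8 = 1)
    (hunr : ∀ P : HeightOneSpectrum (𝓞 F), (q : 𝓞 F) ∈ P.asIdeal → (q : 𝓞 F) ∉ P.asIdeal * P.asIdeal)
    (d k : ℕ) (hd : d = 1 + q * k) (r t : 𝓞 F) (hn : r ^ 2 - (q * d : 𝓞 F) * t ^ 2 ≠ 0)
    (hm : r ^ 2 - (q : 𝓞 F) * t ^ 2 ≠ 0) :
    sg {p : HeightOneSpectrum (𝓞 F) | chq q (absNorm p.asIdeal) = -1} (span {r ^ 2 - (q * d : 𝓞 F) * t ^ 2}) = 1 := by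
  set X := {p : HeightOneSpectrum (𝓞 F) | chq q (absNorm p.asIdeal) = -1}
  set n := r ^ 2 - (q * d : 𝓞 F) * t ^ 2 with hnd
  set m := r ^ 2 - (q : 𝓞 F) * t ^ 2 with hmd
  have hmX : sg X (span {m}) = 1 := sg_of_single _ _ fun p hp => parity p q (inert_of_chq q hq8 p hp) r t hm
  let D : Ideal (𝓞 F) :=
    { carrier := {B | (q : 𝓞 F) * m ∣ B * (n - m)}
      add_mem' := fun {a b} ha hb => by
        rw [Set.mem_ofPred_eq] at ha hb ⊢
        rw [add_mul]; exact dvd_add ha hb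
      zero_mem' := by rw [Set.mem_ofPred_eq]; simp
      smul_mem' := fun c x hx => by
        rw [Set.mem_ofPred_eq] at hx ⊢
        rw [smul_eq_mul, mul_assoc]; exact hx.mul_left _ }
  have hD : ∀ B, B ∈ D ↔ (q : 𝓞 F) * m ∣ B * (n - m) := fun _ => Iff.rfl
  have htop : D ⊔ span {(q : 𝓞 F)} = ⊤ := by
    by_contra hne
    obtain ⟨M, hM, hle⟩ := Ideal.exists_le_maximal _ hne
    have hqM : (q : 𝓞 F) ∈ M := hle (Ideal.mem_sup_right (Ideal.mem_span_singleton_self _))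
    have hM0 : M ≠ ⊥ := by
      rintro rfl
      have : (q : 𝓞 F) = 0 := by simpa using hqM
      have h1 : q = 0 := by exact_mod_cast this
      exact (Fact.out : q.Prime).ne_zero h1
    let P : HeightOneSpectrum (𝓞 F) := ⟨M, hM.isPrime, hM0⟩
    obtain ⟨B, hB, z, hz⟩ := local_div P (q : 𝓞 F) r t hqM (hunr P hqM)
    apply hB
    apply hle
    apply Ideal.mem_sup_left
    rw [hD]
    refine ⟨- (k * z), ?_⟩
    have hdd : (d : 𝓞 F) = 1 + q * k := by rw [hd]; push_cast; ring
    rw [hnd, hmd, hdd]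
    linear_combination (-(q : 𝓞 F) * k) * hz
  have h1 : (1 : 𝓞 F) ∈ D ⊔ span {(q : 𝓞 F)} := by rw [htop]; trivial
  obtain ⟨B0, hB0, y', hy', hsum⟩ := Submodule.mem_sup.1 h1
  obtain ⟨y, rfl⟩ := Ideal.mem_span_singleton'.1 hy'
  obtain ⟨A0, hA0⟩ := (hD B0).1 hB0
  have e1 : B0 = 1 + (q : 𝓞 F) * (-y) := by linear_combination hsum
  have e2 : n * (1 + (q : 𝓞 F) * (-y)) = m * (1 + (q : 𝓞 F) * (A0 - y)) := by
    rw [e1] at hA0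
    linear_combination hA0
  obtain ⟨a1, a2⟩ := sgX_one_of_congr q hq8 (-y)
  obtain ⟨b1, b2⟩ := sgX_one_of_congr q hq8 (A0 - y)
  have e3 := congrArg (fun z => sg X (span {z})) e2
  rw [sgs_mul _ hn a1, sgs_mul _ hm b1, hmX, a2, b2] at e3
  simpa using e3

end P11
end NSq
end WrapPart11

section WrapPart12
/-! Part 12: Lemma Z -/
open NumberField NumberField.InfinitePlace NumberField.Units Module nonZeroDivisors Ideal Filter Topology
open IsDedekindDomain UniqueFactorizationMonoid

universe u
namespace NSq
section P12
open scoped Classical Pointwise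
set_option linter.unusedSectionVars false

/-- extension of a sign character from a subgroup containing the squares -/
lemma ext_sign {G : Type*} [CommGroup G] [Finite G] (H : Subgroup G) (f : H →* ℤˣ)
    (hsq : ∀ g : G, ∃ h : g ^ 2 ∈ H, f ⟨g ^ 2, h⟩ = 1) :
    ∃ ψ : G →* ℤˣ, ∀ h : H, ψ h = f h := by
  let ι : ℤˣ →* ℂˣ := Units.map (Int.castRingHom ℂ : ℤ →* ℂ)
  have hι : Function.Injective ι := Units.map_injective (fun a b h => by simpa using h)
  obtain ⟨Φ, hΦ⟩ := MonoidHom.domRestrict_surjective ℂ H (ι.comp f)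
  have hΦ' : ∀ h : H, Φ h = ι (f h) := fun h => by
    have := DFunLike.congr_fun hΦ h
    exact this
  have hr : ∀ g, ∃ e : ℤˣ, ι e = Φ g := by
    intro g
    obtain ⟨h, hf⟩ := hsq g
    have h1 : Φ g ^ 2 = 1 := by
      rw [← map_pow]
      have := hΦ' ⟨g ^ 2, h⟩
      rw [hf, map_one] at this; exact this
    have h2 : ((Φ g : ℂˣ) : ℂ) ^ 2 = 1 := by
      have := congrArg (Units.val) h1
      simpa using this
    rcases mul_self_eq_one_iff.1 ((sq _).symm.trans h2) with h | h
    · exact ⟨1, by ext; simp [h]⟩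
    · exact ⟨-1, by ext; simp [h, ι]⟩
  choose e he using hr
  refine ⟨{ toFun := e, map_one' := hι (by rw [he]; simp), map_mul' := fun x y => hι (by
    rw [map_mul, he, he, he, map_mul]) }, fun h => ?_⟩
  apply hι
  change ι (e h) = _
  rw [he, hΦ']


lemma class_char {F : Type u} [Field F] [NumberField F] (θ : (Ideal (𝓞 F))⁰ →* ℤˣ) (H : Submonoid (Ideal (𝓞 F))⁰)
    (hsq : ∀ I, I ^ 2 ∈ H) (htriv : ∀ I ∈ H, (I : Ideal (𝓞 F)).IsPrincipal → θ I = 1) :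
    ∃ ψ : ClassGroup (𝓞 F) →* ℤˣ, ∀ I ∈ H, ψ (ClassGroup.mk0 I) = θ I := by
  set h := Fintype.card (ClassGroup (𝓞 F)) with hh
  have hpos : 0 < h := Fintype.card_pos
  have hpr : ∀ I ∈ H, ∀ J ∈ H, ClassGroup.mk0 I = ClassGroup.mk0 J → θ I * θ J ^ (h - 1) = 1 := by
    intro I hI J hJ hIJ
    have h1 : ClassGroup.mk0 (I * J ^ (h - 1)) = 1 := by
      rw [map_mul, map_pow, hIJ, ← pow_succ', Nat.sub_add_cancel hpos, pow_card_eq_one]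
    rw [← map_pow, ← map_mul]
    apply htriv _ (H.mul_mem hI (H.pow_mem hJ _))
    exact (ClassGroup.mk0_eq_one_iff (I * J ^ (h - 1)).2).1 h1
  have hwd : ∀ I ∈ H, ∀ J ∈ H, ClassGroup.mk0 I = ClassGroup.mk0 J → θ I = θ J := by
    intro I hI J hJ hIJ
    have h1 := hpr I hI J hJ hIJ
    have h2 := hpr J hJ J hJ rfl
    exact mul_right_cancel (h1.trans h2.symm)
  let Hb : Subgroup (ClassGroup (𝓞 F)) :=
    { carrier := {c | ∃ I ∈ H, ClassGroup.mk0 I = c}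
      mul_mem' := by
        rintro _ _ ⟨I, hI, rfl⟩ ⟨J, hJ, rfl⟩
        exact ⟨I * J, H.mul_mem hI hJ, map_mul _ _ _⟩
      one_mem' := ⟨1, H.one_mem, map_one _⟩
      inv_mem' := by
        rintro _ ⟨I, hI, rfl⟩
        refine ⟨I ^ (h - 1), H.pow_mem hI _, ?_⟩
        rw [map_pow, eq_inv_iff_mul_eq_one, ← pow_succ, Nat.sub_add_cancel hpos, pow_card_eq_one] }
  have hrep : ∀ c : Hb, ∃ I ∈ H, ClassGroup.mk0 I = c := fun c => c.2
  choose r hr1 hr2 using hrep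
  let f : Hb →* ℤˣ :=
    { toFun := fun c => θ (r c)
      map_one' := by
        rw [hwd _ (hr1 1) 1 H.one_mem (by rw [hr2]; simp), map_one]
      map_mul' := fun x y => by
        rw [hwd _ (hr1 (x * y)) (r x * r y) (H.mul_mem (hr1 _) (hr1 _)) (by rw [hr2, map_mul, hr2, hr2]; rfl), map_mul] }
  have hf : ∀ I (hI : I ∈ H) (hc : ClassGroup.mk0 I ∈ Hb), f ⟨ClassGroup.mk0 I, hc⟩ = θ I := by
    intro I hI hc
    exact hwd _ (hr1 _) I hI (hr2 _)
  obtain ⟨ψ, hψ⟩ := ext_sign Hb f (by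
    intro g
    obtain ⟨I, rfl⟩ := ClassGroup.mk0_surjective g
    have hc : ClassGroup.mk0 (I ^ 2) ∈ Hb := ⟨_, hsq I, rfl⟩
    have h1 := hf (I ^ 2) (hsq I) hc
    have h2 : θ (I ^ 2) = 1 := by rw [map_pow, Int.units_sq]
    rw [h2] at h1
    have e : ClassGroup.mk0 (I ^ 2) = ClassGroup.mk0 I ^ 2 := map_pow _ _ _
    simp only [e] at h1
    exact ⟨_, h1⟩)
  refine ⟨ψ, fun I hI => ?_⟩
  have hc : ClassGroup.mk0 I ∈ Hb := ⟨_, hI, rfl⟩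
  rw [← hf I hI hc]; exact hψ ⟨_, hc⟩

variable {K F : Type*} [Field K] [NumberField K] [Field F] [NumberField F] [Algebra K F]

lemma sg_pow (B : Set (HeightOneSpectrum (𝓞 K))) {I : Ideal (𝓞 K)} (hI : I ≠ 0) (n : ℕ) :
    sg B (I ^ n) = sg B I ^ n := by
  induction n with
  | zero => rw [pow_zero, pow_zero, sg_one]
  | succ n ih => rw [pow_succ, pow_succ, sg_mul _ (pow_ne_zero _ hI) hI, ih]

/-- sign of relative norm -/
noncomputable def sgN (F : Type*) [Field F] [NumberField F] [Algebra K F] (B : Set (HeightOneSpectrum (𝓞 K))) :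
    (Ideal (𝓞 F))⁰ →* ℤˣ where
  toFun I := sg B (relNorm (𝓞 K) (I : Ideal (𝓞 F)))
  map_one' := by
    rw [show (((1 : (Ideal (𝓞 F))⁰)) : Ideal (𝓞 F)) = 1 from rfl, map_one, sg_one]
  map_mul' I J := by
    have h : ∀ I : (Ideal (𝓞 F))⁰, relNorm (𝓞 K) (I : Ideal (𝓞 F)) ≠ 0 := fun I hI =>
      nonZeroDivisors.ne_zero I.2 (relNorm_eq_bot_iff.1 hI)
    rw [Submonoid.coe_mul, map_mul, sg_mul _ (h I) (h J)]

lemma sgN_hp (B : Set (HeightOneSpectrum (𝓞 K))) (P : HeightOneSpectrum (𝓞 F)) :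
    sgN F B (hp P) = (if und P ∈ B then -1 else 1) ^ (P.asIdeal.inertiaDeg (𝓞 K)) := by
  change sg B (relNorm (𝓞 K) P.asIdeal) = _
  rw [relNorm_hp, sg_pow _ (und P).ne_bot, sg_hp]

theorem lemZ (q d : ℕ) [Fact q.Prime] [Fact d.Prime] (hq8 : q % 8 = 1) (hd8 : d % 8 = 1)
    (hqF : ¬ ∃ s : F, (q : F) = s ^ 2) (hdF : ¬ ∃ s : F, (d : F) = s ^ 2)
    (hqdF : ¬ ∃ s : F, ((q * d : ℕ) : F) = s ^ 2)
    (χ : ℕ →*₀ ℝ) (hχ : ∀ n, |χ n| ≤ 1) (hper : ∀ γ δ : 𝓞 F, χ (aN (γ + (q : 𝓞 F) * δ)) = χ (aN γ))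
    (hχq : ∀ n, χ n ≠ 0 → ¬ q ∣ n)
    (B : Set (HeightOneSpectrum (𝓞 K))) (a : 𝓞 K) (ha : a ≠ 0)
    (hB : ∀ p : HeightOneSpectrum (𝓞 K), a ∉ p.asIdeal → (if p ∈ B then -1 else 1) * χ (absNorm p.asIdeal) = 1)
    (W : HeightOneSpectrum (𝓞 F)) (hW : Odd (W.asIdeal.inertiaDeg (𝓞 K)))
    (hBw : (if und W ∈ B then -1 else 1) * χ (absNorm (und (F := K) W).asIdeal) = -1) :
    ∃ γ : 𝓞 F, γ ≠ 0 ∧ (∀ p : HeightOneSpectrum (𝓞 K), p ≠ und W → chq q (absNorm p.asIdeal) = -1 → chq d (absNorm p.asIdeal) = 1 →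
        sg {p} (span {Algebra.intNorm (𝓞 K) (𝓞 F) γ}) = 1) ∧
      sg B (span {Algebra.intNorm (𝓞 K) (𝓞 F) γ}) = -1 := by
  by_contra hcon
  push Not at hcon
  let H : Submonoid (Ideal (𝓞 F))⁰ :=
    { carrier := {I | ∀ p : HeightOneSpectrum (𝓞 K), p ≠ und W → chq q (absNorm p.asIdeal) = -1 → chq d (absNorm p.asIdeal) = 1 →
        sgN F {p} I = 1}
      mul_mem' := fun {I J} hI hJ p h1 h2 h3 => by
        rw [map_mul, hI p h1 h2 h3, hJ p h1 h2 h3, one_mul]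
      one_mem' := fun p h1 h2 h3 => map_one _ }
  have hH : ∀ I, I ∈ H ↔ ∀ p : HeightOneSpectrum (𝓞 K), p ≠ und W → chq q (absNorm p.asIdeal) = -1 → chq d (absNorm p.asIdeal) = 1 →
        sgN F {p} I = 1 := fun _ => Iff.rfl
  obtain ⟨ψ, hψ⟩ := class_char (sgN F B) H (fun I => (hH _).2 fun p _ _ _ => by rw [map_pow, Int.units_sq]) (by
    rintro ⟨I, hI0⟩ hI ⟨γ, rfl⟩
    change span {γ} ∈ _ at hI0
    have hγ : γ ≠ 0 := by
      rintro rfl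
      exact nonZeroDivisors.ne_zero hI0 (by simp)
    have e : ∀ B' : Set (HeightOneSpectrum (𝓞 K)), sgN F B' ⟨span {γ}, hI0⟩ = sg B' (span {Algebra.intNorm (𝓞 K) (𝓞 F) γ}) := by
      intro B'
      change sg B' (relNorm (𝓞 K) (span {γ})) = _
      rw [relNorm_singleton]
    have := hcon γ hγ (fun p h1 h2 h3 => by rw [← e]; exact (hH _).1 hI p h1 h2 h3)
    change sgN F B ⟨span {γ}, hI0⟩ = 1
    rw [e]
    exact (Int.units_eq_one_or _).resolve_right this)
  have hval : ∀ P : HeightOneSpectrum (𝓞 F), hp P ∈ H → lam χ ψ (hp P) =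
      ((if und P ∈ B then -1 else 1) * χ (absNorm (und (F := K) P).asIdeal)) ^ (P.asIdeal.inertiaDeg (𝓞 K)) := by
    intro P hP
    have e : absNorm ((hp P : (Ideal (𝓞 F))⁰) : Ideal (𝓞 F)) = absNorm (und (F := K) P).asIdeal ^ (P.asIdeal.inertiaDeg (𝓞 K)) :=
      absNorm_hp P
    rw [lam, hψ _ hP, sgN_hp, e, map_pow, mul_pow]
    congr 1
    split_ifs <;> simp
  have hinH : ∀ P : HeightOneSpectrum (𝓞 F), (∀ p : HeightOneSpectrum (𝓞 K), p ≠ und W → chq q (absNorm p.asIdeal) = -1 → chq d (absNorm p.asIdeal) = 1 →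
      p = und P → Even (P.asIdeal.inertiaDeg (𝓞 K))) → hp P ∈ H := by
    intro P h
    rw [hH]
    intro p h1 h2 h3
    rw [sgN_hp]
    split_ifs with h4
    · exact (h p h1 h2 h3 h4.symm).neg_one_pow
    · exact one_pow _
  refine thmN q d hq8 hd8 hqF hdF hqdF χ hχ hper hχq ψ {P | algebraMap (𝓞 K) (𝓞 F) a ∈ P.asIdeal}
    (finite_mem _ (by simpa using ha)) ?_ (hp W) ?_
  · intro P hP hnb
    rw [hval, hB _ hP, one_pow]
    apply hinH
    rintro p h1 h2 h3 rfl
    by_contra hodd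
    rw [Nat.not_even_iff_odd] at hodd
    apply hnb
    rw [absNorm_hp (F := K) P, map_pow, map_pow, h2, h3, one_pow, hodd.neg_one_pow]
    exact ⟨rfl, rfl⟩
  · rw [hval, hBw, hW.neg_one_pow]
    apply hinH
    rintro p h1 _ _ h2
    exact absurd h2 h1

end P12
end NSq
end WrapPart12

section WrapPart13
/-! Part 13: Lemma A -/
open NumberField NumberField.InfinitePlace NumberField.Units Module nonZeroDivisors Ideal Filter Topology
open IsDedekindDomain UniqueFactorizationMonoid

universe u
namespace NSq
section P13
open scoped Classical Pointwise
set_option linter.unusedSectionVars false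

section quad
variable {L M : Type*} [Field L] [NumberField L] [Field M] [NumberField M] [Algebra L M]
  [Algebra.IsQuadraticExtension L M]

lemma quad_gal (a : L) (ha : ¬ ∃ s : L, a = s ^ 2) (δ : M) (hδ : δ ^ 2 = algebraMap L M a) :
    ∃ σ : Gal(M/L), σ δ = - δ ∧ σ ≠ 1 ∧ (Finset.univ : Finset Gal(M/L)) = {1, σ} := by
  obtain ⟨σ, hσ⟩ := exists_conj a ha δ hδ
  have hδ0 : δ ≠ 0 := by
    rintro rfl
    refine ha ⟨0, ?_⟩
    apply (algebraMap L M).injective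
    rw [← hδ]; simp
  have hne : σ ≠ 1 := by
    rintro rfl
    simp only [AlgEquiv.one_apply] at hσ
    exact hδ0 (self_eq_neg.1 hσ)
  refine ⟨σ, hσ, hne, ?_⟩
  symm
  apply Finset.eq_univ_of_card
  rw [Finset.card_pair hne.symm, ← Nat.card_eq_fintype_card, IsGalois.card_aut_eq_finrank,
    Algebra.IsQuadraticExtension.finrank_eq_two]

lemma quad_rep (a : L) (ha : ¬ ∃ s : L, a = s ^ 2) (δ : M) (hδ : δ ^ 2 = algebraMap L M a) (γ : M) :
    ∃ y z : L, γ = algebraMap L M y + algebraMap L M z * δ := by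
  obtain ⟨σ, hσ, hne, hu⟩ := quad_gal a ha δ hδ
  have hδ0 : δ ≠ 0 := by
    rintro rfl
    refine ha ⟨0, ?_⟩
    apply (algebraMap L M).injective
    rw [← hδ]; simp
  have hall : ∀ τ : Gal(M/L), τ = 1 ∨ τ = σ := by
    intro τ
    have : τ ∈ (Finset.univ : Finset Gal(M/L)) := Finset.mem_univ _
    rw [hu] at this; simpa using this
  have hσσ : ∀ x, σ (σ x) = x := by
    intro x
    rcases hall (σ * σ) with h | h
    · have := congrArg (fun f : Gal(M/L) => f x) h
      simpa using this
    · exact absurd (mul_eq_left.1 h) hne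
  have hfix : ∀ x : M, σ x = x → ∃ y : L, algebraMap L M y = x := by
    intro x hx
    apply (IsGalois.mem_range_algebraMap_iff_fixed x).2
    intro τ
    rcases hall τ with rfl | rfl
    · simp
    · exact hx
  obtain ⟨y, hy⟩ := hfix ((γ + σ γ) / 2) (by
    rw [map_div₀, map_add, hσσ, map_ofNat, add_comm])
  obtain ⟨z, hz⟩ := hfix ((γ - σ γ) / (2 * δ)) (by
    simp only [map_div₀, map_sub, map_mul, hσσ, hσ, map_ofNat]
    field_simp; ring)
  refine ⟨y, z, ?_⟩
  rw [hy, hz]; field_simp; ring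

lemma quad_norm (a : L) (ha : ¬ ∃ s : L, a = s ^ 2) (δ : M) (hδ : δ ^ 2 = algebraMap L M a) (y z : L) :
    Algebra.norm L (algebraMap L M y + algebraMap L M z * δ) = y ^ 2 - a * z ^ 2 := by
  obtain ⟨σ, hσ, hne, hu⟩ := quad_gal a ha δ hδ
  apply (algebraMap L M).injective
  rw [Algebra.norm_eq_prod_automorphisms, hu, Finset.prod_pair hne.symm]
  simp only [AlgEquiv.one_apply, map_add, map_mul, AlgEquiv.commutes, hσ, map_sub, map_pow, ← hδ]
  ring

lemma intNorm_rep (a : L) (ha : ¬ ∃ s : L, a = s ^ 2) (δ : M) (hδ : δ ^ 2 = algebraMap L M a) (γ : 𝓞 M) :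
    ∃ y z : L, ((Algebra.intNorm (𝓞 L) (𝓞 M) γ : 𝓞 L) : L) = y ^ 2 - a * z ^ 2 := by
  obtain ⟨y, z, h⟩ := quad_rep a ha δ hδ (γ : M)
  refine ⟨y, z, ?_⟩
  have := Algebra.algebraMap_intNorm (A := 𝓞 L) (K := L) (L := M) (B := 𝓞 M) γ
  rw [← quad_norm a ha δ hδ, ← h]
  exact this

/-- an ideal whose non-norm prime factors appear evenly is a relative norm -/
lemma is_relNorm_wf (C : Ideal (𝓞 L) → Prop) (I : Ideal (𝓞 L)) (h : ∀ I, (∀ J, DvdNotUnit J I → C J) → C I) : C I :=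
  WellFounded.induction (wellFounded_dvdNotUnit (α := Ideal (𝓞 L))) I h

lemma is_relNorm (I : Ideal (𝓞 L)) : I ≠ 0 →
    (∀ P : HeightOneSpectrum (𝓞 L), (¬ ∃ Q : Ideal (𝓞 M), relNorm (𝓞 L) Q = P.asIdeal) → sg {P} I = 1) →
    ∃ J : Ideal (𝓞 M), relNorm (𝓞 L) J = I := by
  induction I using is_relNorm_wf with
  | _ I ih =>
  intro hI h
  by_cases hu : IsUnit I
  · refine ⟨1, ?_⟩
    rw [map_one]; rw [Ideal.one_eq_top]; exact (Ideal.isUnit_iff.1 hu).symm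
  obtain ⟨p, hp, hpI⟩ := WfDvdMonoid.exists_irreducible_factor hu hI
  let P : HeightOneSpectrum (𝓞 L) := ⟨p, Ideal.isPrime_of_prime hp.prime, hp.ne_zero⟩
  by_cases hn : ∃ Q : Ideal (𝓞 M), relNorm (𝓞 L) Q = P.asIdeal
  · obtain ⟨Q, hQ⟩ := hn
    obtain ⟨J, rfl⟩ := hpI
    have hJ : J ≠ 0 := right_ne_zero_of_mul hI
    obtain ⟨J', hJ'⟩ := ih J ⟨hJ, p, hp.not_isUnit, mul_comm _ _⟩ hJ (by
      intro P' hP'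
      have h1 := h P' hP'
      rw [sg_mul _ hp.ne_zero hJ] at h1
      have h2 : sg {P'} p = 1 := by
        change sg {P'} P.asIdeal = 1
        rw [sg_hp, if_neg]
        rintro rfl
        exact hP' ⟨Q, hQ⟩
      rwa [h2, one_mul] at h1)
    exact ⟨Q * J', by rw [map_mul, hQ, hJ']⟩
  · obtain ⟨J, hJe⟩ := sg_sq_dvd P I hI (h P hn) hpI
    have hJ : J ≠ 0 := by rintro rfl; exact hI (by rw [hJe]; simp)
    have hPP : P.asIdeal * P.asIdeal ≠ 0 := mul_ne_zero P.ne_bot P.ne_bot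
    obtain ⟨J', hJ'⟩ := ih J ⟨hJ, P.asIdeal * P.asIdeal, fun hh => hp.not_isUnit (isUnit_of_mul_isUnit_left hh), by rw [hJe, mul_comm]⟩ hJ (by
      intro P' hP'
      have h1 := h P' hP'
      rw [hJe, sg_mul _ hPP hJ, sg_mul _ P.ne_bot P.ne_bot, ← sq, Int.units_sq, one_mul] at h1
      exact h1)
    refine ⟨Ideal.map (algebraMap (𝓞 L) (𝓞 M)) P.asIdeal * J', ?_⟩
    rw [map_mul, hJ', hJe, relNorm_algebraMap]
    have : finrank (𝓞 L) (𝓞 M) = 2 := by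
      have h1 := IsFractionRing.finrank_eq (𝓞 L) L (𝓞 M) M
      rw [Algebra.IsQuadraticExtension.finrank_eq_two] at h1
      exact h1.symm
    rw [this, sq]


/-- extension of an evenly divisible ideal -/
lemma sg_map (P : HeightOneSpectrum (𝓞 M)) (I : Ideal (𝓞 L)) : I ≠ 0 → sg {und (F := L) P} I = 1 →
    sg {P} (Ideal.map (algebraMap (𝓞 L) (𝓞 M)) I) = 1 := by
  induction I using is_relNorm_wf with
  | _ I ih =>
  intro hI h
  by_cases hd : (und (F := L) P).asIdeal ∣ I
  · obtain ⟨J, hJe⟩ := sg_sq_dvd _ I hI h hd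
    have hJ : J ≠ 0 := by rintro rfl; exact hI (by rw [hJe]; simp)
    have hPP : (und (F := L) P).asIdeal * (und (F := L) P).asIdeal ≠ 0 := mul_ne_zero (und P).ne_bot (und P).ne_bot
    have hinj := FaithfulSMul.algebraMap_injective (𝓞 L) (𝓞 M)
    have hm : ∀ I : Ideal (𝓞 L), I ≠ 0 → Ideal.map (algebraMap (𝓞 L) (𝓞 M)) I ≠ 0 := fun I hI hh =>
      hI ((Ideal.map_eq_bot_iff_of_injective hinj).1 hh)
    have h2 := ih J ⟨hJ, (und (F := L) P).asIdeal * (und (F := L) P).asIdeal,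
      fun hh => (und (F := L) P).irreducible.not_isUnit (isUnit_of_mul_isUnit_left hh), by rw [hJe, mul_comm]⟩ hJ (by
        rw [hJe, sg_mul _ hPP hJ, sg_mul _ (und P).ne_bot (und P).ne_bot, ← sq, Int.units_sq, one_mul] at h
        exact h)
    rw [hJe, Ideal.map_mul, sg_mul _ (hm _ hPP) (hm _ hJ), Ideal.map_mul, sg_mul _ (hm _ (und P).ne_bot) (hm _ (und P).ne_bot),
      ← sq, Int.units_sq, h2, one_mul]
  · apply sg_notdvd
    intro hh
    apply hd
    rw [Ideal.dvd_iff_le] at hh ⊢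
    exact Ideal.map_le_iff_le_comap.1 hh

end quad

section cover
variable {L : Type*} [Field L]

/-- finitely many cosets of the norm form suffice -/
def FC (a : L) (X : Set L) : Prop :=
  ∃ Ω : Set L, Ω.Finite ∧ (∀ κ ∈ Ω, κ ≠ 0) ∧ ∀ x ∈ X, ∃ κ ∈ Ω, ∃ u v : L, x = κ * (u ^ 2 - a * v ^ 2)

lemma FC_step (a : L) (X X' : Set L) (h0 : ∀ x ∈ X, x ≠ 0) {Y : Type*} [Finite Y] (f : X → Y)
    (hf : ∀ x1 x2 : X, f x1 = f x2 → (x1 : L) * x2 ∈ X') (h : FC a X') : FC a X := by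
  obtain ⟨Ω, hΩ, hΩ0, hc⟩ := h
  have hY : ∀ y : Y, ∃ z : L, z ≠ 0 ∧ ∀ x : X, f x = y → (x : L) * z ∈ X' := by
    intro y
    by_cases hy : ∃ x, f x = y
    · obtain ⟨x, rfl⟩ := hy
      exact ⟨x, h0 _ x.2, fun x' hx' => hf x' x hx'⟩
    · exact ⟨1, one_ne_zero, fun x hx => absurd ⟨x, hx⟩ hy⟩
  choose z hz0 hz using hY
  refine ⟨Set.image2 (fun κ y => κ / z y) Ω Set.univ, hΩ.image2 _ Set.finite_univ, ?_, ?_⟩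
  · rintro _ ⟨κ, hκ, y, -, rfl⟩
    exact div_ne_zero (hΩ0 κ hκ) (hz0 y)
  · intro x hx
    obtain ⟨κ, hκ, u, v, huv⟩ := hc _ (hz (f ⟨x, hx⟩) ⟨x, hx⟩ rfl)
    refine ⟨κ / z (f ⟨x, hx⟩), ⟨κ, hκ, _, trivial, rfl⟩, u, v, ?_⟩
    have := hz0 (f ⟨x, hx⟩)
    rw [div_mul_eq_mul_div, ← huv]
    field_simp

/-- the nonzero values of the norm form -/
def NF (a : L) : Set L := {x | x ≠ 0 ∧ ∃ u v : L, x = u ^ 2 - a * v ^ 2}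

lemma NF_mul (a : L) {x y : L} (hx : x ∈ NF a) (hy : y ∈ NF a) : x * y ∈ NF a := by
  obtain ⟨hx0, u, v, rfl⟩ := hx
  obtain ⟨hy0, r, s, rfl⟩ := hy
  exact ⟨mul_ne_zero hx0 hy0, u * r + a * v * s, u * s + v * r, by ring⟩

lemma NF_sq (a : L) {x : L} (hx : x ≠ 0) : x ^ 2 ∈ NF a := ⟨pow_ne_zero _ hx, x, 0, by ring⟩

lemma NF_div_sq (a : L) {x y : L} (hy : y ≠ 0) (hx : x ∈ NF a) : x / y ^ 2 ∈ NF a := by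
  have := NF_mul a hx (NF_sq a (inv_ne_zero hy))
  rwa [inv_pow, ← div_eq_mul_inv] at this

lemma FC_NF (a : L) : FC a (NF a) :=
  ⟨{1}, Set.finite_singleton _, by simp, fun x hx => ⟨1, rfl, by
    obtain ⟨_, u, v, h⟩ := hx; exact ⟨u, v, by rw [h, one_mul]⟩⟩⟩

end cover

section lemA
variable {L M : Type*} [Field L] [NumberField L] [Field M] [NumberField M] [Algebra L M]
  [Algebra.IsQuadraticExtension L M]

lemma units_mod_sq (L : Type*) [Field L] [NumberField L] : ∃ (Y : Type) (_ : Finite Y) (f : (𝓞 L)ˣ → Y),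
    ∀ x y, f x = f y → ∃ z, x * y = z ^ 2 := by
  have h := fun u => (exist_unique_eq_mul_prod L u).exists
  choose g hg using h
  have hfin : Finite (torsion L) := inferInstance
  obtain ⟨n, ⟨e⟩⟩ := finite_iff_exists_equiv_fin.1 hfin
  refine ⟨Fin n × (Fin (rank L) → ZMod 2), inferInstance, fun u => (e (g u).1, fun i => ((g u).2 i : ZMod 2)), ?_⟩
  intro x y hxy
  have h1 : (g x).1 = (g y).1 := e.injective (congrArg Prod.fst hxy)
  have h2 : ∀ i, ∃ k : ℤ, (g x).2 i + (g y).2 i = 2 * k := by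
    intro i
    have h3 : ((g x).2 i : ZMod 2) = ((g y).2 i : ZMod 2) := congrFun (congrArg Prod.snd hxy) i
    have h4 := (ZMod.intCast_eq_intCast_iff_dvd_sub _ _ 2).1 h3
    obtain ⟨k, hk⟩ := h4
    push_cast at hk
    exact ⟨k + (g x).2 i, by linarith⟩
  choose k hk using h2
  refine ⟨((g x).1 : (𝓞 L)ˣ) * ∏ i, fundSystem L i ^ k i, ?_⟩
  conv_lhs => rw [hg x, hg y]
  rw [h1, mul_pow, ← Finset.prod_pow, mul_mul_mul_comm, ← sq, ← Finset.prod_mul_distrib]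
  congr 1
  apply Finset.prod_congr rfl
  intro i _
  rw [← zpow_add, hk, mul_comm, zpow_mul]; rfl

lemma FC_X2 (a : L) : FC a {x | ∃ (ε : (𝓞 L)ˣ) (n : L), n ∈ NF a ∧ x = ((ε : 𝓞 L) : L) * n} := by
  obtain ⟨Y, _, f, hf⟩ := units_mod_sq L
  have hε : ∀ ε : (𝓞 L)ˣ, ((ε : 𝓞 L) : L) ≠ 0 := fun ε => by
    rw [Ne, RingOfIntegers.coe_eq_zero_iff]; exact ε.ne_zero
  refine FC_step a _ (NF a) ?_ (fun x => f x.2.choose) ?_ (FC_NF a)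
  · rintro x ⟨ε, n, hn, rfl⟩
    exact mul_ne_zero (hε ε) hn.1
  · intro x1 x2 h
    obtain ⟨z, hz⟩ := hf _ _ h
    obtain ⟨n1, hn1, e1⟩ := x1.2.choose_spec
    obtain ⟨n2, hn2, e2⟩ := x2.2.choose_spec
    have hz' : ((x1.2.choose : 𝓞 L) : L) * ((x2.2.choose : 𝓞 L) : L) = ((z : 𝓞 L) : L) ^ 2 := by
      rw [← map_mul, ← Units.val_mul, hz, Units.val_pow_eq_pow_val, map_pow]
    rw [e1, e2, mul_mul_mul_comm, hz']
    exact NF_mul a (NF_sq a (hε z)) (NF_mul a hn1 hn2)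

lemma FC_X1 (a : L) (ha : ¬ ∃ s : L, a = s ^ 2) (δ : M) (hδ : δ ^ 2 = algebraMap L M a) :
    FC a {x | ∃ c : 𝓞 L, c ≠ 0 ∧ (∃ J : Ideal (𝓞 M), relNorm (𝓞 L) J = span {c}) ∧ x = c} := by
  have hJ : ∀ x : {x : L | ∃ c : 𝓞 L, c ≠ 0 ∧ (∃ J : Ideal (𝓞 M), relNorm (𝓞 L) J = span {c}) ∧ x = c},
      ∃ (c : 𝓞 L) (J : (Ideal (𝓞 M))⁰), c ≠ 0 ∧ relNorm (𝓞 L) (J : Ideal (𝓞 M)) = span {c} ∧ (x : L) = c := by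
    rintro ⟨x, c, hc, ⟨J, hJ⟩, hx⟩
    refine ⟨c, ⟨J, mem_nonZeroDivisors_of_ne_zero ?_⟩, hc, hJ, hx⟩
    rintro rfl
    rw [map_zero] at hJ
    exact hc (by simpa using hJ.symm)
  choose c J hc hJ hx using hJ
  set h := Fintype.card (ClassGroup (𝓞 M)) with hh
  have hpos : 0 < h := Fintype.card_pos
  refine FC_step a _ _ ?_ (fun x => ClassGroup.mk0 (J x)) ?_ (FC_X2 a)
  · rintro x ⟨c, hc, -, rfl⟩
    rw [Ne, RingOfIntegers.coe_eq_zero_iff]; exact hc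
  · intro x1 x2 h12
    have h1 : ClassGroup.mk0 (J x1 * J x2 ^ (2 * h - 1)) = 1 := by
      have e : 2 * h - 1 + 1 = h * 2 := by omega
      rw [map_mul, map_pow, h12, ← pow_succ', e, pow_mul, pow_card_eq_one, one_pow]
    obtain ⟨γ, hγ⟩ := (ClassGroup.mk0_eq_one_iff (J x1 * J x2 ^ (2 * h - 1)).2).1 h1
    have h2 := congrArg (relNorm (𝓞 L)) hγ
    change relNorm (𝓞 L) ((J x1 : Ideal (𝓞 M)) * (J x2 : Ideal (𝓞 M)) ^ (2 * h - 1)) = relNorm (𝓞 L) (span {γ}) at h2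
    rw [map_mul, map_pow, hJ, hJ, relNorm_singleton, Ideal.span_singleton_pow, Ideal.span_singleton_mul_span_singleton,
      Ideal.span_singleton_eq_span_singleton] at h2
    obtain ⟨ε, hε⟩ := h2.symm
    obtain ⟨y, z, hyz⟩ := intNorm_rep a ha δ hδ γ
    have hc2 : ((c x2 : 𝓞 L) : L) ≠ 0 := by rw [Ne, RingOfIntegers.coe_eq_zero_iff]; exact hc x2
    have hc1 : ((c x1 : 𝓞 L) : L) ≠ 0 := by rw [Ne, RingOfIntegers.coe_eq_zero_iff]; exact hc x1
    have hε' : (y ^ 2 - a * z ^ 2) * ((ε : 𝓞 L) : L) = ((c x1 : 𝓞 L) : L) * ((c x2 : 𝓞 L) : L) ^ (2 * h - 1) := by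
      have h3 := congrArg (algebraMap (𝓞 L) L) hε
      rw [map_mul, map_mul, map_pow] at h3
      rw [← hyz]; exact h3
    have hn0 : y ^ 2 - a * z ^ 2 ≠ 0 := by
      intro h0
      rw [h0, zero_mul] at hε'
      exact mul_ne_zero hc1 (pow_ne_zero _ hc2) hε'.symm
    refine ⟨ε, _, NF_div_sq a (pow_ne_zero (h - 1) hc2) ⟨hn0, y, z, rfl⟩, ?_⟩
    rw [hx x1, hx x2, mul_div_assoc', mul_comm _ (y ^ 2 - a * z ^ 2), hε', ← pow_mul,
      eq_div_iff (pow_ne_zero _ hc2), mul_assoc, ← pow_succ', show (h - 1) * 2 + 1 = 2 * h - 1 by omega]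

lemma FC_X0 (a : L) (ha : ¬ ∃ s : L, a = s ^ 2) (δ : M) (hδ : δ ^ 2 = algebraMap L M a)
    (S : Set (HeightOneSpectrum (𝓞 L))) (hS : S.Finite) :
    FC a {x | ∃ c : 𝓞 L, c ≠ 0 ∧ (∀ P : HeightOneSpectrum (𝓞 L), P ∉ S → (¬ ∃ Q : Ideal (𝓞 M), relNorm (𝓞 L) Q = P.asIdeal) →
      sg {P} (span {c}) = 1) ∧ x = c} := by
  have : Finite S := hS
  have hc : ∀ x : {x : L | ∃ c : 𝓞 L, c ≠ 0 ∧ (∀ P : HeightOneSpectrum (𝓞 L), P ∉ S → (¬ ∃ Q : Ideal (𝓞 M), relNorm (𝓞 L) Q = P.asIdeal) →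
      sg {P} (span {c}) = 1) ∧ x = c}, ∃ c : 𝓞 L, c ≠ 0 ∧ (∀ P : HeightOneSpectrum (𝓞 L), P ∉ S → (¬ ∃ Q : Ideal (𝓞 M), relNorm (𝓞 L) Q = P.asIdeal) →
      sg {P} (span {c}) = 1) ∧ (x : L) = c := fun x => x.2
  choose c hc0 hcP hx using hc
  refine FC_step a _ _ ?_ (fun x (P : S) => sg {(P : HeightOneSpectrum (𝓞 L))} (span {c x})) ?_ (FC_X1 a ha δ hδ)
  · rintro x ⟨c, hc, -, rfl⟩
    rw [Ne, RingOfIntegers.coe_eq_zero_iff]; exact hc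
  · intro x1 x2 h12
    refine ⟨c x1 * c x2, mul_ne_zero (hc0 _) (hc0 _), ?_, by
      rw [hx x1, hx x2]; exact (map_mul (algebraMap (𝓞 L) L) _ _).symm⟩
    apply is_relNorm _ (by simpa using ⟨hc0 x1, hc0 x2⟩)
    intro P hP
    rw [sgs_mul _ (hc0 _) (hc0 _)]
    by_cases hPS : P ∈ S
    · have := congrFun h12 ⟨P, hPS⟩
      simp only at this
      rw [this, ← sq, Int.units_sq]
    · rw [hcP x1 P hPS hP, hcP x2 P hPS hP, one_mul]

theorem lemA {K : Type*} [Field K] [NumberField K] [Algebra K L] [Algebra.IsQuadraticExtension K L]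
    (q d : ℕ) [Fact q.Prime] [Fact d.Prime] (hq8 : q % 8 = 1) (hd8 : d % 8 = 1)
    (hqL : ¬ ∃ s : L, (q : L) = s ^ 2) (η : L) (hη : η ^ 2 = (d : L)) (δ : M) (hδ : δ ^ 2 = (q : M))
    (w : HeightOneSpectrum (𝓞 K)) :
    FC (q : L) {x | ∃ b : 𝓞 K, b ≠ 0 ∧ (∀ p : HeightOneSpectrum (𝓞 K), p ≠ w → chq q (absNorm p.asIdeal) = -1 → chq d (absNorm p.asIdeal) = 1 →
        sg {p} (span {b}) = 1) ∧ x = algebraMap K L b} := by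
  obtain ⟨a, haw, ha0⟩ := Submodule.exists_mem_ne_zero_of_ne_bot w.ne_bot
  have hq0 : (q : 𝓞 L) ≠ 0 := by exact_mod_cast (Fact.out : q.Prime).ne_zero
  have hd0 : (d : 𝓞 L) ≠ 0 := by exact_mod_cast (Fact.out : d.Prime).ne_zero
  have hfin := finite_mem (2 * (q : 𝓞 L) * (d : 𝓞 L) * algebraMap (𝓞 K) (𝓞 L) a) (by
    simp only [ne_eq, mul_eq_zero, not_or]
    exact ⟨⟨⟨two_ne_zero, hq0⟩, hd0⟩, by simpa using ha0⟩)
  obtain ⟨Ω, h1, h2, h3⟩ := FC_X0 (q : L) hqL δ (by rw [hδ]; simp) _ hfin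
  refine ⟨Ω, h1, h2, ?_⟩
  rintro x ⟨b, hb0, hb, rfl⟩
  apply h3
  refine ⟨algebraMap (𝓞 K) (𝓞 L) b, by simpa using hb0, ?_, rfl⟩
  intro P hPS hPn
  have hPpr : P.asIdeal.IsPrime := P.isPrime
  have hPS' : 2 * (q : 𝓞 L) * (d : 𝓞 L) * algebraMap (𝓞 K) (𝓞 L) a ∉ P.asIdeal := hPS
  have hP2 : (2 : 𝓞 L) ∉ P.asIdeal := fun hh => hPS' (Ideal.mul_mem_right _ _ (Ideal.mul_mem_right _ _ (Ideal.mul_mem_right _ _ hh)))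
  have hPq : (q : 𝓞 L) ∉ P.asIdeal := fun hh => hPS' (Ideal.mul_mem_right _ _ (Ideal.mul_mem_right _ _ (Ideal.mul_mem_left _ _ hh)))
  have hPd : (d : 𝓞 L) ∉ P.asIdeal := fun hh => hPS' (Ideal.mul_mem_right _ _ (Ideal.mul_mem_left _ _ hh))
  have hPa : algebraMap (𝓞 K) (𝓞 L) a ∉ P.asIdeal := fun hh => hPS' (Ideal.mul_mem_left _ _ hh)
  -- integral square roots
  have hinteg : IsIntegral ℤ δ := by
    apply IsIntegral.of_pow (n := 2) (by norm_num)
    rw [hδ]; simpa using isIntegral_algebraMap (R := ℤ) (A := M) (x := (q : ℤ))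
  obtain ⟨δ', hδ'⟩ : ∃ δ' : 𝓞 M, (δ' : M) = δ := ⟨⟨δ, hinteg⟩, rfl⟩
  have hδ2 : δ' ^ 2 = algebraMap (𝓞 L) (𝓞 M) (q : 𝓞 L) := by
    apply RingOfIntegers.coe_injective
    have h1 : algebraMap (𝓞 M) M δ' = δ := hδ'
    rw [map_pow, h1, hδ]; simp
  have hintegη : IsIntegral ℤ η := by
    apply IsIntegral.of_pow (n := 2) (by norm_num)
    rw [hη]; simpa using isIntegral_algebraMap (R := ℤ) (A := L) (x := (d : ℤ))
  obtain ⟨η', hη'⟩ : ∃ η' : 𝓞 L, (η' : L) = η := ⟨⟨η, hintegη⟩, rfl⟩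
  have hη2 : η' ^ 2 = algebraMap (𝓞 K) (𝓞 L) (d : 𝓞 K) := by
    apply RingOfIntegers.coe_injective
    have h1 : algebraMap (𝓞 L) L η' = η := hη'
    rw [map_pow, h1, hη]; simp
  have hcq : chq q (absNorm P.asIdeal) = -1 := by
    rcases chq_pm q (absNorm P.asIdeal) (by rwa [prime_dvd_norm q Fact.out]) with h | h
    · exfalso
      obtain ⟨t, ht, hat⟩ := split_of_chq q hq8 P hP2 h
      obtain ⟨-, h5⟩ := split_case (E := M) (q : 𝓞 L) (by simpa using hqL) δ' hδ2 P hP2 t ht hat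
      obtain ⟨Q, rfl⟩ := exists_over M P
      apply hPn
      refine ⟨Q.asIdeal, ?_⟩
      rw [relNorm_hp, inert_eq, h5, pow_one]
    · exact h
  have hodd : Odd (P.asIdeal.inertiaDeg (𝓞 K)) := by
    by_contra hne
    rw [Nat.not_odd_iff_even] at hne
    rw [absNorm_hp (F := K), map_pow] at hcq
    have := hne.pow_nonneg (chq q (absNorm (und (F := K) P).asIdeal))
    rw [hcq] at this; norm_num at this
  have hcqp : chq q (absNorm (und (F := K) P).asIdeal) = -1 := by
    rw [absNorm_hp (F := K), map_pow] at hcq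
    rcases chq_cases q (absNorm (und (F := K) P).asIdeal) with h | h | h
    · rw [h, zero_pow hodd.pos.ne'] at hcq; norm_num at hcq
    · rw [h, one_pow] at hcq; norm_num at hcq
    · exact h
  have hPd' : (d : 𝓞 K) ∉ (und (F := K) P).asIdeal := by
    rw [mem_und]; simpa using hPd
  have hcd : chq d (absNorm (und (F := K) P).asIdeal) = 1 := by
    rcases chq_pm d (absNorm (und (F := K) P).asIdeal) (by rwa [prime_dvd_norm d Fact.out]) with h | h
    · exact h
    · exfalso
      obtain ⟨-, h5⟩ := inert_case (E := L) (d : 𝓞 K) η' hη2 (und P) (inert_of_chq d hd8 _ h)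
      rw [inert_eq, h5] at hodd
      exact absurd hodd (by decide)
  have hb1 := hb (und P) (by
    rintro rfl
    exact hPa ((mem_und P a).1 haw)) hcqp hcd
  have := sg_map P (span {b}) (by simpa using hb0) hb1
  rwa [Ideal.map_span, Set.image_singleton] at this

end lemA

end P13
end NSq
end WrapPart13

section WrapPart14
open NumberField NumberField.InfinitePlace NumberField.Units Module nonZeroDivisors Ideal Filter Topology
open IsDedekindDomain UniqueFactorizationMonoid
universe u
namespace NSq
section P14
open scoped Classical Pointwise
set_option linter.unusedSectionVars false

variable {K : Type u} [Field K] [NumberField K]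

lemma not_bdd_log' : ¬ Bdd (fun s => Real.log (s - 1)) := not_bdd_log

lemma unram_of_large (K : Type u) [Field K] [NumberField K] : ∃ N : ℕ, ∀ q : ℕ, q.Prime → N < q →
    ∀ P : HeightOneSpectrum (𝓞 K), (q : 𝓞 K) ∈ P.asIdeal → (q : 𝓞 K) ∉ P.asIdeal * P.asIdeal := by
  refine ⟨absNorm (differentIdeal ℤ (𝓞 K)), fun q hq hN P hP h2 => ?_⟩
  have hne : absNorm (differentIdeal ℤ (𝓞 K)) ≠ 0 := by
    rw [Ne, absNorm_eq_zero_iff]; exact differentIdeal_ne_bot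
  have hqp : Prime (q : ℤ) := Nat.prime_iff_prime_int.1 hq
  have hmax : (span {(q : ℤ)}).IsMaximal :=
    PrincipalIdealRing.isMaximal_of_irreducible hqp.irreducible
  have hd : P.asIdeal ^ 2 ∣ (span {(q : ℤ)}).map (algebraMap ℤ (𝓞 K)) := by
    rw [Ideal.map_span, Set.image_singleton, Ideal.dvd_span_singleton, sq]
    simpa using h2
  have h3 := pow_sub_one_dvd_differentIdeal ℤ P.asIdeal 2 (by
    rw [Ne, span_singleton_eq_bot]; exact hqp.ne_zero) hd
  rw [show 2 - 1 = 1 from rfl, pow_one] at h3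
  have h4 := absNorm_dvd_of_dvd h3
  have h5 := ((prime_dvd_norm q hq P).2 hP).trans h4
  exact absurd (Nat.le_of_dvd (Nat.pos_of_ne_zero hne) h5) (by omega)

lemma exists_prime_mem (q : ℕ) (hq : q.Prime) : ∃ P : HeightOneSpectrum (𝓞 K), (q : 𝓞 K) ∈ P.asIdeal := by
  have hnu : ¬ IsUnit (q : 𝓞 K) := by
    intro h
    have := (h.map (Algebra.norm ℤ (S := 𝓞 K)))
    rw [show ((q : 𝓞 K)) = algebraMap ℤ (𝓞 K) (q : ℤ) by simp, Algebra.norm_algebraMap, isUnit_pow_iff, Int.isUnit_iff_natAbs_eq] at this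
    · exact hq.one_lt.ne' (by simpa using this)
    · exact Module.finrank_pos.ne'
  obtain ⟨M, hM, hqM⟩ := exists_max_ideal_of_mem_nonunits (a := (q : 𝓞 K)) hnu
  exact ⟨⟨M, hM.isPrime, fun h => by
    rw [h] at hqM
    exact hq.ne_zero (by exact_mod_cast (Ideal.mem_bot.1 hqM))⟩, hqM⟩

/-- the square root of an integer is an integer -/
lemma sqrt_int (x : 𝓞 K) (s : K) (h : (x : K) = s ^ 2) : ∃ t : 𝓞 K, (t : K) = s ∧ x = t ^ 2 := by
  have hinteg : IsIntegral ℤ s := by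
    apply IsIntegral.of_pow (n := 2) (by norm_num)
    rw [← h]; exact x.isIntegral_coe
  obtain ⟨t, ht⟩ : ∃ t : 𝓞 K, (t : K) = s := ⟨⟨s, hinteg⟩, rfl⟩
  refine ⟨t, ht, ?_⟩
  apply RingOfIntegers.coe_injective
  rw [map_pow]
  have ht' : algebraMap (𝓞 K) K t = s := ht
  rw [ht']; exact h

structure Cst (q d : ℕ) [Fact q.Prime] [Fact d.Prime] (w : HeightOneSpectrum (𝓞 K)) : Prop where
  hq8 : q % 8 = 1
  hd8 : d % 8 = 1
  hunr : ∀ P : HeightOneSpectrum (𝓞 K), (q : 𝓞 K) ∈ P.asIdeal → (q : 𝓞 K) ∉ P.asIdeal * P.asIdeal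
  hk : ∃ k, d = 1 + q * k
  hq : ¬ ∃ s : K, (q : K) = s ^ 2
  hd : ¬ ∃ s : K, (d : K) = s ^ 2
  hqd : ¬ ∃ s : K, (q * d : K) = s ^ 2
  hw : chq q (absNorm w.asIdeal) = -1
  hdw : (d : 𝓞 K) - 1 ∈ w.asIdeal

lemma nonsq_of_unram (q : ℕ) (hq : q.Prime)
    (h : ∀ P : HeightOneSpectrum (𝓞 K), (q : 𝓞 K) ∈ P.asIdeal → (q : 𝓞 K) ∉ P.asIdeal * P.asIdeal) (k : ℕ) :
    ¬ ∃ s : K, (q * ((1 + q * k : ℕ) : K)) = s ^ 2 := by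
  rintro ⟨s, hs⟩
  obtain ⟨t, -, ht⟩ := sqrt_int ((q : 𝓞 K) * ((1 + q * k : ℕ) : 𝓞 K)) s (by rw [← hs]; simp)
  obtain ⟨P, hP⟩ := exists_prime_mem (K := K) q hq
  apply h P hP
  have hPpr := P.isPrime
  have htP : t ∈ P.asIdeal := by
    apply hPpr.mem_of_pow_mem 2
    rw [← ht]; exact Ideal.mul_mem_right _ _ hP
  have h1 : (q : 𝓞 K) = t * t - (q : 𝓞 K) * q * k := by
    rw [← sq, ← ht]; push_cast; ring
  rw [h1]
  exact sub_mem (Ideal.mul_mem_mul htP htP) (Ideal.mul_mem_right _ _ (Ideal.mul_mem_mul hP hP))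

lemma exists_w (q : ℕ) [Fact q.Prime] (hq8 : q % 8 = 1) (hq : ¬ ∃ s : K, (q : K) = s ^ 2) :
    ∃ w : HeightOneSpectrum (𝓞 K), chq q (absNorm w.asIdeal) = -1 := by
  by_contra hno
  push Not at hno
  have h1 : Bdd (SP (fun _ : HeightOneSpectrum (𝓞 K) => 1)) := by
    apply SP_rch (q : 𝓞 K) (by simpa using hq) _ (by simp)
    intro P hP
    have h2 : (2 : 𝓞 K) ∉ P.asIdeal := fun h => hP (Ideal.mul_mem_right _ _ h)
    have hq' : (q : 𝓞 K) ∉ P.asIdeal := fun h => hP (Ideal.mul_mem_left _ _ h)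
    rw [rch_prime q hq8 P h2 hq']
    rcases chq_pm q (absNorm P.asIdeal) (by rwa [prime_dvd_norm q Fact.out]) with h | h
    · exact h.symm
    · exact absurd h (hno P)
  have h2 := (SP_one K).sub h1
  apply not_bdd_log'
  refine h2.congr (Filter.Eventually.of_forall fun s => ?_)
  ring

theorem exists_cst (K : Type u) [Field K] [NumberField K] :
    ∃ (q d : ℕ) (_ : Fact q.Prime) (_ : Fact d.Prime) (w : HeightOneSpectrum (𝓞 K)), Cst q d w := by
  obtain ⟨N, hN⟩ := unram_of_large K
  obtain ⟨q, hqp, hqN, hq1⟩ := Nat.exists_prime_gt_modEq_one (k := 8) N (by norm_num)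
  have fq : Fact q.Prime := ⟨hqp⟩
  have hq8 : q % 8 = 1 := hq1
  have hunr := hN q hqp hqN
  have hq : ¬ ∃ s : K, (q : K) = s ^ 2 := by
    have := nonsq_of_unram q hqp hunr 0
    simpa using this
  obtain ⟨w, hw⟩ := exists_w q hq8 hq
  have hw0 : absNorm w.asIdeal ≠ 0 := by
    rw [Ne, absNorm_eq_zero_iff]; exact w.ne_bot
  obtain ⟨d, hdp, hdN, hd1⟩ := Nat.exists_prime_gt_modEq_one (k := 8 * q * absNorm w.asIdeal) N
    (by simp [hqp.ne_zero, hw0])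
  have hdv : 8 * q * absNorm w.asIdeal ∣ d - 1 := (Nat.modEq_iff_dvd' hdp.one_lt.le).1 hd1.symm
  have fd : Fact d.Prime := ⟨hdp⟩
  obtain ⟨j, hj⟩ := hdv
  have hdj : d = 1 + 8 * q * absNorm w.asIdeal * j := by have := hdp.one_lt; omega
  have hdk : d = 1 + q * (8 * absNorm w.asIdeal * j) := by rw [hdj]; ring
  refine ⟨q, d, fq, fd, w, hq8, ?_, hunr, ⟨_, hdk⟩, hq, ?_, ?_, hw, ?_⟩
  · rw [hdj, show 1 + 8 * q * absNorm w.asIdeal * j = 1 + 8 * (q * absNorm w.asIdeal * j) by ring]; omega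
  · have := nonsq_of_unram d hdp (hN d hdp hdN) 0
    simpa using this
  · have := nonsq_of_unram q hqp hunr (8 * absNorm w.asIdeal * j)
    rwa [← hdk] at this
  · have : (d : 𝓞 K) - 1 = (absNorm w.asIdeal : 𝓞 K) * (8 * q * j) := by
      rw [hdj]; push_cast; ring
    rw [this]
    exact Ideal.mul_mem_right _ _ (absNorm_mem _)

end P14
end NSq
end WrapPart14

section WrapPart15
open NumberField NumberField.InfinitePlace NumberField.Units Module nonZeroDivisors Ideal Filter Topology
open IsDedekindDomain UniqueFactorizationMonoid
universe u
namespace NSq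
section P15
open scoped Classical Pointwise
set_option linter.unusedSectionVars false

lemma Hdec {k : Type*} [Field k] (q d u0 u1 v0 v1 h : k) (hq : q ≠ 0) (h0 : u0 * u1 = q * v0 * v1)
    (hh : h = u0 ^ 2 + d * u1 ^ 2 - q * (v0 ^ 2 + d * v1 ^ 2)) :
    ∃ A B C D e : k, e ≠ 0 ∧ h * e ^ 2 = (A ^ 2 - q * B ^ 2) * (C ^ 2 - q * d * D ^ 2) := by
  by_cases hu : u0 = 0
  · subst hu
    have h1 : v0 = 0 ∨ v1 = 0 := by
      have : q * v0 * v1 = 0 := by rw [← h0]; ring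
      simpa [hq] using this
    rcases h1 with rfl | rfl
    · refine ⟨v1, u1 / q, 0, 1, 1, one_ne_zero, ?_⟩
      rw [hh]; field_simp; ring
    · refine ⟨0, 1, v0, u1 / q, 1, one_ne_zero, ?_⟩
      rw [hh]; field_simp; ring
  · refine ⟨u0, v0, u0, v1, u0, hu, ?_⟩
    rw [hh]
    linear_combination (d * (u0 * u1 + q * v0 * v1)) * h0

variable {K : Type u} [Field K] [NumberField K]

lemma clear1 (y : K) : ∃ (c y' : 𝓞 K), c ≠ 0 ∧ y * algebraMap (𝓞 K) K c = algebraMap (𝓞 K) K y' := by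
  obtain ⟨n, c, hc, rfl⟩ := IsFractionRing.div_surjective (A := 𝓞 K) y
  have hc0 := nonZeroDivisors.ne_zero hc
  refine ⟨c, n, hc0, ?_⟩
  exact div_mul_cancel₀ _ (by simpa using hc0)

lemma clear2 (y z : K) : ∃ (c y' z' : 𝓞 K), c ≠ 0 ∧ y * algebraMap (𝓞 K) K c = algebraMap (𝓞 K) K y' ∧ z * algebraMap (𝓞 K) K c = algebraMap (𝓞 K) K z' := by
  obtain ⟨c1, y1, h1, h2⟩ := clear1 y
  obtain ⟨c2, y2, h3, h4⟩ := clear1 z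
  refine ⟨c1 * c2, y1 * c2, y2 * c1, mul_ne_zero h1 h3, ?_, ?_⟩
  · rw [map_mul, map_mul, ← h2]; ring
  · rw [map_mul, map_mul, ← h4]; ring

lemma inert_qd {q d : ℕ} [Fact q.Prime] [Fact d.Prime] (hq8 : q % 8 = 1) (hd8 : d % 8 = 1)
    (P : HeightOneSpectrum (𝓞 K)) (h1 : chq q (absNorm P.asIdeal) = -1) (h2 : chq d (absNorm P.asIdeal) = 1) :
    ∀ t : 𝓞 K, (q * d : 𝓞 K) - t ^ 2 ∉ P.asIdeal := by
  have hP2 : (2 : 𝓞 K) ∉ P.asIdeal := fun h => by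
    rw [chq_over_two q hq8 P h] at h1; norm_num at h1
  have hPq : (q : 𝓞 K) ∉ P.asIdeal := fun h => by
    rw [← prime_dvd_norm q Fact.out, ← chq_zero_iff, h1] at h; norm_num at h
  have hPd : (d : 𝓞 K) ∉ P.asIdeal := fun h => by
    rw [← prime_dvd_norm d Fact.out, ← chq_zero_iff, h2] at h; norm_num at h
  have e1 := rch_prime q hq8 P hP2 hPq
  have e2 := rch_prime d hd8 P hP2 hPd
  rw [h1] at e1; rw [h2] at e2
  have e1' : rch P (q : 𝓞 K) = -1 := by exact_mod_cast e1
  have e2' : rch P (d : 𝓞 K) = 1 := by exact_mod_cast e2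
  have hpr := P.isPrime
  rcases rch_spec P (q * d : 𝓞 K) (fun h => (hpr.mem_or_mem h).elim hPq hPd) with ⟨h, -⟩ | ⟨-, h⟩
  · rw [rch_mul, e1', e2'] at h; norm_num at h
  · exact h

section core
variable {q d : ℕ} [Fact q.Prime] [Fact d.Prime] {w : HeightOneSpectrum (𝓞 K)} (C : Cst q d w)
include C

lemma Cst.inert_w : ∀ t : 𝓞 K, (q : 𝓞 K) - t ^ 2 ∉ w.asIdeal := inert_of_chq q C.hq8 w C.hw

lemma Cst.inert_wqd : ∀ t : 𝓞 K, (q * d : 𝓞 K) - t ^ 2 ∉ w.asIdeal := by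
  intro t ht
  apply C.inert_w t
  have : (q : 𝓞 K) - t ^ 2 = (q * d - t ^ 2) - q * (d - 1) := by ring
  rw [this]
  exact sub_mem ht (Ideal.mul_mem_left _ _ C.hdw)

lemma Cst.chq_d (P : HeightOneSpectrum (𝓞 K)) (hP : (d : 𝓞 K) ∈ P.asIdeal) : chq q (absNorm P.asIdeal) = 1 := by
  obtain ⟨n, hn⟩ := absNorm_dvd_pow d P hP
  obtain ⟨m, -, hm⟩ := (Nat.dvd_prime_pow (Fact.out : d.Prime)).1 hn
  obtain ⟨k, hk⟩ := C.hk
  have : chq q d = 1 := by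
    rw [chq_def, hk]; simp
  rw [hm, map_pow, this, one_pow]

/-- integral form of the identity h = N_q N_qd -/
lemma Cst.integral_eq (a : ℕ) (b : 𝓞 K) (y z : K) (A B C' D e : K) (he : e ≠ 0)
    (hb : b ≠ 0) (hy : y ^ 2 - a * z ^ 2 ≠ 0)
    (h : (algebraMap (𝓞 K) K b) * (y ^ 2 - a * z ^ 2) * e ^ 2 = (A ^ 2 - q * B ^ 2) * (C' ^ 2 - q * d * D ^ 2)) :
    ∃ Y Z A' B' C'' D' E G : 𝓞 K, E ≠ 0 ∧ G ≠ 0 ∧ Y ^ 2 - (a : 𝓞 K) * Z ^ 2 ≠ 0 ∧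
      A' ^ 2 - (q : 𝓞 K) * B' ^ 2 ≠ 0 ∧ C'' ^ 2 - (q * d : 𝓞 K) * D' ^ 2 ≠ 0 ∧
      b * (Y ^ 2 - (a : 𝓞 K) * Z ^ 2) * E ^ 2 =
        (A' ^ 2 - (q : 𝓞 K) * B' ^ 2) * (C'' ^ 2 - (q * d : 𝓞 K) * D' ^ 2) * G ^ 2 := by
  obtain ⟨c1, Y, Z, hc1, hY, hZ⟩ := clear2 y z
  obtain ⟨c2, A', B', hc2, hA, hB⟩ := clear2 A B
  obtain ⟨c3, C'', D', hc3, hC, hD⟩ := clear2 C' D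
  obtain ⟨c4, e', hc4, he'⟩ := clear1 e
  have hc1' : (algebraMap (𝓞 K) K c1) ≠ 0 := by simpa using hc1
  have hc4' : (algebraMap (𝓞 K) K c4) ≠ 0 := by simpa using hc4
  have he0 : e' ≠ 0 := by
    rintro rfl
    rw [map_zero] at he'
    exact mul_ne_zero he hc4' he'
  have key : b * (Y ^ 2 - (a : 𝓞 K) * Z ^ 2) * (e' * c2 * c3) ^ 2 =
        (A' ^ 2 - (q : 𝓞 K) * B' ^ 2) * (C'' ^ 2 - (q * d : 𝓞 K) * D' ^ 2) * (c1 * c4) ^ 2 := by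
    apply RingOfIntegers.coe_injective
    simp only [map_mul, map_sub, map_pow, map_natCast]
    rw [← hY, ← hZ, ← hA, ← hB, ← hC, ← hD, ← he']
    linear_combination ((algebraMap (𝓞 K) K c1) * c2 * c3 * c4) ^ 2 * h
  have hn0 : Y ^ 2 - (a : 𝓞 K) * Z ^ 2 ≠ 0 := by
    intro h0
    have h1 := congrArg (algebraMap (𝓞 K) K) h0
    simp only [map_mul, map_sub, map_pow, map_natCast, map_zero] at h1
    rw [← hY, ← hZ] at h1
    have : (y ^ 2 - a * z ^ 2) * (algebraMap (𝓞 K) K c1) ^ 2 = 0 := by rw [← h1]; ring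
    exact mul_ne_zero hy (pow_ne_zero 2 hc1') this
  have hne : b * (Y ^ 2 - (a : 𝓞 K) * Z ^ 2) * (e' * c2 * c3) ^ 2 ≠ 0 :=
    mul_ne_zero (mul_ne_zero hb hn0) (pow_ne_zero _ (mul_ne_zero (mul_ne_zero he0 hc2) hc3))
  refine ⟨Y, Z, A', B', C'', D', e' * c2 * c3, c1 * c4, mul_ne_zero (mul_ne_zero he0 hc2) hc3,
    mul_ne_zero hc1 hc4, hn0, ?_, ?_, key⟩
  · intro h0; rw [key, h0] at hne; simp at hne
  · intro h0; rw [key, h0] at hne; simp at hne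

lemma Cst.sg_eq (S : Set (HeightOneSpectrum (𝓞 K))) (b n m l E G : 𝓞 K) (hb : b ≠ 0) (hn : n ≠ 0)
    (hm : m ≠ 0) (hl : l ≠ 0) (hE : E ≠ 0) (hG : G ≠ 0) (h : b * n * E ^ 2 = m * l * G ^ 2) :
    sg S (span {b}) * sg S (span {n}) = sg S (span {m}) * sg S (span {l}) := by
  have := congrArg (fun x => sg S (span {x})) h
  rwa [sgs_mul S (mul_ne_zero hb hn) (pow_ne_zero _ hE), sgs_mul S (mul_ne_zero hm hl) (pow_ne_zero _ hG),
    sgs_mul S hb hn, sgs_mul S hm hl, sgs_sq S hE, sgs_sq S hG, mul_one, mul_one] at this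

/-- Case II -/
lemma Cst.caseII (b : 𝓞 K) (hb : b ≠ 0) (y z A B C' D e : K) (he : e ≠ 0) (hy : y ^ 2 - (q : K) * z ^ 2 ≠ 0)
    (h : (algebraMap (𝓞 K) K b) * (y ^ 2 - q * z ^ 2) * e ^ 2 = (A ^ 2 - q * B ^ 2) * (C' ^ 2 - q * d * D ^ 2)) :
    sg {w} (span {b}) = 1 := by
  obtain ⟨Y, Z, A', B', C'', D', E, G, hE, hG, h1, h2, h3, h4⟩ := C.integral_eq q b y z A B C' D e he hb hy h
  have := C.sg_eq {w} _ _ _ _ _ _ hb h1 h2 h3 hE hG h4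
  rwa [parity w _ C.inert_w _ _ h1, parity w _ C.inert_w _ _ h2, parity w _ C.inert_wqd _ _ h3, mul_one, mul_one] at this

/-- Case I -/
lemma Cst.caseI (b : 𝓞 K) (hb : b ≠ 0)
    (hE' : ∀ p : HeightOneSpectrum (𝓞 K), p ≠ w → chq q (absNorm p.asIdeal) = -1 → chq d (absNorm p.asIdeal) = 1 →
        sg {p} (span {b}) = 1)
    (y z A B C' D e : K) (he : e ≠ 0) (hy : y ^ 2 - (d : K) * z ^ 2 ≠ 0)
    (h : (algebraMap (𝓞 K) K b) * (y ^ 2 - d * z ^ 2) * e ^ 2 = (A ^ 2 - q * B ^ 2) * (C' ^ 2 - q * d * D ^ 2)) :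
    sg ({p : HeightOneSpectrum (𝓞 K) | chq q (absNorm p.asIdeal) = -1} \ {w}) (span {b}) = 1 := by
  obtain ⟨Y, Z, A', B', C'', D', E, G, hE, hG, h1, h2, h3, h4⟩ := C.integral_eq d b y z A B C' D e he hb hy h
  obtain ⟨k, hk⟩ := C.hk
  have hS := C.sg_eq ({p : HeightOneSpectrum (𝓞 K) | chq q (absNorm p.asIdeal) = -1} \ {w}) _ _ _ _ _ _ hb h1 h2 h3 hE hG h4
  have hm : sg ({p : HeightOneSpectrum (𝓞 K) | chq q (absNorm p.asIdeal) = -1} \ {w}) (span {A' ^ 2 - (q : 𝓞 K) * B' ^ 2}) = 1 := by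
    apply sg_of_single
    rintro p ⟨hp, -⟩
    exact parity p _ (inert_of_chq q C.hq8 p hp) _ _ h2
  have hl : sg ({p : HeightOneSpectrum (𝓞 K) | chq q (absNorm p.asIdeal) = -1} \ {w}) (span {C'' ^ 2 - (q * d : 𝓞 K) * D' ^ 2}) = 1 := by
    have hX := sgX_nm q C.hq8 C.hunr d k hk C'' D' h3 (by
      intro h0
      by_cases hD : D' = 0
      · rw [hD] at h0 h3
        apply h3; linear_combination h0
      · apply C.hq
        refine ⟨(algebraMap (𝓞 K) K C'') / D', ?_⟩
        have hD' : (algebraMap (𝓞 K) K D') ≠ 0 := by simpa using hD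
        have h1 := congrArg (algebraMap (𝓞 K) K) h0
        simp only [map_mul, map_sub, map_pow, map_natCast, map_zero] at h1
        field_simp
        linear_combination -h1)
    rw [sg_split _ w (by exact C.hw), parity w _ C.inert_wqd _ _ h3, mul_one] at hX
    exact hX
  have hn : sg ({p : HeightOneSpectrum (𝓞 K) | chq q (absNorm p.asIdeal) = -1} \ {w}) (span {Y ^ 2 - (d : 𝓞 K) * Z ^ 2}) = 1 := by
    apply sg_of_single
    rintro p ⟨hp, hpw⟩
    have hp : chq q (absNorm p.asIdeal) = -1 := hp
    have hpw : p ≠ w := hpw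
    have hdp : ¬ d ∣ absNorm p.asIdeal := by
      rw [prime_dvd_norm d Fact.out]
      intro h
      rw [C.chq_d p h] at hp; norm_num at hp
    rcases chq_pm d _ hdp with h5 | h5
    · have hp1 := C.sg_eq {p} _ _ _ _ _ _ hb h1 h2 h3 hE hG h4
      rwa [hE' p hpw hp h5, parity p _ (inert_of_chq q C.hq8 p hp) _ _ h2,
        parity p _ (inert_qd C.hq8 C.hd8 p hp h5) _ _ h3, one_mul, one_mul] at hp1
    · exact parity p _ (inert_of_chq d C.hd8 p h5) _ _ h1
  rwa [hm, hl, hn, mul_one, mul_one] at hS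

end core

end P15
end NSq
end WrapPart15

section WrapPart16
open NumberField NumberField.InfinitePlace NumberField.Units Module nonZeroDivisors Ideal Filter Topology
open IsDedekindDomain UniqueFactorizationMonoid
universe u
namespace NSq
section P16
open scoped Classical Pointwise
set_option linter.unusedSectionVars false

variable {K : Type u} [Field K] [NumberField K]

lemma hos_prime (w : HeightOneSpectrum (𝓞 K)) : Prime w.asIdeal :=
  Ideal.prime_of_isPrime w.ne_bot w.isPrime

lemma exists_notMem_pow (w : HeightOneSpectrum (𝓞 K)) (t : 𝓞 K) (ht : t ≠ 0) : ∃ n, t ∉ w.asIdeal ^ (2 * (n + 1)) := by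
  by_contra hno
  push Not at hno
  have h1 : t ∈ ⨅ i : ℕ, w.asIdeal ^ i := by
    rw [Ideal.mem_iInf]
    intro i
    exact Ideal.pow_le_pow_right (by omega) (hno i)
  rw [Ideal.iInf_pow_eq_bot_of_isDomain _ w.isPrime.ne_top] at h1
  exact ht h1

lemma normal_form (w : HeightOneSpectrum (𝓞 K)) (x : K) (hx : x ≠ 0) :
    ∃ (t : 𝓞 K) (s : K), s ≠ 0 ∧ x = algebraMap (𝓞 K) K t * s ^ 2 ∧
      (t ∉ w.asIdeal ∨ (t ∈ w.asIdeal ∧ t ∉ w.asIdeal * w.asIdeal)) := by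
  obtain ⟨c, n, hc, hn⟩ := clear1 x
  have hc' : algebraMap (𝓞 K) K c ≠ 0 := by simpa using hc
  have hn0 : n ≠ 0 := by
    rintro rfl
    rw [map_zero] at hn
    exact mul_ne_zero hx hc' hn
  have ht0 : n * c ≠ 0 := mul_ne_zero hn0 hc
  have hex := exists_notMem_pow w (n * c) ht0
  set m := Nat.find hex with hm
  have h1 : n * c ∉ w.asIdeal ^ (2 * (m + 1)) := Nat.find_spec hex
  have h2 : n * c ∈ w.asIdeal ^ (2 * m) := by
    rcases Nat.eq_zero_or_pos m with h | h
    · rw [h]; simp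
    · have := Nat.find_min hex (m := m - 1) (by omega)
      push Not at this
      rwa [show m - 1 + 1 = m by omega] at this
  have hpr := hos_prime w
  have hlt : ¬ (w.asIdeal ≤ w.asIdeal ^ 2) := by
    intro h
    rw [← Ideal.dvd_iff_le, sq] at h
    have h3 : w.asIdeal * w.asIdeal ∣ w.asIdeal * 1 := by rwa [mul_one]
    exact hpr.not_isUnit (isUnit_of_dvd_one ((mul_dvd_mul_iff_left hpr.ne_zero).1 h3))
  obtain ⟨ϖ, hϖ1, hϖ2⟩ := SetLike.not_le_iff_exists.1 hlt
  have hϖ0 : ϖ ≠ 0 := by rintro rfl; exact hϖ2 (zero_mem _)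
  obtain ⟨C, hC⟩ := (Ideal.dvd_span_singleton).2 hϖ1
  have hCw : ¬ C ≤ w.asIdeal := by
    intro h
    apply hϖ2
    rw [← Ideal.dvd_span_singleton, hC, sq]
    exact mul_dvd_mul_left _ (Ideal.dvd_iff_le.2 h)
  obtain ⟨g, hg1, hg2⟩ := SetLike.not_le_iff_exists.1 hCw
  have hg0 : g ≠ 0 := by rintro rfl; exact hg2 (zero_mem _)
  have hdv : ϖ ^ (2 * m) ∣ (n * c) * g ^ (2 * m) := by
    rw [← Ideal.span_singleton_le_span_singleton, ← Ideal.dvd_iff_le, ← Ideal.span_singleton_pow, hC, mul_pow,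
      ← Ideal.span_singleton_mul_span_singleton, ← Ideal.span_singleton_pow]
    exact mul_dvd_mul (Ideal.dvd_span_singleton.2 h2) (pow_dvd_pow_of_dvd (Ideal.dvd_span_singleton.2 hg1) _)
  obtain ⟨t, ht⟩ := hdv
  have hϖ' : algebraMap (𝓞 K) K ϖ ≠ 0 := by simpa using hϖ0
  have hg' : algebraMap (𝓞 K) K g ≠ 0 := by simpa using hg0
  refine ⟨t, (algebraMap (𝓞 K) K ϖ) ^ m / ((algebraMap (𝓞 K) K g) ^ m * algebraMap (𝓞 K) K c),
    div_ne_zero (pow_ne_zero _ hϖ') (mul_ne_zero (pow_ne_zero _ hg') hc'), ?_, ?_⟩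
  · have h3 := congrArg (algebraMap (𝓞 K) K) ht
    simp only [map_mul, map_pow] at h3
    rw [← hn] at h3
    field_simp
    rw [← pow_mul, ← pow_mul, mul_comm m 2]
    linear_combination h3
  · by_contra hcon
    push Not at hcon
    obtain ⟨hc1, hc2⟩ := hcon
    have h3 := hc2 hc1
    apply h1
    rw [← Ideal.dvd_span_singleton]
    have hng : ¬ w.asIdeal ∣ span {g ^ (2 * m)} := by
      rw [Ideal.dvd_span_singleton]
      exact fun h => hg2 (w.isPrime.mem_of_pow_mem _ h)
    apply hpr.pow_dvd_of_dvd_mul_right _ hng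
    rw [Ideal.span_singleton_mul_span_singleton, ht, ← Ideal.span_singleton_mul_span_singleton,
      show 2 * (m + 1) = 2 * m + 2 by ring, pow_add, ← Ideal.span_singleton_pow]
    refine mul_dvd_mul (pow_dvd_pow_of_dvd (Ideal.dvd_span_singleton.2 hϖ1) _) ?_
    rw [sq]; exact Ideal.dvd_span_singleton.2 h3

section claimW
variable {q d : ℕ} [Fact q.Prime] [Fact d.Prime] {w : HeightOneSpectrum (𝓞 K)} (C : Cst q d w)
include C

lemma Cst.two_notMem : (2 : 𝓞 K) ∉ w.asIdeal := fun h => by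
  have := C.hw
  rw [chq_over_two q C.hq8 w h] at this; norm_num at this

lemma Cst.q_notMem : (q : 𝓞 K) ∉ w.asIdeal := fun h => by
  have := C.hw
  rw [← prime_dvd_norm q Fact.out, ← chq_zero_iff, C.hw] at h; norm_num at h

lemma Cst.choose_a (t : 𝓞 K) (ht : t ∉ w.asIdeal ∨ (t ∈ w.asIdeal ∧ t ∉ w.asIdeal * w.asIdeal)) :
    ((∃ t0 ∉ w.asIdeal, (d : 𝓞 K) * t - t0 ^ 2 ∈ w.asIdeal) ∨
      (((d : 𝓞 K) * t ∈ w.asIdeal ∧ (d : 𝓞 K) * t ∉ w.asIdeal * w.asIdeal))) ∨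
    (∃ t0 ∉ w.asIdeal, (q : 𝓞 K) * t - t0 ^ 2 ∈ w.asIdeal) := by
  rcases ht with ht | ⟨h1, h2⟩
  · rcases rch_spec w t ht with ⟨-, t0, h0, h1⟩ | ⟨h1, -⟩
    · left; left
      refine ⟨t0, h0, ?_⟩
      have : (d : 𝓞 K) * t - t0 ^ 2 = (d - 1) * t + (t - t0 ^ 2) := by ring
      rw [this]
      exact add_mem (Ideal.mul_mem_right _ _ C.hdw) h1
    · right
      have hqr : rch w (q : 𝓞 K) = -1 := by
        have := rch_prime q C.hq8 w C.two_notMem C.q_notMem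
        rw [C.hw] at this; exact_mod_cast this
      rcases rch_spec w (q * t) (fun h => (w.isPrime.mem_or_mem h).elim C.q_notMem ht) with ⟨-, h⟩ | ⟨h, -⟩
      · exact h
      · rw [rch_mul, hqr, h1] at h; norm_num at h
  · left; right
    refine ⟨Ideal.mul_mem_left _ _ h1, fun h => h2 ?_⟩
    have : t = (d : 𝓞 K) * t - (d - 1) * t := by ring
    rw [this]
    exact sub_mem h (Ideal.mul_mem_mul C.hdw h1)

variable {F : Type u} [Field F] [NumberField F] [Algebra K F] [Algebra.IsQuadraticExtension K F]

lemma Cst.exists_W (e : 𝓞 K) (he : ¬ ∃ s : K, algebraMap (𝓞 K) K e = s ^ 2) (δ : 𝓞 F)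
    (hδ : δ ^ 2 = algebraMap (𝓞 K) (𝓞 F) e)
    (h : (∃ t0 ∉ w.asIdeal, e - t0 ^ 2 ∈ w.asIdeal) ∨ (e ∈ w.asIdeal ∧ e ∉ w.asIdeal * w.asIdeal)) :
    ∃ W : HeightOneSpectrum (𝓞 F), und W = w ∧ Odd (W.asIdeal.inertiaDeg (𝓞 K)) := by
  obtain ⟨W, hW⟩ := exists_over F w
  refine ⟨W, hW, ?_⟩
  rcases h with ⟨t0, h0, h1⟩ | ⟨h1, h2⟩
  · obtain ⟨-, h5⟩ := split_case e he δ hδ w C.two_notMem t0 h0 h1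
    rw [inert_eq, hW, h5]; exact odd_one
  · by_contra hne
    apply h2
    have hf : 2 ≤ W.asIdeal.inertiaDeg (𝓞 K) := by
      have h6 := gef F w
      rw [inert_eq, hW] at hne ⊢
      generalize inertiaDegIn w.asIdeal (𝓞 F) = f at *
      rcases f with _ | _ | f
      · simp at h6
      · exact absurd odd_one hne
      · omega
    have hδW : δ ∈ W.asIdeal := by
      apply W.isPrime.mem_of_pow_mem 2
      rw [hδ, ← mem_und, hW]; exact h1
    have h3 : relNorm (𝓞 K) W.asIdeal ∣ relNorm (𝓞 K) (span {δ}) := map_dvd _ (Ideal.dvd_span_singleton.2 hδW)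
    rw [relNorm_hp, hW, relNorm_singleton] at h3
    have hδ' : (algebraMap (𝓞 F) F δ) ^ 2 = algebraMap K F (algebraMap (𝓞 K) K e) := by
      rw [← map_pow, hδ]; rfl
    have hnorm : Algebra.intNorm (𝓞 K) (𝓞 F) δ = - e := by
      apply RingOfIntegers.coe_injective
      have h7 := quad_norm _ he (algebraMap (𝓞 F) F δ) hδ' 0 1
      rw [map_neg, Algebra.algebraMap_intNorm (A := 𝓞 K) (B := 𝓞 F) (K := K) (L := F)]
      simpa using h7
    rw [hnorm] at h3
    have h4 := (pow_dvd_pow w.asIdeal hf).trans h3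
    rw [sq, Ideal.dvd_span_singleton] at h4
    simpa using neg_mem h4

end claimW

lemma sq_in_quad {F : Type u} [Field F] [NumberField F] [Algebra K F] [Algebra.IsQuadraticExtension K F]
    (e : K) (he : ¬ ∃ s : K, e = s ^ 2) (δ : F) (hδ : δ ^ 2 = algebraMap K F e) (c : K)
    (hc : ¬ ∃ s : K, c = s ^ 2) (hce : ¬ ∃ s : K, c * e = s ^ 2) : ¬ ∃ s : F, algebraMap K F c = s ^ 2 := by
  rintro ⟨s, hs⟩
  obtain ⟨σ, h1, h2, h3⟩ := quad_gal e he δ hδ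
  obtain ⟨y, z, rfl⟩ := quad_rep e he δ hδ s
  have he0 : e ≠ 0 := by rintro rfl; exact he ⟨0, by simp⟩
  have hδ0 : δ ≠ 0 := by
    rintro rfl
    apply he0
    apply (algebraMap K F).injective
    rw [← hδ]; simp
  have hσ : algebraMap K F c = (algebraMap K F y - algebraMap K F z * δ) ^ 2 := by
    have := congrArg σ hs
    simpa [h1, sub_eq_add_neg] using this
  have h4 : (4 : F) * (algebraMap K F y * algebraMap K F z) * δ = 0 := by linear_combination hσ - hs
  have h5 : y * z = 0 := by
    have : algebraMap K F (y * z) = 0 := by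
      rw [map_mul]
      rcases mul_eq_zero.1 h4 with h | h
      · simpa using h
      · exact absurd h hδ0
    simpa using this
  rcases mul_eq_zero.1 h5 with rfl | rfl
  · apply hce
    refine ⟨e * z, ?_⟩
    apply (algebraMap K F).injective
    simp only [map_mul, map_pow]
    rw [hs, map_zero, zero_add, mul_pow, hδ]; ring
  · apply hc
    refine ⟨y, ?_⟩
    apply (algebraMap K F).injective
    rw [hs]; simp

end P16
end NSq
end WrapPart16

section WrapPart17
open NumberField NumberField.InfinitePlace NumberField.Units Module nonZeroDivisors Ideal Filter Topology
open IsDedekindDomain UniqueFactorizationMonoid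
universe u
namespace NSq
section P17
open scoped Classical Pointwise
set_option linter.unusedSectionVars false

variable {K : Type u} [Field K] [NumberField K]

lemma coord_zero {L : Type*} [Field L] [Algebra K L] (d : K) (hd : ¬ ∃ s : K, d = s ^ 2) (η : L)
    (hη : η ^ 2 = algebraMap K L d) (A B : K) (h : algebraMap K L A + algebraMap K L B * η = 0) : A = 0 ∧ B = 0 := by
  have hB : B = 0 := by
    by_contra hB
    apply hd
    refine ⟨A / B, ?_⟩
    have hB' : algebraMap K L B ≠ 0 := by simpa using hB
    apply (algebraMap K L).injective
    rw [← hη, map_pow, map_div₀]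
    have : η = - (algebraMap K L A / algebraMap K L B) := by
      field_simp
      linear_combination h
    rw [this]; ring
  subst hB
  refine ⟨?_, rfl⟩
  simpa using h

lemma expand {L : Type*} [Field L] [Algebra K L] (q d : K) (η : L)
    (hη : η ^ 2 = algebraMap K L d) (u0 u1 v0 v1 : K) :
    (algebraMap K L u0 + algebraMap K L u1 * η) ^ 2 - algebraMap K L q * (algebraMap K L v0 + algebraMap K L v1 * η) ^ 2
    = algebraMap K L (u0 ^ 2 + d * u1 ^ 2 - q * (v0 ^ 2 + d * v1 ^ 2)) + algebraMap K L (2 * (u0 * u1 - q * v0 * v1)) * η := by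
  simp only [map_add, map_sub, map_mul, map_pow, map_ofNat, ← hη]
  ring

section core
variable {q d : ℕ} [Fact q.Prime] [Fact d.Prime] {w : HeightOneSpectrum (𝓞 K)} (C : Cst q d w)
  {L : Type u} [Field L] [NumberField L] [Algebra K L] [Algebra.IsQuadraticExtension K L]
  (η : L) (hη : η ^ 2 = algebraMap K L d)
include C hη

lemma Cst.dec (h : K) (U V : L) (hUV : algebraMap K L h = U ^ 2 - (q : L) * V ^ 2) :
    ∃ A B C D e : K, e ≠ 0 ∧ h * e ^ 2 = (A ^ 2 - q * B ^ 2) * (C ^ 2 - q * d * D ^ 2) := by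
  obtain ⟨u0, u1, rfl⟩ := quad_rep (d : K) C.hd η hη U
  obtain ⟨v0, v1, rfl⟩ := quad_rep (d : K) C.hd η hη V
  have h1 := expand (q : K) (d : K) η hη u0 u1 v0 v1
  rw [map_natCast, ← hUV] at h1
  obtain ⟨h2, h3⟩ := coord_zero (d : K) C.hd η hη (h - (u0 ^ 2 + d * u1 ^ 2 - q * (v0 ^ 2 + d * v1 ^ 2)))
    (-(2 * (u0 * u1 - q * v0 * v1))) (by rw [map_sub, map_neg]; linear_combination h1)
  have hq0 : (q : K) ≠ 0 := by exact_mod_cast (Fact.out : q.Prime).ne_zero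
  apply Hdec (q : K) (d : K) u0 u1 v0 v1 h hq0
  · have : u0 * u1 - q * v0 * v1 = 0 := by
      have h4 : (2 : K) ≠ 0 := two_ne_zero
      simpa [h4] using h3
    linear_combination this
  · linear_combination h2

omit [NumberField L] hη [Algebra.IsQuadraticExtension K L] in
/-- Existence of the element `b` -/
lemma Cst.exists_b (a : ℕ) (t : 𝓞 K)
    (ha : (∃ t0 ∉ w.asIdeal, (a : 𝓞 K) * t - t0 ^ 2 ∈ w.asIdeal) ∨
      ((a : 𝓞 K) * t ∈ w.asIdeal ∧ (a : 𝓞 K) * t ∉ w.asIdeal * w.asIdeal))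
    (h1 : ¬ ∃ s : K, (a : K) * algebraMap (𝓞 K) K t = s ^ 2)
    (h2 : ¬ ∃ s : K, (q : K) * (a * algebraMap (𝓞 K) K t) = s ^ 2)
    (h3 : ¬ ∃ s : K, (d : K) * (a * algebraMap (𝓞 K) K t) = s ^ 2)
    (h4 : ¬ ∃ s : K, (q * d : K) * (a * algebraMap (𝓞 K) K t) = s ^ 2)
    (χ : ℕ →*₀ ℝ) (hχ : ∀ n, |χ n| ≤ 1)
    (hper : ∀ (F : Type u) [Field F] [NumberField F] (γ δ : 𝓞 F), χ (aN (γ + (q : 𝓞 F) * δ)) = χ (aN γ))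
    (hχq : ∀ n, χ n ≠ 0 → ¬ q ∣ n)
    (B : Set (HeightOneSpectrum (𝓞 K)))
    (hB : ∀ p : HeightOneSpectrum (𝓞 K), p ≠ w → (q : 𝓞 K) ∉ p.asIdeal → (if p ∈ B then -1 else 1) * χ (absNorm p.asIdeal) = 1)
    (hBw : (if w ∈ B then -1 else 1) * χ (absNorm w.asIdeal) = -1) :
    ∃ b : 𝓞 K, b ≠ 0 ∧ (∀ p : HeightOneSpectrum (𝓞 K), p ≠ w → chq q (absNorm p.asIdeal) = -1 → chq d (absNorm p.asIdeal) = 1 →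
        sg {p} (span {b}) = 1) ∧ sg B (span {b}) = -1 ∧
        ∃ y z : K, algebraMap (𝓞 K) K b = y ^ 2 - (a * algebraMap (𝓞 K) K t) * z ^ 2 := by
  obtain ⟨F, _, _, _, _, δ, hδ⟩ := exists_quad _ h1
  obtain ⟨δ', hδ', hδ2⟩ := sqrt_int (algebraMap (𝓞 K) (𝓞 F) ((a : 𝓞 K) * t)) δ (by
    rw [hδ]
    change algebraMap K F (algebraMap (𝓞 K) K ((a : 𝓞 K) * t)) = _
    simp)
  have he : ¬ ∃ s : K, algebraMap (𝓞 K) K ((a : 𝓞 K) * t) = s ^ 2 := by simpa using h1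
  obtain ⟨W, hW, hodd⟩ := C.exists_W _ he δ' hδ2.symm ha
  obtain ⟨w0, hw0, hw00⟩ := Submodule.exists_mem_ne_zero_of_ne_bot w.ne_bot
  have hq0 : (q : 𝓞 K) ≠ 0 := by exact_mod_cast (Fact.out : q.Prime).ne_zero
  have g2 := sq_in_quad _ h1 δ hδ (q : K) C.hq h2
  have g3 := sq_in_quad _ h1 δ hδ (d : K) C.hd h3
  have g4 := sq_in_quad _ h1 δ hδ (q * d : K) C.hqd h4
  obtain ⟨γ, hγ0, hγ1, hγ2⟩ := lemZ (K := K) (F := F) q d C.hq8 C.hd8 (by simpa using g2) (by simpa using g3)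
    (by simpa using g4) χ hχ (hper F) hχq B ((q : 𝓞 K) * w0) (mul_ne_zero hq0 hw00) (by
      intro p hp
      apply hB p
      · rintro rfl
        exact hp (Ideal.mul_mem_left _ _ hw0)
      · exact fun h => hp (Ideal.mul_mem_right _ _ h)) W hodd (by rw [hW]; exact hBw)
  rw [hW] at hγ1
  refine ⟨Algebra.intNorm (𝓞 K) (𝓞 F) γ, ?_, hγ1, hγ2, ?_⟩
  · rwa [Ne, Algebra.intNorm_eq_zero]
  · exact intNorm_rep _ h1 δ hδ γ

theorem Cst.complete (t : 𝓞 K) (ht : t ∉ w.asIdeal ∨ (t ∈ w.asIdeal ∧ t ∉ w.asIdeal * w.asIdeal))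
    (h1 : ¬ ∃ s : K, algebraMap (𝓞 K) K t = s ^ 2)
    (h2 : ¬ ∃ s : K, (q : K) * algebraMap (𝓞 K) K t = s ^ 2)
    (h3 : ¬ ∃ s : K, (d : K) * algebraMap (𝓞 K) K t = s ^ 2)
    (h4 : ¬ ∃ s : K, (q * d : K) * algebraMap (𝓞 K) K t = s ^ 2) :
    ∃ a : ℕ, (a = q ∨ a = d) ∧ ∃ b : 𝓞 K, b ≠ 0 ∧
      (∀ p : HeightOneSpectrum (𝓞 K), p ≠ w → chq q (absNorm p.asIdeal) = -1 → chq d (absNorm p.asIdeal) = 1 →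
        sg {p} (span {b}) = 1) ∧
      (∃ y z : K, algebraMap (𝓞 K) K b = y ^ 2 - (a * algebraMap (𝓞 K) K t) * z ^ 2) ∧
      ∀ (y z : K) (U V : L), y ^ 2 - a * z ^ 2 ≠ 0 →
        algebraMap K L (algebraMap (𝓞 K) K b * (y ^ 2 - a * z ^ 2)) ≠ U ^ 2 - (q : L) * V ^ 2 := by
  have hq0 : (q : K) ≠ 0 := by exact_mod_cast (Fact.out : q.Prime).ne_zero
  have hd0 : (d : K) ≠ 0 := by exact_mod_cast (Fact.out : d.Prime).ne_zero
  have hz : ∀ n, chq q n ≠ 0 → ¬ q ∣ n := fun n hn h => hn ((chq_zero_iff q n).2 h)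
  rcases C.choose_a t ht with hc | hc
  · -- case I
    obtain ⟨b, hb0, hb1, hb2, hb3⟩ := C.exists_b d t hc h3 (by rwa [← mul_assoc])
      (by
        rintro ⟨s, hs⟩
        exact h1 ⟨s / d, by field_simp; linear_combination hs⟩)
      (by
        rintro ⟨s, hs⟩
        exact h2 ⟨s / d, by field_simp; linear_combination hs⟩)
      (chq q) (chq_abs q) (fun F _ _ => chq_per q C.hq8) hz
      ({p : HeightOneSpectrum (𝓞 K) | chq q (absNorm p.asIdeal) = -1} \ {w}) (by
        intro p hpw hqp
        have : p ∈ ({p : HeightOneSpectrum (𝓞 K) | chq q (absNorm p.asIdeal) = -1} \ {w}) ↔ chq q (absNorm p.asIdeal) = -1 :=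
          ⟨fun h => h.1, fun h => ⟨h, hpw⟩⟩
        simp only [this]
        rcases chq_pm q (absNorm p.asIdeal) (by rwa [prime_dvd_norm q Fact.out]) with h | h
        · rw [h]; norm_num
        · rw [h]; norm_num)
      (by
        rw [if_neg (fun h => h.2 rfl), C.hw, one_mul])
    refine ⟨d, Or.inr rfl, b, hb0, hb1, hb3, ?_⟩
    intro y z U V hyz hUV
    obtain ⟨A, B, C', D, e, he, hdec⟩ := C.dec η hη _ U V hUV
    rw [C.caseI b hb0 hb1 y z A B C' D e he hyz hdec] at hb2
    exact absurd hb2 (by decide)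
  · -- case II
    obtain ⟨b, hb0, hb1, hb2, hb3⟩ := C.exists_b q t (Or.inl hc) h2
      (by
        rintro ⟨s, hs⟩
        exact h1 ⟨s / q, by field_simp; linear_combination hs⟩)
      (by rwa [← mul_assoc, mul_comm (d : K)])
      (by
        rintro ⟨s, hs⟩
        exact h3 ⟨s / q, by field_simp; linear_combination hs⟩)
      (chq q * chq q) (by
        intro n
        change |chq q n * chq q n| ≤ 1
        rw [abs_mul]
        exact mul_le_one₀ (chq_abs q n) (abs_nonneg _) (chq_abs q n))
      (by
        intro F _ _ γ δ
        change chq q _ * chq q _ = chq q _ * chq q _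
        rw [chq_per q C.hq8])
      (by
        intro n hn
        exact hz n (left_ne_zero_of_mul (b := chq q n) hn)) {w} (by
        intro p hpw hqp
        rw [if_neg (show p ∉ ({w} : Set (HeightOneSpectrum (𝓞 K))) from hpw), one_mul]
        change chq q _ * chq q _ = 1
        exact chq_sq q _ (by rwa [prime_dvd_norm q Fact.out])) (by
        rw [if_pos (Set.mem_singleton w)]
        change -1 * (chq q _ * chq q _) = -1
        rw [C.hw]; norm_num)
    refine ⟨q, Or.inl rfl, b, hb0, hb1, hb3, ?_⟩
    intro y z U V hyz hUV
    obtain ⟨A, B, C', D, e, he, hdec⟩ := C.dec η hη _ U V hUV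
    rw [C.caseII b hb0 y z A B C' D e he hyz hdec] at hb2
    exact absurd hb2 (by decide)

end core

end P17
end NSq
end WrapPart17

section WrapPart18
open NumberField NumberField.InfinitePlace NumberField.Units Module nonZeroDivisors Ideal Filter Topology
open IsDedekindDomain UniqueFactorizationMonoid
universe u
namespace NSq
section P18
open scoped Classical Pointwise
set_option linter.unusedSectionVars false

section dioph
variable {k : Type*} [Field k] {ι : Type*} [Fintype ι]

lemma dioph_of {σ : Type*} [Fintype σ] (S : Set (ι → k)) (f : MvPolynomial (ι ⊕ σ) k)
    (h : ∀ a : ι → k, a ∈ S ↔ ∃ x : σ → k, MvPolynomial.eval (Sum.elim a x) f = 0) : IsDiophantine S := by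
  let e := Fintype.equivFin σ
  refine ⟨Fintype.card σ, MvPolynomial.rename (Sum.map id e) f, fun a => ?_⟩
  rw [h a]
  have key : ∀ x : Fin (Fintype.card σ) → k, Sum.elim a x ∘ Sum.map id e = Sum.elim a (x ∘ e) := by
    intro x; ext i; cases i <;> rfl
  constructor
  · rintro ⟨x, hx⟩
    refine ⟨x ∘ e.symm, ?_⟩
    rw [MvPolynomial.eval_rename, key]
    have : (x ∘ e.symm) ∘ e = x := by ext i; simp
    rw [this, hx]
  · rintro ⟨x, hx⟩
    rw [MvPolynomial.eval_rename, key] at hx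
    exact ⟨_, hx⟩

lemma dioph_empty : IsDiophantine (∅ : Set (ι → k)) :=
  ⟨0, 1, fun a => by simp⟩

lemma dioph_union (S T : Set (ι → k)) (hS : IsDiophantine S) (hT : IsDiophantine T) : IsDiophantine (S ∪ T) := by
  obtain ⟨m, f, hf⟩ := hS
  obtain ⟨n, g, hg⟩ := hT
  apply dioph_of (σ := Fin m ⊕ Fin n) _
    (MvPolynomial.rename (Sum.map id Sum.inl) f * MvPolynomial.rename (Sum.map id Sum.inr) g)
  intro a
  have k1 : ∀ x : Fin m ⊕ Fin n → k, Sum.elim a x ∘ Sum.map id Sum.inl = Sum.elim a (x ∘ Sum.inl) := by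
    intro x; ext i; cases i <;> rfl
  have k2 : ∀ x : Fin m ⊕ Fin n → k, Sum.elim a x ∘ Sum.map id Sum.inr = Sum.elim a (x ∘ Sum.inr) := by
    intro x; ext i; cases i <;> rfl
  simp only [map_mul, MvPolynomial.eval_rename, k1, k2, mul_eq_zero]
  rw [Set.mem_union, hf, hg]
  constructor
  · rintro (⟨x, hx⟩ | ⟨x, hx⟩)
    · exact ⟨Sum.elim x 0, Or.inl (by simpa using hx)⟩
    · exact ⟨Sum.elim 0 x, Or.inr (by simpa using hx)⟩
  · rintro ⟨x, hx | hx⟩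
    · exact Or.inl ⟨_, hx⟩
    · exact Or.inr ⟨_, hx⟩

lemma dioph_biUnion {τ : Type*} (Λ : Set τ) (hΛ : Λ.Finite) (S : τ → Set (ι → k)) (h : ∀ l, IsDiophantine (S l)) :
    IsDiophantine {a | ∃ l ∈ Λ, a ∈ S l} := by
  induction Λ, hΛ using Set.Finite.induction_on with
  | empty =>
    convert dioph_empty (k := k) (ι := ι) using 1
    ext a; simp
  | @insert b s _ _ ih =>
    convert dioph_union _ _ (h b) ih using 1
    ext a; simp

lemma aniso (d : k) (hd : ¬ ∃ s : k, d = s ^ 2) (X Y : k) : X ^ 2 - d * Y ^ 2 = 0 ↔ X = 0 ∧ Y = 0 := by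
  constructor
  · intro h
    have hY : Y = 0 := by
      by_contra hY
      exact hd ⟨X / Y, by field_simp; linear_combination -h⟩
    subst hY
    refine ⟨?_, rfl⟩
    have : X ^ 2 = 0 := by linear_combination h
    exact pow_eq_zero_iff (two_ne_zero) |>.1 this
  · rintro ⟨rfl, rfl⟩; ring

/-- simple sets -/
lemma dioph_simple (d : k) (hd : ¬ ∃ s : k, d = s ^ 2) (c : k) :
    IsDiophantine {a : Fin 2 → k | a 0 ≠ 0 ∧ a 1 ≠ 0 ∧ ∃ s, c * (-(a 0 * a 1)) = s ^ 2} := by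
  apply dioph_of (σ := Fin 2) _
    (((MvPolynomial.X (Sum.inl 0) * MvPolynomial.X (Sum.inl 1) * MvPolynomial.X (Sum.inr 0) - 1) ^ 2
      - MvPolynomial.C d * (MvPolynomial.C c * (-(MvPolynomial.X (Sum.inl 0) * MvPolynomial.X (Sum.inl 1))) - MvPolynomial.X (Sum.inr 1) ^ 2) ^ 2
      : MvPolynomial (Fin 2 ⊕ Fin 2) k))
  intro a
  simp only [map_sub, map_mul, map_pow, map_neg, map_one, MvPolynomial.eval_X, MvPolynomial.eval_C, Sum.elim_inl, Sum.elim_inr]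
  simp only [aniso d hd]
  rw [Set.mem_ofPred_eq]
  constructor
  · rintro ⟨h0, h1, s, hs⟩
    refine ⟨![(a 0 * a 1)⁻¹, s], ?_, ?_⟩
    · change a 0 * a 1 * (a 0 * a 1)⁻¹ - 1 = 0
      rw [mul_inv_cancel₀ (mul_ne_zero h0 h1), sub_self]
    · simp [← hs]
  · rintro ⟨x, h1, h2⟩
    refine ⟨?_, ?_, x 1, by linear_combination h2⟩
    · intro h; rw [h] at h1; simp at h1
    · intro h; rw [h] at h1; simp at h1

/-- the certificate relation -/
def cert (q d a k0 k1 x : k) (y z u0 u1 v0 v1 : k) : Prop :=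
  y ^ 2 - a * x * z ^ 2 ≠ 0 ∧
  y ^ 2 - a * x * z ^ 2 = k0 * (u0 ^ 2 + d * u1 ^ 2 - q * (v0 ^ 2 + d * v1 ^ 2)) + d * k1 * (2 * (u0 * u1 - q * v0 * v1)) ∧
  k0 * (2 * (u0 * u1 - q * v0 * v1)) + k1 * (u0 ^ 2 + d * u1 ^ 2 - q * (v0 ^ 2 + d * v1 ^ 2)) = 0

open MvPolynomial in
lemma dioph_cert (q d : k) (hd : ¬ ∃ s : k, d = s ^ 2) (a k0 k1 : k) :
    IsDiophantine {α : Fin 2 → k | α 0 ≠ 0 ∧ α 1 ≠ 0 ∧ ∃ y z u0 u1 v0 v1, cert q d a k0 k1 (-(α 0 * α 1)) y z u0 u1 v0 v1} := by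
  let A : MvPolynomial (Fin 2 ⊕ Fin 8) k := X (Sum.inl 0)
  let B : MvPolynomial (Fin 2 ⊕ Fin 8) k := X (Sum.inl 1)
  let x : Fin 8 → MvPolynomial (Fin 2 ⊕ Fin 8) k := fun i => X (Sum.inr i)
  let N : MvPolynomial (Fin 2 ⊕ Fin 8) k := x 2 ^ 2 - C a * (-(A * B)) * x 3 ^ 2
  let R : MvPolynomial (Fin 2 ⊕ Fin 8) k := x 4 ^ 2 + C d * x 5 ^ 2 - C q * (x 6 ^ 2 + C d * x 7 ^ 2)
  let I : MvPolynomial (Fin 2 ⊕ Fin 8) k := C 2 * (x 4 * x 5 - C q * x 6 * x 7)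
  apply dioph_of (σ := Fin 8) _
    (((A * B * x 0 - 1) ^ 2 - C d * (N * x 1 - 1) ^ 2) ^ 2
      - C d * ((N - (C k0 * R + C d * C k1 * I)) ^ 2 - C d * (C k0 * I + C k1 * R) ^ 2) ^ 2)
  intro α
  simp only [A, B, x, N, R, I, map_sub, map_add, map_mul, map_pow, map_neg, map_one, eval_X, eval_C, Sum.elim_inl, Sum.elim_inr]
  simp only [aniso d hd]
  rw [Set.mem_ofPred_eq]
  unfold cert
  constructor
  · rintro ⟨h0, h1, y, z, u0, u1, v0, v1, h2, h3, h4⟩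
    refine ⟨![(α 0 * α 1)⁻¹, (y ^ 2 - a * (-(α 0 * α 1)) * z ^ 2)⁻¹, y, z, u0, u1, v0, v1], ⟨?_, ?_⟩, ?_, ?_⟩
    · change α 0 * α 1 * (α 0 * α 1)⁻¹ - 1 = 0
      rw [mul_inv_cancel₀ (mul_ne_zero h0 h1), sub_self]
    · change (y ^ 2 - a * (-(α 0 * α 1)) * z ^ 2) * (y ^ 2 - a * (-(α 0 * α 1)) * z ^ 2)⁻¹ - 1 = 0
      rw [mul_inv_cancel₀ h2, sub_self]
    · exact sub_eq_zero.2 h3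
    · exact h4
  · rintro ⟨x, ⟨h1, h2⟩, h3, h4⟩
    refine ⟨?_, ?_, x 2, x 3, x 4, x 5, x 6, x 7, ?_, sub_eq_zero.1 h3, h4⟩
    · intro h; rw [h] at h1; simp at h1
    · intro h; rw [h] at h1; simp at h1
    · intro h; rw [h] at h2; simp at h2

end dioph

variable {K : Type u} [Field K] [NumberField K]

lemma cert_iff {L : Type*} [Field L] [Algebra K L] (q d : K) (hd : ¬ ∃ s : K, d = s ^ 2) (η : L)
    (hη : η ^ 2 = algebraMap K L d) (a k0 k1 x y z u0 u1 v0 v1 : K) :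
    cert q d a k0 k1 x y z u0 u1 v0 v1 ↔ y ^ 2 - a * x * z ^ 2 ≠ 0 ∧
      algebraMap K L (y ^ 2 - a * x * z ^ 2) = (algebraMap K L k0 + algebraMap K L k1 * η) *
        ((algebraMap K L u0 + algebraMap K L u1 * η) ^ 2 - algebraMap K L q * (algebraMap K L v0 + algebraMap K L v1 * η) ^ 2) := by
  unfold cert
  rw [expand q d η hη]
  generalize u0 ^ 2 + d * u1 ^ 2 - q * (v0 ^ 2 + d * v1 ^ 2) = R
  generalize 2 * (u0 * u1 - q * v0 * v1) = I
  generalize y ^ 2 - a * x * z ^ 2 = N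
  have key : (algebraMap K L k0 + algebraMap K L k1 * η) * (algebraMap K L R + algebraMap K L I * η) =
      algebraMap K L (k0 * R + d * k1 * I) + algebraMap K L (k0 * I + k1 * R) * η := by
    simp only [map_add, map_mul, ← hη]; ring
  rw [key]
  apply and_congr_right
  intro _
  constructor
  · rintro ⟨h1, h2⟩
    rw [h2, ← h1]; simp
  · intro h
    obtain ⟨h1, h2⟩ := coord_zero d hd η hη (N - (k0 * R + d * k1 * I)) (-(k0 * I + k1 * R)) (by
      rw [map_sub, map_neg]; linear_combination h)
    exact ⟨sub_eq_zero.1 h1, neg_eq_zero.1 h2⟩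

theorem main_char (K : Type u) [Field K] [NumberField K] :
    ∃ (q d : K) (Λ : Set (K × K × K)), Λ.Finite ∧ (¬ ∃ s : K, d = s ^ 2) ∧
      ∀ x : K, x ≠ 0 → ((¬ ∃ s : K, x = s ^ 2) ↔
        (∃ s, q * x = s ^ 2) ∨ (∃ s, d * x = s ^ 2) ∨ (∃ s, (q * d) * x = s ^ 2) ∨
          ∃ l ∈ Λ, ∃ y z u0 u1 v0 v1, cert q d l.1 l.2.1 l.2.2 x y z u0 u1 v0 v1) := by
  obtain ⟨q, d, _, _, w, C⟩ := exists_cst K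
  obtain ⟨L, _, _, _, _, η, hη⟩ := exists_quad (d : K) C.hd
  have hqL : ¬ ∃ s : L, (q : L) = s ^ 2 := by
    have := sq_in_quad (d : K) C.hd η hη (q : K) C.hq C.hqd
    simpa using this
  obtain ⟨M, _, _, _, _, δ, hδ⟩ := exists_quad (q : L) hqL
  obtain ⟨Ω, hΩ, hΩ0, hΩ1⟩ := lemA (K := K) q d C.hq8 C.hd8 hqL η (by simpa using hη) δ (by simpa using hδ) w
  -- coordinates of Ω
  let Ξ : Set (K × K) := {p | algebraMap K L p.1 + algebraMap K L p.2 * η ∈ Ω}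
  have hΞ : Ξ.Finite := by
    apply hΩ.preimage
    rintro ⟨a, b⟩ - ⟨a', b'⟩ - h
    simp only at h
    obtain ⟨h1, h2⟩ := coord_zero (d : K) C.hd η hη (a - a') (b - b') (by
      rw [map_sub, map_sub]; linear_combination h)
    rw [sub_eq_zero.1 h1, sub_eq_zero.1 h2]
  let Λ : Set (K × K × K) := {l | l ∈ ({(q : K), (d : K)} : Set K) ×ˢ Ξ ∧
    ¬ ∃ y z u0 u1 v0 v1, cert (q : K) d l.1 l.2.1 l.2.2 1 y z u0 u1 v0 v1}
  have hΛ : Λ.Finite := by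
    apply Set.Finite.subset (Set.Finite.prod ((Set.finite_singleton _).insert _) hΞ)
    intro l hl; exact hl.1
  refine ⟨q, d, Λ, hΛ, C.hd, ?_⟩
  intro x hx
  have aux : ∀ c : K, (¬ ∃ s : K, c = s ^ 2) → (∃ s, c * x = s ^ 2) → ¬ ∃ s : K, x = s ^ 2 := by
    rintro c hc ⟨s, hs⟩ ⟨r, rfl⟩
    have hr : r ≠ 0 := by rintro rfl; simp at hx
    exact hc ⟨s / r, by field_simp; linear_combination hs⟩
  constructor
  · intro hns
    by_contra hcon
    push Not at hcon
    obtain ⟨n1, n2, n3, n4⟩ := hcon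
    obtain ⟨t, s, hs, rfl, ht⟩ := normal_form w x hx
    have aux2 : ∀ c : K, (∀ r : K, c * (algebraMap (𝓞 K) K t * s ^ 2) ≠ r ^ 2) →
        ¬ ∃ r : K, c * algebraMap (𝓞 K) K t = r ^ 2 := by
      rintro c hc ⟨r, hr⟩
      exact hc (r * s) (by rw [← mul_assoc, hr]; ring)
    obtain ⟨a, ha, b, hb0, hb1, ⟨y, z, hyz⟩, hb2⟩ := C.complete η hη t ht (by
      rintro ⟨r, hr⟩
      exact hns ⟨r * s, by rw [hr]; ring⟩) (aux2 _ n1) (aux2 _ n2) (aux2 _ n3)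
    obtain ⟨κ, hκ, u, v, huv⟩ := hΩ1 _ ⟨b, hb0, hb1, rfl⟩
    obtain ⟨k0, k1, rfl⟩ := quad_rep (d : K) C.hd η hη κ
    obtain ⟨u0, u1, rfl⟩ := quad_rep (d : K) C.hd η hη u
    obtain ⟨v0, v1, rfl⟩ := quad_rep (d : K) C.hd η hη v
    have hbK : algebraMap (𝓞 K) K b ≠ 0 := by simpa using hb0
    have huv' : algebraMap K L (algebraMap (𝓞 K) K b) = (algebraMap K L k0 + algebraMap K L k1 * η) *
        ((algebraMap K L u0 + algebraMap K L u1 * η) ^ 2 - algebraMap K L (q : K) * (algebraMap K L v0 + algebraMap K L v1 * η) ^ 2) := by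
      rw [map_natCast]; exact huv
    refine n4 ((a : K), k0, k1) ⟨⟨?_, hκ⟩, ?_⟩ y (z / s) u0 u1 v0 v1 ?_
    · rcases ha with rfl | rfl
      · left; rfl
      · right; rfl
    · rintro ⟨y', z', u0', u1', v0', v1', hc⟩
      rw [cert_iff _ _ C.hd η hη] at hc
      obtain ⟨hc1, hc2⟩ := hc
      simp only [mul_one] at hc1 hc2
      have m1 : algebraMap K L (algebraMap (𝓞 K) K b) * algebraMap K L (y' ^ 2 - a * z' ^ 2) ∈ NF (q : L) := by
        rw [huv', hc2]
        have e1 : (algebraMap K L k0 + algebraMap K L k1 * η) *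
            ((algebraMap K L u0 + algebraMap K L u1 * η) ^ 2 - algebraMap K L (q : K) * (algebraMap K L v0 + algebraMap K L v1 * η) ^ 2) ≠ 0 := by
          rw [← huv']; exact (map_ne_zero _).2 hbK
        have e2 : (algebraMap K L k0 + algebraMap K L k1 * η) *
            ((algebraMap K L u0' + algebraMap K L u1' * η) ^ 2 - algebraMap K L (q : K) * (algebraMap K L v0' + algebraMap K L v1' * η) ^ 2) ≠ 0 := by
          rw [← hc2]; exact (map_ne_zero _).2 hc1
        rw [map_natCast] at e1 e2 ⊢
        have f1 := NF_sq (q : L) (left_ne_zero_of_mul e1)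
        have f2 : _ ∈ NF (q : L) := ⟨right_ne_zero_of_mul e1, _, _, rfl⟩
        have f3 : _ ∈ NF (q : L) := ⟨right_ne_zero_of_mul e2, _, _, rfl⟩
        have f4 := NF_mul _ f1 (NF_mul _ f2 f3)
        convert f4 using 1
        ring
      obtain ⟨-, U, V, hUV⟩ := m1
      rw [← map_mul] at hUV
      exact hb2 y' z' U V hc1 hUV
    · rw [cert_iff _ _ C.hd η hη]
      have e3 : y ^ 2 - (a : K) * (algebraMap (𝓞 K) K t * s ^ 2) * (z / s) ^ 2 = algebraMap (𝓞 K) K b := by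
        rw [hyz]; field_simp
      simp only [e3]
      exact ⟨hbK, huv'⟩
  · rintro (h | h | h | ⟨l, hl, y, z, u0, u1, v0, v1, hc⟩)
    · exact aux _ C.hq h
    · exact aux _ C.hd h
    · exact aux _ C.hqd h
    · rintro ⟨s, rfl⟩
      apply hl.2
      refine ⟨y, s * z, u0, u1, v0, v1, ?_⟩
      unfold cert at hc ⊢
      have e : y ^ 2 - l.1 * 1 * (s * z) ^ 2 = y ^ 2 - l.1 * s ^ 2 * z ^ 2 := by ring
      rw [e]; exact hc

theorem main_thm (K : Type u) [Field K] [NumberField K] :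
    IsDiophantine {a : Fin 2 → K | a 0 ≠ 0 ∧ a 1 ≠ 0 ∧ ¬ ∃ s : K, -(a 0 * a 1) = s ^ 2} := by
  obtain ⟨q, d, Λ, hΛ, hd, hmain⟩ := main_char K
  have h := dioph_union _ _ (dioph_simple d hd q) (dioph_union _ _ (dioph_simple d hd d)
    (dioph_union _ _ (dioph_simple d hd (q * d))
      (dioph_biUnion Λ hΛ _ (fun l => dioph_cert q d hd l.1 l.2.1 l.2.2))))
  convert h using 1
  ext a
  simp only [Set.mem_union, Set.mem_ofPred_eq]
  by_cases h0 : a 0 = 0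
  · simp [h0]
  by_cases h1 : a 1 = 0
  · simp [h1]
  have := hmain (-(a 0 * a 1)) (neg_ne_zero.2 (mul_ne_zero h0 h1))
  simp only [ne_eq, h0, h1, not_false_eq_true, true_and]
  exact this

end P18
end NSq
end WrapPart18

/-- Over a number field `K`, the set of pairs `(a₁, a₂) ∈ (Kˣ)²` such that `−a₁a₂` is not a
square in `K` is diophantine over `K`. -/
theorem nonsquare_product_diophantine_numberField
    (K : Type*) [Field K] [NumberField K] :
    IsDiophantine {a : Fin 2 → K |
      a 0 ≠ 0 ∧ a 1 ≠ 0 ∧ ¬ ∃ s : K, -(a 0 * a 1) = s ^ 2} := by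
  exact NSq.main_thm K
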